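/- arXiv:2506.09605 — 3 statements merged into one kernel-verified Lean document; each statement's English description precedes it below -/
import Mathlib

section
/- Let $K = \mathbb{Q}(\sqrt{-5})$ with ring of integers $\mathcal{O}_K = \mathbb{Z}[\sqrt{-5}]$. For every nonzero prime ideal $\mathfrak{p}$ of $\mathcal{O}_K$ with $\mathfrak{p} \neq (2, 1+\sqrt{-5})$, the ideal $\mathfrak{p}$ is principal if and only if the polynomial $X^2 + 1$ splits into two distinct linear factors over the residue field $\mathcal{O}_K/\mathfrak{p}$. -/
open NumberField Polynomial

theorem nt_rep (n : ℕ) : ∀ (m t : ℤ), 0 < m → m.toNat = n → m ∣ t^2+5 →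
    ∃ x y : ℤ, (x^2+5*y^2 = m ∨ x^2+5*y^2 = 2*m) ∧ m ∣ x + t*y := by
  induction n using Nat.strong_induction_on with
  | _ n ih =>
    intro m t hm hn hd
    by_cases h3 : m < 3
    · have : m = 1 ∨ m = 2 := by omega
      rcases this with rfl | rfl
      · exact ⟨1, 0, by norm_num, one_dvd _⟩
      · exact ⟨2, 0, by norm_num, by norm_num⟩
    · obtain ⟨s, k, hs, hlo, hhi⟩ : ∃ s k : ℤ, t = s + m*k ∧ -m ≤ 2*s ∧ 2*s ≤ m := by
        have h1 := Int.emod_add_mul_ediv t m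
        have h2 := Int.emod_nonneg t hm.ne'
        have h4 := Int.emod_lt_of_pos t hm
        by_cases h : 2*(t % m) ≤ m
        · exact ⟨t % m, t / m, h1.symm, by omega, h⟩
        · exact ⟨t % m - m, t / m + 1, by linear_combination -h1, by omega, by omega⟩
      have hd' : m ∣ s^2+5 := by
        have : s^2+5 = (t^2+5) - m*(k*(2*s+m*k)) := by rw [hs]; ring
        rw [this]; exact dvd_sub hd (dvd_mul_right _ _)
      obtain ⟨m', hm'⟩ := hd'
      have hpos : 0 < m' := by
        have : 0 < m*m' := by rw [← hm']; positivity
        exact pos_of_mul_pos_right this hm.le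
      have hlt : m' < m := by
        by_contra hc
        have : m*m ≤ m*m' := by apply mul_le_mul_of_nonneg_left (by omega) hm.le
        nlinarith
      obtain ⟨x, y, hxy, c, hc⟩ := ih m'.toNat (by omega) m' (-s) hpos rfl ⟨m, by linear_combination hm'⟩
      have hx : x = m'*c + s*y := by linear_combination hc
      refine ⟨-(c*s+m*y), c, ?_, ?_⟩
      · have key : m' * ((-(c*s+m*y))^2+5*c^2) = m * (x^2+5*y^2) := by
          rw [hx]
          linear_combination (m' * c^2 - m * y^2) * hm'
        rcases hxy with h | h
        · left
          apply mul_left_cancel₀ hpos.ne'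
          rw [key, h]; ring
        · right
          apply mul_left_cancel₀ hpos.ne'
          rw [key, h]; ring
      · exact ⟨-y + k*c, by rw [hs]; ring⟩

theorem nt_rep' (q t : ℤ) (hq : 0 < q) (h4 : q % 4 = 1) (hd : q ∣ t^2+5) :
    ∃ x y : ℤ, x^2+5*y^2 = q ∧ q ∣ x + t*y := by
  obtain ⟨x, y, h, h'⟩ := nt_rep _ q t hq rfl hd
  rcases h with h | h
  · exact ⟨x, y, h, h'⟩
  · exfalso
    have h8 : (x^2+5*y^2) % 8 = 2 := by omega
    have hx : x % 8 = 0 ∨ x % 8 = 1 ∨ x % 8 = 2 ∨ x % 8 = 3 ∨ x % 8 = 4 ∨ x % 8 = 5 ∨ x % 8 = 6 ∨ x % 8 = 7 := by omega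
    have hy : y % 8 = 0 ∨ y % 8 = 1 ∨ y % 8 = 2 ∨ y % 8 = 3 ∨ y % 8 = 4 ∨ y % 8 = 5 ∨ y % 8 = 6 ∨ y % 8 = 7 := by omega
    rcases hx with h | h | h | h | h | h | h | h <;> rcases hy with h' | h' | h' | h' | h' | h' | h' | h' <;>
      simp [pow_two, Int.add_emod, Int.mul_emod, h, h'] at h8

section
set_option linter.unusedSectionVars false
variable {R : Type*} [CommRing R] [IsDomain R] [CharZero R] {a : R}

theorem coords_zero (ha : a^2 = -5) {x y : ℤ} (h : (x:R) + y*a = 0) : x = 0 ∧ y = 0 := by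
  have h1 : ((x^2+5*y^2 : ℤ) : R) = 0 := by
    push_cast
    linear_combination (x - y*a) * h + (y:R)^2 * ha
  have h2 : x^2+5*y^2 = 0 := by exact_mod_cast h1
  constructor <;> nlinarith [sq_nonneg x, sq_nonneg y]

theorem coords_inj (ha : a^2 = -5) {x y u v : ℤ} (h : (x:R) + y*a = u + v*a) : x = u ∧ y = v := by
  have := coords_zero (x := x-u) (y := y-v) ha (by push_cast; linear_combination h)
  omega

theorem exists_prime_under (ha : a^2 = -5) (hspan : ∀ z : R, ∃ x y : ℤ, z = x + y*a)
    (p : Ideal R) (hp : p.IsPrime) (hp0 : p ≠ ⊥) :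
    ∃ q : ℕ, q.Prime ∧ ∀ n : ℤ, (n:R) ∈ p ↔ (q:ℤ) ∣ n := by
  obtain ⟨g, hg⟩ := (IsPrincipalIdealRing.principal (p.comap (Int.castRingHom R))).principal
  have hg' : ∀ n : ℤ, (n:R) ∈ p ↔ g ∣ n := by
    intro n
    have : n ∈ p.comap (Int.castRingHom R) ↔ n ∈ Ideal.span {g} := by rw [hg]
    rw [Ideal.mem_span_singleton] at this
    simpa using this
  have hprime : Prime g := by
    have hg0 : g ≠ 0 := by
      rintro rfl
      obtain ⟨z, hz, hz0⟩ := Submodule.exists_mem_ne_zero_of_ne_bot hp0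
      obtain ⟨x, y, rfl⟩ := hspan z
      have h1 : ((x^2+5*y^2 : ℤ) : R) ∈ p := by
        have : ((x^2+5*y^2 : ℤ) : R) = (x - y*a) * (x+y*a) := by
          push_cast; linear_combination (y:R)^2 * ha
        rw [this]; exact p.mul_mem_left _ hz
      rw [hg', zero_dvd_iff] at h1
      have hx : x = 0 := by nlinarith [sq_nonneg x, sq_nonneg y]
      have hy : y = 0 := by nlinarith [sq_nonneg x, sq_nonneg y]
      apply hz0; simp [hx, hy]
    have : (Ideal.span {g}).IsPrime := by
      have h2 : p.comap (Int.castRingHom R) = Ideal.span {g} := hg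
      rw [← h2]; exact Ideal.comap_isPrime _ _
    exact (Ideal.span_singleton_prime hg0).1 this
  refine ⟨g.natAbs, Int.prime_iff_natAbs_prime.1 hprime, fun n => ?_⟩
  rw [hg', Int.natAbs_dvd]

theorem splits_iff (p : Ideal R) (hp : p.IsPrime) (h2 : ((2:ℤ):R) ∉ p) :
    (∃ x y : R ⧸ p, x ≠ y ∧
        (X ^ 2 + 1 : Polynomial (R ⧸ p)) =
          ((X : Polynomial (R ⧸ p)) - C x) * ((X : Polynomial (R ⧸ p)) - C y)) ↔
    ∃ w : R, w^2+1 ∈ p := by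
  constructor
  · rintro ⟨x, y, -, h⟩
    obtain ⟨w, rfl⟩ := Ideal.Quotient.mk_surjective x
    refine ⟨w, ?_⟩
    have := congrArg (Polynomial.eval (Ideal.Quotient.mk p w)) h
    simp at this
    rw [← Ideal.Quotient.eq_zero_iff_mem]
    simpa using this
  · rintro ⟨w, hw⟩
    have hw' : (Ideal.Quotient.mk p w)^2 + 1 = 0 := by
      rw [← Ideal.Quotient.eq_zero_iff_mem] at hw
      simpa using hw
    refine ⟨Ideal.Quotient.mk p w, -Ideal.Quotient.mk p w, ?_, ?_⟩
    · intro h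
      apply h2
      rw [← Ideal.Quotient.eq_zero_iff_mem]
      simp only [Int.cast_ofNat, map_ofNat]
      linear_combination (-(Ideal.Quotient.mk p w)) * h + 2 * hw'
    · have := congrArg (C : (R ⧸ p) → (R ⧸ p)[X]) hw'
      simp only [map_add, map_pow, map_one, map_zero] at this
      simp only [map_neg]
      linear_combination this

theorem two_case (ha : a^2 = -5) (hspan : ∀ z : R, ∃ x y : ℤ, z = x + y*a)
    (p : Ideal R) (hp : p.IsPrime) (hne : p ≠ Ideal.span {2, 1 + a}) : ((2:ℤ):R) ∉ p := by
  intro h2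
  have h2' : (2:R) ∈ p := by simpa using h2
  have h1 : 1 + a ∈ p := by
    apply hp.mem_of_pow_mem 2
    have : (1+a)^2 = (a-2)*2 := by linear_combination ha
    rw [this]; exact p.mul_mem_left _ h2'
  apply hne
  apply le_antisymm
  · intro z hz
    obtain ⟨x, y, rfl⟩ := hspan z
    rw [Ideal.mem_span_pair]
    have h3 : ((x - y : ℤ) : R) ∈ p := by
      have : ((x - y : ℤ) : R) = (x + y*a) - y*(1+a) := by push_cast; ring
      rw [this]; exact p.sub_mem hz (p.mul_mem_left _ h1)
    rcases Int.even_or_odd' (x-y) with ⟨k, hk | hk⟩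
    · refine ⟨k, y, ?_⟩
      have : (x:R) - y = 2*k := by exact_mod_cast congrArg (Int.cast : ℤ → R) hk
      linear_combination -this
    · exfalso
      apply hp.ne_top
      rw [Ideal.eq_top_iff_one]
      have : (1:R) = ((x-y:ℤ):R) - k*2 := by rw [hk]; push_cast; ring
      rw [this]; exact p.sub_mem h3 (p.mul_mem_left _ h2')
  · rw [Ideal.span_le]
    rintro z (rfl | rfl)
    · exact h2'
    · exact h1

theorem main_aux (ha : a^2 = -5) (hspan : ∀ z : R, ∃ x y : ℤ, z = x + y*a)
    (p : Ideal R) (hp : p.IsPrime) (hp0 : p ≠ ⊥) (hne : p ≠ Ideal.span {2, 1 + a}) :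
    Submodule.IsPrincipal p ↔ ∃ w : R, w^2+1 ∈ p := by
  have h2 := two_case ha hspan p hp hne
  obtain ⟨q, hq, hqp⟩ := exists_prime_under ha hspan p hp hp0
  have hqm : ((q:ℤ):R) ∈ p := (hqp q).2 dvd_rfl
  have hq2 : q ≠ 2 := by rintro rfl; exact h2 hqm
  have hodd : q % 2 = 1 := hq.eq_two_or_odd.resolve_left hq2
  have : Fact q.Prime := ⟨hq⟩
  by_cases hc : ∃ t : ℤ, a - t ∈ p
  · obtain ⟨t, ht⟩ := hc
    have htq : (q:ℤ) ∣ t^2+5 := by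
      rw [← hqp]
      have : ((t^2+5:ℤ):R) = -(a+t)*(a-t) := by push_cast; linear_combination ha
      rw [this]; exact p.mul_mem_left _ ht
    have hmem : ∀ x y : ℤ, (x:R) + y*a ∈ p ↔ (q:ℤ) ∣ x + t*y := by
      intro x y
      rw [← hqp]
      have : (x:R) + y*a = ((x+t*y:ℤ):R) + y*(a-t) := by push_cast; ring
      rw [this]
      exact p.add_mem_iff_left (p.mul_mem_left _ ht)
    constructor
    · rintro ⟨b, hb⟩
      have hb : p = Ideal.span {b} := hb
      have hbp : b ∈ p := by rw [hb]; exact Ideal.mem_span_singleton_self b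
      obtain ⟨x, y, rfl⟩ := hspan b
      have hN : (q:ℤ) ∣ x^2+5*y^2 := by
        rw [← hqp]
        have : ((x^2+5*y^2 : ℤ) : R) = (x - y*a) * (x+y*a) := by
          push_cast; linear_combination (y:R)^2 * ha
        rw [this]; exact p.mul_mem_left _ hbp
      have hqd : (x:R) + y*a ∣ (q:ℤ) := by rw [← Ideal.mem_span_singleton, ← hb]; exact hqm
      obtain ⟨c, hcc⟩ := hqd
      obtain ⟨u, v, rfl⟩ := hspan c
      obtain ⟨e1, e2⟩ := coords_inj (x := q) (y := 0) (u := x*u-5*y*v) (v := x*v+y*u) ha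
        (by push_cast at hcc ⊢; linear_combination hcc + (y*v:R)*ha)
      have hNN : (x^2+5*y^2)*(u^2+5*v^2) = (q:ℤ)^2 := by
        rw [e1]
        linear_combination (-5*(x*v+y*u))*e2
      obtain ⟨k, hk⟩ := hN
      have hq0 : (q:ℤ) ≠ 0 := by exact_mod_cast hq.ne_zero
      have hkk : k * (u^2+5*v^2) = q := by
        apply mul_left_cancel₀ hq0
        rw [hk] at hNN
        linear_combination hNN
      have hqpr : Prime (q:ℤ) := Nat.prime_iff_prime_int.1 hq
      have hqpos : (0:ℤ) < q := by exact_mod_cast hq.pos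
      have hk0 : 0 < k := by
        by_contra hcon
        have : k ≤ 0 := by omega
        nlinarith [sq_nonneg u, sq_nonneg v]
      have hq4 : q % 4 = 1 := by
        rcases hqpr.irreducible.isUnit_or_isUnit hkk.symm with h | h
        · have : k = 1 := by
            rcases Int.isUnit_iff.1 h with h | h <;> omega
          subst this
          have h8 : (x^2+5*y^2) % 4 = q % 4 := by omega
          have hx : x % 4 = 0 ∨ x % 4 = 1 ∨ x % 4 = 2 ∨ x % 4 = 3 := by omega
          have hy : y % 4 = 0 ∨ y % 4 = 1 ∨ y % 4 = 2 ∨ y % 4 = 3 := by omega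
          rcases hx with h | h | h | h <;> rcases hy with h' | h' | h' | h' <;>
            simp [pow_two, Int.add_emod, Int.mul_emod, h, h'] at h8 <;> omega
        · exfalso
          have h1 : u^2+5*v^2 = 1 := by
            rcases Int.isUnit_iff.1 h with h | h
            · exact h
            · nlinarith [sq_nonneg u, sq_nonneg v]
          have hv : v = 0 := by
            have : v^2 < 1 := by nlinarith [sq_nonneg u]
            nlinarith
          subst hv
          have hu : u ≠ 0 := by rintro rfl; simp at h1
          have hy : y = 0 := by
            have : y * u = 0 := by linarith
            exact (mul_eq_zero.1 this).resolve_right hu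
          subst hy
          rw [hb, Ideal.mem_span_singleton] at ht
          obtain ⟨d, hd⟩ := ht
          obtain ⟨r, s, rfl⟩ := hspan d
          obtain ⟨e3, e4⟩ := coords_inj (x := -t) (y := 1) (u := x*r) (v := x*s) ha
            (by push_cast at hd ⊢; linear_combination hd)
          have hx1 : x ∣ 1 := ⟨s, e4⟩
          have : (q:ℤ) ∣ x^2 := ⟨k, by linear_combination hk⟩
          have := hqpr.dvd_of_dvd_pow this
          exact hqpr.not_isUnit (isUnit_of_dvd_one (this.trans hx1))
      have : IsSquare (-1 : ZMod q) := ZMod.exists_sq_eq_neg_one_iff.2 (by omega)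
      obtain ⟨n, hn⟩ := this
      refine ⟨((n.val : ℤ) : R), ?_⟩
      have h5 : (q:ℤ) ∣ (n.val:ℤ)^2+1 := by
        rw [← ZMod.intCast_zmod_eq_zero_iff_dvd]
        push_cast
        rw [ZMod.natCast_zmod_val]
        linear_combination -hn
      have := (hqp _).2 h5
      exact_mod_cast this
    · rintro ⟨w, hw⟩
      have hq4 : q % 4 ≠ 3 := by
        rw [← ZMod.exists_sq_eq_neg_one_iff]
        obtain ⟨x, y, rfl⟩ := hspan w
        have h5 : (q:ℤ) ∣ (x+t*y)^2+1 := by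
          rw [← hqp]
          have : (((x+t*y)^2+1:ℤ):R) = ((x+y*a)^2+1) - (y*(2*x+y*a+t*y))*(a-t) := by
            push_cast; ring
          rw [this]; exact p.sub_mem hw (p.mul_mem_left _ ht)
        rw [← ZMod.intCast_zmod_eq_zero_iff_dvd] at h5
        refine ⟨((x+t*y:ℤ):ZMod q), ?_⟩
        push_cast at h5 ⊢
        linear_combination -h5
      obtain ⟨x, y, hxy, hd⟩ := nt_rep' q t (by exact_mod_cast hq.pos) (by omega) htq
      refine ⟨(x:R)+y*a, ?_⟩
      change p = Ideal.span {_}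
      apply le_antisymm
      · intro z hz
        rw [Ideal.mem_span_singleton]
        obtain ⟨u, v, rfl⟩ := hspan z
        obtain ⟨d1, hd1⟩ := hd
        obtain ⟨d2, hd2⟩ := (hmem u v).1 hz
        obtain ⟨d3, hd3⟩ := htq
        have hx : x = q*d1 - t*y := by linarith
        have hu : u = q*d2 - t*v := by linarith
        have e1 : u*x+5*v*y = q*(q*d1*d2 - d2*t*y - d1*t*v + d3*v*y) := by
          rw [hx, hu]; linear_combination v*y*hd3
        have e2 : v*x-u*y = q*(d1*v-d2*y) := by rw [hx, hu]; ring
        refine ⟨((q*d1*d2 - d2*t*y - d1*t*v + d3*v*y : ℤ):R) + ((d1*v-d2*y:ℤ):R)*a, ?_⟩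
        have hq0 : ((q:ℤ):R) ≠ 0 := by exact_mod_cast hq.ne_zero
        apply mul_left_cancel₀ hq0
        have e1' := congrArg (Int.cast : ℤ → R) e1
        have e2' := congrArg (Int.cast : ℤ → R) e2
        have e3' := congrArg (Int.cast : ℤ → R) hxy
        push_cast at e1' e2' e3' ⊢
        linear_combination (x+y*a:R)*(e1' + a*e2') - (u+v*a:R)*e3' + (u*y^2 - v*x*y:R)*ha
      · rw [Ideal.span_singleton_le_iff_mem, hmem]; exact hd
  · have hpq : p = Ideal.span {((q:ℤ):R)} := by
      apply le_antisymm
      · intro z hz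
        rw [Ideal.mem_span_singleton]
        obtain ⟨x, y, rfl⟩ := hspan z
        have hqpr : Prime (q:ℤ) := Nat.prime_iff_prime_int.1 hq
        have hy : (q:ℤ) ∣ y := by
          by_contra hy
          obtain ⟨r, s, hrs⟩ := (hqpr.irreducible.coprime_iff_not_dvd.2 hy : IsCoprime (q:ℤ) y)
          apply hc
          refine ⟨-(s*x), ?_⟩
          have e := congrArg (Int.cast : ℤ → R) hrs
          push_cast at e
          have : a - ((-(s*x):ℤ):R) = s*(x+y*a) + (r*a)*((q:ℤ):R) := by
            push_cast; linear_combination -a*e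
          rw [this]
          exact p.add_mem (p.mul_mem_left _ hz) (p.mul_mem_left _ hqm)
        have hx : (q:ℤ) ∣ x := by
          rw [← hqp]
          have h1 : (y:R)*a ∈ p := p.mul_mem_right _ ((hqp y).2 hy)
          exact (p.add_mem_iff_left h1).1 hz
        obtain ⟨m, rfl⟩ := hx
        obtain ⟨n, rfl⟩ := hy
        exact ⟨m+n*a, by push_cast; ring⟩
      · rw [Ideal.span_singleton_le_iff_mem]; exact hqm
    refine ⟨fun _ => ?_, fun _ => ⟨_, hpq⟩⟩
    have toInt : ∀ n : ZMod q, ∃ m : ℤ, (m : ZMod q) = n := fun n => ZMod.intCast_surjective n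
    have h5 : ¬ IsSquare (-5 : ZMod q) := by
      rintro ⟨n, hn⟩
      obtain ⟨m, rfl⟩ := toInt n
      have : (q:ℤ) ∣ m^2+5 := by
        rw [← ZMod.intCast_zmod_eq_zero_iff_dvd]; push_cast; linear_combination -hn
      have h6 : (a - (m:ℤ)) * (a - ((-m:ℤ):R)) ∈ p := by
        have e : (a - (m:ℤ)) * (a - ((-m:ℤ):R)) = -((m^2+5:ℤ):R) := by
          push_cast; linear_combination ha
        rw [e]; exact p.neg_mem ((hqp _).2 this)
      rcases hp.mem_or_mem h6 with h | h
      · exact hc ⟨_, h⟩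
      · exact hc ⟨_, h⟩
    by_cases h1 : IsSquare (-1 : ZMod q)
    · obtain ⟨n, hn⟩ := h1
      obtain ⟨m, rfl⟩ := toInt n
      have : (q:ℤ) ∣ m^2+1 := by
        rw [← ZMod.intCast_zmod_eq_zero_iff_dvd]; push_cast; linear_combination -hn
      exact ⟨m, by exact_mod_cast (hqp _).2 this⟩
    · have h5s : IsSquare (5 : ZMod q) := by
        have h10 : (-1 : ZMod q) ≠ 0 := by intro h; apply h1; rw [h]; exact IsSquare.zero
        have h50 : (-5 : ZMod q) ≠ 0 := by intro h; apply h5; rw [h]; exact IsSquare.zero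
        have hF : ringChar (ZMod q) ≠ 2 := by rwa [ZMod.ringChar_zmod_n]
        have e1 := quadraticChar_neg_one_iff_not_isSquare.2 h1
        have e5 := quadraticChar_neg_one_iff_not_isSquare.2 h5
        have h55 : (5 : ZMod q) ≠ 0 := by intro h; apply h50; rw [h]; simp
        rw [← quadraticChar_one_iff_isSquare h55]
        have : (5 : ZMod q) = (-1) * (-5) := by ring
        rw [this, map_mul, e1, e5]; rfl
      obtain ⟨n, hn⟩ := h5s
      have hn0 : n ≠ 0 := by
        rintro rfl
        apply h5
        rw [hn]; simp
      obtain ⟨m, hm⟩ := toInt n⁻¹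
      have : (q:ℤ) ∣ 5*m^2-1 := by
        rw [← ZMod.intCast_zmod_eq_zero_iff_dvd]; push_cast
        rw [hm, hn]; field_simp; ring
      refine ⟨m*a, ?_⟩
      have e : (m*a:R)^2+1 = -((5*m^2-1:ℤ):R) := by
        push_cast; linear_combination (m:R)^2*ha
      rw [e]; exact p.neg_mem ((hqp _).2 this)
end

section
variable {K : Type*} [Field K] [NumberField K] {α : K}

theorem rat_coords (hα : α ^ 2 = -5) (hgen : IntermediateField.adjoin ℚ {α} = ⊤) (z : K) :
    ∃ r s : ℚ, z = r + s*α := by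
  have hz : z ∈ (IntermediateField.adjoin ℚ {α}).toSubalgebra := by rw [hgen]; trivial
  rw [IntermediateField.adjoin_simple_toSubalgebra_of_isAlgebraic (IsAlgebraic.of_finite ℚ α)] at hz
  induction hz using Algebra.adjoin_induction with
  | mem x hx => rw [Set.mem_singleton_iff] at hx; exact ⟨0, 1, by simp [hx]⟩
  | algebraMap r => exact ⟨r, 0, by simp⟩
  | add x y _ _ hx hy =>
    obtain ⟨r, s, rfl⟩ := hx
    obtain ⟨u, v, rfl⟩ := hy
    exact ⟨r+u, s+v, by push_cast; ring⟩
  | mul x y _ _ hx hy =>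
    obtain ⟨r, s, rfl⟩ := hx
    obtain ⟨u, v, rfl⟩ := hy
    exact ⟨r*u-5*s*v, r*v+s*u, by push_cast; linear_combination (s*v:K)*hα⟩

theorem minpoly_alpha (hα : α ^ 2 = -5) : minpoly ℚ α = X^2+5 := by
  have hm : (X^2+5 : ℚ[X]).Monic := by monicity!
  have hdeg : (X^2+5 : ℚ[X]).natDegree = 2 := by compute_degree!
  symm
  apply minpoly.eq_of_irreducible_of_monic _ _ hm
  · apply Polynomial.irreducible_of_degree_le_three_of_not_isRoot
    · rw [hdeg]; decide
    · intro x hx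
      simp at hx
      nlinarith [sq_nonneg x]
  · have h5 : aeval α (5:ℚ[X]) = 5 := map_ofNat (aeval α) 5
    simp [hα, h5]

theorem exists_conj (hα : α ^ 2 = -5) (hgen : IntermediateField.adjoin ℚ {α} = ⊤) :
    ∃ σ : K →ₐ[ℚ] K, σ α = -α := by
  have hi : IsIntegral ℚ α := (IsAlgebraic.of_finite ℚ α).isIntegral
  have hr : -α ∈ (minpoly ℚ α).aroots K := by
    rw [Polynomial.mem_aroots]
    refine ⟨minpoly.ne_zero hi, ?_⟩
    rw [minpoly_alpha hα]
    have h5 : aeval (-α) (5:ℚ[X]) = 5 := map_ofNat (aeval (-α)) 5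
    simp [hα, h5]
  let f := (IntermediateField.algHomAdjoinIntegralEquiv ℚ (K := K) hi).symm ⟨-α, hr⟩
  have hf : f (IntermediateField.AdjoinSimple.gen ℚ α) = -α :=
    IntermediateField.algHomAdjoinIntegralEquiv_symm_apply_gen ℚ hi _
  refine ⟨f.comp (((IntermediateField.equivOfEq hgen.symm).toAlgHom).comp
    (IntermediateField.topEquiv (F := ℚ) (E := K)).symm.toAlgHom), ?_⟩
  rw [← hf]
  rfl

theorem int_of_integral (r : ℚ) (h : IsIntegral ℤ (r:K)) : ∃ n : ℤ, (n:ℚ) = r := by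
  have : IsIntegral ℤ (algebraMap ℚ K r) := by simpa using h
  rw [isIntegral_algebraMap_iff (algebraMap ℚ K).injective] at this
  obtain ⟨n, hn⟩ := IsIntegrallyClosed.isIntegral_iff.1 this
  exact ⟨n, by simpa using hn⟩

theorem rat_arith (r s : ℚ) (m n : ℤ) (hm : (m:ℚ) = 2*r) (hn : (n:ℚ) = r^2+5*s^2) :
    ∃ x y : ℤ, (x:ℚ) = r ∧ (y:ℚ) = s := by
  have h1 : ∃ k : ℤ, (k:ℚ) = 2*s := by
    have h2 : IsIntegral ℤ (10*s) := by
      refine ⟨X^2 - C (5*(4*n-m^2)), by monicity!, ?_⟩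
      rw [eval₂_sub, eval₂_pow, eval₂_X, eval₂_C]
      simp
      rw [hm, hn]; ring
    obtain ⟨j, hj⟩ := IsIntegrallyClosed.isIntegral_iff.1 h2
    have hj : (j:ℚ) = 10*s := by simpa using hj
    have h3 : j^2 = 5*(4*n-m^2) := by
      have : (j:ℚ)^2 = 5*(4*n-m^2) := by rw [hj, hm, hn]; ring
      exact_mod_cast this
    have h5 : (5:ℤ) ∣ j := by
      have : Prime (5:ℤ) := by norm_num
      exact this.dvd_of_dvd_pow ⟨_, h3⟩
    obtain ⟨k, rfl⟩ := h5
    refine ⟨k, ?_⟩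
    push_cast at hj
    linarith
  obtain ⟨k, hk⟩ := h1
  have h4 : m^2+5*k^2 = 4*n := by
    have : (m:ℚ)^2+5*k^2 = 4*n := by rw [hm, hn, hk]; ring
    exact_mod_cast this
  have h8 : (m^2+5*k^2) % 4 = 0 := by omega
  have hx : m % 4 = 0 ∨ m % 4 = 1 ∨ m % 4 = 2 ∨ m % 4 = 3 := by omega
  have hy : k % 4 = 0 ∨ k % 4 = 1 ∨ k % 4 = 2 ∨ k % 4 = 3 := by omega
  have h9 : m % 2 = 0 ∧ k % 2 = 0 := by
    rcases hx with h | h | h | h <;> rcases hy with h' | h' | h' | h' <;>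
      simp [pow_two, Int.add_emod, Int.mul_emod, h, h'] at h8 <;> omega
  obtain ⟨x, rfl⟩ := Int.dvd_of_emod_eq_zero h9.1
  obtain ⟨y, rfl⟩ := Int.dvd_of_emod_eq_zero h9.2
  push_cast at hm hk
  exact ⟨x, y, by linarith, by linarith⟩

theorem int_coords (hα : α ^ 2 = -5) (hgen : IntermediateField.adjoin ℚ {α} = ⊤)
    (a : 𝓞 K) (ha : (a : K) = α) (z : 𝓞 K) : ∃ x y : ℤ, z = x + y*a := by
  obtain ⟨σ, hσ⟩ := exists_conj hα hgen
  obtain ⟨r, s, hz⟩ := rat_coords hα hgen (z:K)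
  have hi : IsIntegral ℤ (z:K) := z.isIntegral_coe
  have hi' : IsIntegral ℤ (σ (z:K)) := hi.map (σ.restrictScalars ℤ)
  have hσz : σ (z:K) = r - s*α := by
    rw [hz]; simp [hσ]; ring
  obtain ⟨m, hm⟩ := int_of_integral (K := K) (2*r) (by
    have := hi.add hi'
    rw [hσz, hz] at this
    have e : ((2*r:ℚ):K) = r + s*α + (r - s*α) := by push_cast; ring
    rw [e]; exact this)
  obtain ⟨n, hn⟩ := int_of_integral (K := K) (r^2+5*s^2) (by
    have := hi.mul hi'
    rw [hσz, hz] at this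
    have e : ((r^2+5*s^2:ℚ):K) = (r + s*α) * (r - s*α) := by
      push_cast; linear_combination (s:K)^2*hα
    rw [e]; exact this)
  obtain ⟨x, y, rfl, rfl⟩ := rat_arith r s m n hm hn
  refine ⟨x, y, ?_⟩
  apply RingOfIntegers.ext
  rw [hz]
  simp [ha]
end

set_option synthInstance.maxHeartbeats 400000 in
theorem isPrincipal_iff_x_sq_add_one_splits
    (K : Type*) [Field K] [NumberField K]
    (α : K) (hα : α ^ 2 = -5)
    (hgen : IntermediateField.adjoin ℚ {α} = ⊤)
    (a : 𝓞 K) (ha : (a : K) = α)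
    (p : Ideal (𝓞 K)) (hp : p.IsPrime) (hp0 : p ≠ ⊥)
    (hne : p ≠ Ideal.span {2, 1 + a}) :
    Submodule.IsPrincipal p ↔
      ∃ x y : 𝓞 K ⧸ p, x ≠ y ∧
        (X ^ 2 + 1 : Polynomial (𝓞 K ⧸ p)) =
          ((X : Polynomial (𝓞 K ⧸ p)) - C x) * ((X : Polynomial (𝓞 K ⧸ p)) - C y) := by
  have ha2 : a ^ 2 = -5 := by
    apply RingOfIntegers.ext
    rw [← ha] at hα
    have h5 : algebraMap (𝓞 K) K 5 = 5 := map_ofNat (algebraMap (𝓞 K) K) 5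
    simpa [h5] using hα
  have hspan := int_coords hα hgen a ha
  rw [splits_iff p hp (two_case ha2 hspan p hp hne)]
  exact main_aux ha2 hspan p hp hp0 hne
end

section
/- Let $F = \mathbb{Q}(\zeta_{512})$ be the $512$-th cyclotomic field. Then $17$ divides the class number of $F$, i.e., $17$ divides the order of the ideal class group $Cl(\mathcal{O}_F)$. -/
open NumberField

/-! The class group of `ℚ(ζ₅₁₂)` contains an ideal class of order 17.  We exhibit
`δ ∈ ℤ[ζ₆₄]` with `δ * conj δ = 31 ^ 17` and `δ`, `conj δ` coprime, so that `(δ) = I ^ 17`.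
If `I` were principal then `δ ^ 2` would be a root of unity times a seventeenth power
of a fraction; reduction modulo a prime above 87041 shows that this is not the case. -/

namespace Cyc512

variable {R : Type*} [CommRing R]

/-- The element `δ` (a product of conjugates of Eisenstein sums over `𝔽_961`, divided by a
power of 31), as a polynomial in `z = ζ₆₄`. -/
def del (z : R) : R :=
    (818078773545)*z^0 + (-1425058579359)*z^1 + (1067937693489)*z^2 + (919807225747)*z^3
      + (1640287348099)*z^4 + (-583784665645)*z^5 + (-195265559505)*z^6 + (-314613204809)*z^7
      + (-993144011955)*z^8 + (1165417745229)*z^9 + (-525929851827)*z^10 + (490865906055)*z^11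
      + (811793860331)*z^12 + (-325466554483)*z^13 + (113715104263)*z^14 + (338662877381)*z^15
      + (338662877381)*z^17 + (-113715104263)*z^18 + (-325466554483)*z^19 + (-811793860331)*z^20
      + (490865906055)*z^21 + (525929851827)*z^22 + (1165417745229)*z^23 + (993144011955)*z^24
      + (-314613204809)*z^25 + (195265559505)*z^26 + (-583784665645)*z^27
      + (-1640287348099)*z^28 + (919807225747)*z^29 + (-1067937693489)*z^30
      + (-1425058579359)*z^31

/-- The complex conjugate of `δ`. -/
def delBar (z : R) : R :=
    (818078773545)*z^0 + (1425058579359)*z^1 + (1067937693489)*z^2 + (-919807225747)*z^3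
      + (1640287348099)*z^4 + (583784665645)*z^5 + (-195265559505)*z^6 + (314613204809)*z^7
      + (-993144011955)*z^8 + (-1165417745229)*z^9 + (-525929851827)*z^10 + (-490865906055)*z^11
      + (811793860331)*z^12 + (325466554483)*z^13 + (113715104263)*z^14 + (-338662877381)*z^15
      + (-338662877381)*z^17 + (-113715104263)*z^18 + (325466554483)*z^19 + (-811793860331)*z^20
      + (-490865906055)*z^21 + (525929851827)*z^22 + (-1165417745229)*z^23 + (993144011955)*z^24
      + (314613204809)*z^25 + (195265559505)*z^26 + (583784665645)*z^27 + (-1640287348099)*z^28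
      + (-919807225747)*z^29 + (-1067937693489)*z^30 + (1425058579359)*z^31

theorem map_del {S : Type*} [CommRing S] (g : R →+* S) (z : R) : g (del z) = del (g z) := by
  simp only [del, map_add, map_mul, map_neg, map_pow, map_ofNat g]

theorem del_conj (z w : R) (h : z ^ 32 = -1) (hw : w * z = 1) : del w = delBar z := by
  have key : ∀ k : ℕ, k ≤ 32 → w ^ k = - z ^ (32 - k) := by
    intro k hk
    have h1 : w ^ k * z ^ k = 1 := by rw [← mul_pow, hw, one_pow]
    have h2 : z ^ k * z ^ (32 - k) = -1 := by rw [← pow_add, Nat.add_sub_cancel' hk, h]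
    linear_combination w ^ k * h2 - z ^ (32 - k) * h1
  unfold del delBar
  linear_combination (-1425058579359)*key 1 (by norm_num)
    + (1067937693489)*key 2 (by norm_num)
    + (919807225747)*key 3 (by norm_num)
    + (1640287348099)*key 4 (by norm_num)
    + (-583784665645)*key 5 (by norm_num)
    + (-195265559505)*key 6 (by norm_num)
    + (-314613204809)*key 7 (by norm_num)
    + (-993144011955)*key 8 (by norm_num)
    + (1165417745229)*key 9 (by norm_num)
    + (-525929851827)*key 10 (by norm_num)
    + (490865906055)*key 11 (by norm_num)
    + (811793860331)*key 12 (by norm_num)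
    + (-325466554483)*key 13 (by norm_num)
    + (113715104263)*key 14 (by norm_num)
    + (338662877381)*key 15 (by norm_num)
    + (338662877381)*key 17 (by norm_num)
    + (-113715104263)*key 18 (by norm_num)
    + (-325466554483)*key 19 (by norm_num)
    + (-811793860331)*key 20 (by norm_num)
    + (490865906055)*key 21 (by norm_num)
    + (525929851827)*key 22 (by norm_num)
    + (1165417745229)*key 23 (by norm_num)
    + (993144011955)*key 24 (by norm_num)
    + (-314613204809)*key 25 (by norm_num)
    + (195265559505)*key 26 (by norm_num)
    + (-583784665645)*key 27 (by norm_num)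
    + (-1640287348099)*key 28 (by norm_num)
    + (919807225747)*key 29 (by norm_num)
    + (-1067937693489)*key 30 (by norm_num)
    + (-1425058579359)*key 31 (by norm_num)

set_option maxHeartbeats 4000000 in
theorem del_mul_delBar (z : R) (h : z ^ 32 = -1) : del z * delBar z = 31 ^ 17 := by
  unfold del delBar
  linear_combination (
    (-21880863894437851786815886)*z^0 + (-283477637580776796953871)*z^2
      + (6445817797977351782587377)*z^4 + (674064130417554136513253)*z^6
      + (825793825450761569175729)*z^8 + (-62779625610139369592367)*z^10
      + (-4127279164931376819382327)*z^12 + (13550552871954151285157)*z^14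
      + (6968152147261114989140679)*z^16 + (-172505273186079530959513)*z^18
      + (-5455501816193267834869117)*z^20 + (797724470696532105441063)*z^22
      + (2450733895958176004636679)*z^24 + (993549349288411371103703)*z^26
      + (3762049273988930968105467)*z^28 + (-2030791954604691300850881)*z^30) * h

set_option maxHeartbeats 4000000 in
theorem del_add_delBar (z : R) (h : z ^ 32 = -1) :
    ∃ a b : R, (del z + delBar z) * a = 1 + 31 * b := by
  refine ⟨
    (-9)*z^0 + (-3)*z^2 + (3)*z^4 + (-3)*z^6 + (-9)*z^8 + (-11)*z^10 + (14)*z^12 + (-2)*z^14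
      + (2)*z^18 + (-14)*z^20 + (11)*z^22 + (9)*z^24 + (3)*z^26 + (-3)*z^28 + (3)*z^30,
    (3159057996799)*z^0 + (-981866776098)*z^2 + (-3440530574094)*z^4 + (-2118807993972)*z^6
      + (515586475764)*z^8 + (548519437240)*z^10 + (-663242738208)*z^12 + (-811445140080)*z^14
      + (811445140080)*z^18 + (663242738208)*z^20 + (-548519437240)*z^22 + (-515586475764)*z^24
      + (2118807993972)*z^26 + (3440530574094)*z^28 + (981866776098)*z^30, ?_⟩
  unfold del delBar
  linear_combination (
    (-112656215824580)*z^0 + (6306518934966)*z^2 + (75632122011468)*z^4 + (60855257315292)*z^6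
      + (-8226315172614)*z^8 + (-49812430096240)*z^10 + (-25797052068528)*z^12
      + (15098848000952)*z^14 + (71172781144486)*z^16 + (-4736764370614)*z^18
      + (-54651493126278)*z^20 + (-24277331856696)*z^22 + (4605691284690)*z^24
      + (-3434097927660)*z^26 + (-6407626160934)*z^28) * h

theorem isCoprime_del (z : R) (h : z ^ 32 = -1) : IsCoprime (del z) (delBar z) := by
  obtain ⟨a, b, hab⟩ := del_add_delBar z h
  have hm := del_mul_delBar z h
  have h1 : IsCoprime (del z + delBar z) (31 : R) := ⟨a, -b, by linear_combination hab⟩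
  have h2 : IsCoprime (del z + delBar z) (del z * delBar z) := by
    rw [hm]; exact h1.pow_right
  have h3 := h2.of_mul_right_right
  obtain ⟨c, e, hc⟩ := h3
  exact ⟨c, c + e, by linear_combination hc⟩

instance fact_prime : Fact (Nat.Prime 87041) := ⟨by norm_num⟩

theorem root_pow : (65837 : ZMod 87041) ^ 256 = -1 := by decide +kernel

theorem root_ne : (1 : ZMod 87041) ≠ -1 := by decide +kernel

theorem del_val : del ((65837 : ZMod 87041) ^ 8) = 64921 := by
  unfold del; decide +kernel

theorem val_pow : (64921 : ZMod 87041) ^ 10240 ≠ 1 := by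
  have h : (64921 : ZMod 87041) ^ 10240 = 68057 := by
    have e : 10240 = 64 * (32 * 5) := by norm_num
    rw [e, pow_mul, pow_mul]
    decide +kernel
  rw [h]; decide +kernel

theorem root_primitive : IsPrimitiveRoot (65837 : ZMod 87041) 512 := by
  rw [IsPrimitiveRoot.iff_orderOf]
  have : (512 : ℕ) = 2 ^ (8 + 1) := by norm_num
  rw [this]
  apply orderOf_eq_prime_pow
  · rw [show 2 ^ 8 = 256 by norm_num, root_pow]
    exact fun h => root_ne h.symm
  · rw [show 2 ^ (8 + 1) = 256 * 2 by norm_num, pow_mul, root_pow]; norm_num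

variable (F : Type*) [Field F] [NumberField F] [IsCyclotomicExtension {512} ℚ F]

theorem exists_hom (ζ : F) (hζ : IsPrimitiveRoot ζ 512) :
    ∃ f : 𝓞 F →+* ZMod 87041, f hζ.toInteger = 65837 := by
  have hroot : Polynomial.aeval (65837 : ZMod 87041) (minpoly ℤ hζ.integralPowerBasis.gen) = 0 := by
    have hmin : minpoly ℤ hζ.toInteger = Polynomial.cyclotomic 512 ℤ := by
      rw [Polynomial.cyclotomic_eq_minpoly hζ (by norm_num)]
      exact (minpoly.algebraMap_eq (A := ℤ)
        (FaithfulSMul.algebraMap_injective (𝓞 F) F) hζ.toInteger).symm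
    rw [IsPrimitiveRoot.integralPowerBasis_gen, hmin]
    have := root_primitive.isRoot_cyclotomic (by norm_num)
    rw [Polynomial.IsRoot.def, ← Polynomial.map_cyclotomic_int, Polynomial.eval_map] at this
    exact this
  refine ⟨(hζ.integralPowerBasis.lift _ hroot).toRingHom, ?_⟩
  have := hζ.integralPowerBasis.lift_gen _ hroot
  rw [IsPrimitiveRoot.integralPowerBasis_gen] at this
  exact this

end Cyc512

open Cyc512 in
theorem seventeen_dvd_classNumber_cyclotomic_512
    (F : Type*) [Field F] [NumberField F]
    [IsCyclotomicExtension {512} ℚ F] :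
    17 ∣ NumberField.classNumber F := by
  have : IsCMField F :=
    IsCyclotomicExtension.Rat.isCMField F (S := {512}) ⟨512, rfl, by norm_num⟩
  obtain ⟨ζ, hζ⟩ := IsCyclotomicExtension.exists_isPrimitiveRoot ℚ F
    (S := {512}) (n := 512) rfl (by norm_num)
  obtain ⟨f, hf⟩ := exists_hom F ζ hζ
  set ω : 𝓞 F := hζ.toInteger with hω
  have hωp : IsPrimitiveRoot ω 512 := hζ.toInteger_isPrimitiveRoot
  have hz : (ω ^ 8) ^ 32 = -1 := by
    rw [← pow_mul]
    have h2 : (ω ^ 256) ^ 2 = 1 := by rw [← pow_mul]; exact hωp.pow_eq_one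
    rcases (mul_self_eq_one_iff.mp ((sq _).symm.trans h2)) with h | h
    · exact absurd h (hωp.pow_ne_one_of_pos_of_lt (by norm_num) (by norm_num))
    · exact h
  by_contra hdvd
  have hcop : (NumberField.classNumber F).Coprime 17 :=
    ((Nat.Prime.coprime_iff_not_dvd (by norm_num)).mpr hdvd).symm
  let c : 𝓞 F →+* 𝓞 F := (IsCMField.ringOfIntegersComplexConj F).toRingEquiv.toRingHom
  have hcω : c ω * ω = 1 := by
    let φ : F →+* ℂ := Classical.choice inferInstance
    apply RingOfIntegers.ext
    apply φ.injective
    have h1 : φ ((c ω : 𝓞 F) : F) = (starRingEnd ℂ) (φ ζ) :=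
      IsCMField.complexEmbedding_complexConj F φ ζ
    have h2 : ‖φ ζ‖ = 1 := (hζ.map_of_injective φ.injective).norm'_eq_one (by norm_num)
    have h3 : φ ((ω : 𝓞 F) : F) = φ ζ := rfl
    have h4 : ((c ω * ω : 𝓞 F) : F) = ((c ω : 𝓞 F) : F) * (ω : F) := rfl
    rw [h4, map_mul, h1, h3, Complex.conj_mul', h2]
    simp
  have hcz : c (ω ^ 8) * ω ^ 8 = 1 := by rw [map_pow, ← mul_pow, hcω, one_pow]
  set z : 𝓞 F := ω ^ 8 with hzdef
  have hcδ : c (del z) = delBar z := by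
    rw [← del_conj z (c z) hz hcz]
    exact map_del c z
  have hfδ : f (del z) = 64921 := by
    rw [← del_val, ← hf, ← map_pow, ← hzdef]
    exact map_del f z
  have hmul := del_mul_delBar z hz
  -- the ideal `(δ)` is a seventeenth power
  obtain ⟨I, hI⟩ : ∃ I : Ideal (𝓞 F), Ideal.span {del z} = I ^ 17 := by
    apply exists_eq_pow_of_mul_eq_pow_of_coprime (b := Ideal.span {delBar z})
      (c := Ideal.span {31})
    · rw [Ideal.isCoprime_span_singleton_iff]
      exact isCoprime_del z hz
    · rw [Ideal.span_singleton_mul_span_singleton, hmul, Ideal.span_singleton_pow]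
  have hIp : I.IsPrincipal := by
    apply Ideal.IsPrincipal.of_isPrincipal_pow_of_coprime (n := 17)
    · exact hcop.symm
    · rw [← hI]; exact ⟨_, rfl⟩
  obtain ⟨α, hα⟩ := hIp
  have hassoc : Associated (α ^ 17) (del z) := by
    rw [← Ideal.span_singleton_eq_span_singleton, ← Ideal.span_singleton_pow, hI, hα]
  obtain ⟨u, hu⟩ := hassoc
  -- `u / conj u` is a root of unity
  obtain ⟨t, ht, htu⟩ : ∃ t : 𝓞 F, t ^ 512 = 1 ∧ (u : 𝓞 F) = t * c u := by
    have h1 := IsCMField.unitsMulComplexConjInv_apply F u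
    have h2 : (IsCMField.unitsMulComplexConjInv F u) ^ 512 = 1 := by
      have := pow_card_eq_one' (x := IsCMField.unitsMulComplexConjInv F u)
      have ho : Units.torsionOrder F = 512 := by
        rw [IsCyclotomicExtension.Rat.torsionOrder_eq (n := 512) (K := F)]
        simp [show Even 512 by decide]
      rw [← ho]
      exact this
    refine ⟨((IsCMField.unitsMulComplexConjInv F u : (𝓞 F)ˣ) : 𝓞 F), ?_, ?_⟩
    · rw [← Units.val_pow_eq_pow_val, ← SubmonoidClass.coe_pow, h2]
      rfl
    · have h3 : c (u : 𝓞 F) = ((IsCMField.unitsComplexConj F u : (𝓞 F)ˣ) : 𝓞 F) := rfl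
      rw [h3, ← Units.val_mul, h1, inv_mul_cancel_right]
  have hbar : delBar z = c α ^ 17 * c u := by
    rw [← hcδ, ← hu, map_mul, map_pow]
  have hrel : del z ^ 2 * c α ^ 17 = t * α ^ 17 * 31 ^ 17 := by
    rw [← hmul, hbar]
    have : del z = α ^ 17 * (t * c u) := by rw [← htu, hu]
    linear_combination (del z * c α ^ 17) * this
  have hrelf : (64921 : ZMod 87041) ^ 2 * f (c α) ^ 17 = f t * f α ^ 17 * 31 ^ 17 := by
    have := congrArg f hrel
    simpa only [map_mul, map_pow, hfδ, map_ofNat] using this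
  have h31 : (31 : ZMod 87041) ≠ 0 := by decide +kernel
  have hprod : f (del z) * f (delBar z) = 31 ^ 17 := by
    rw [← map_mul, hmul, map_pow, map_ofNat]
  have hα0 : f α ≠ 0 := by
    intro h0
    rw [← hu, map_mul, map_pow, h0] at hprod
    exact pow_ne_zero 17 h31 (by rw [← hprod]; simp)
  have hcα0 : f (c α) ≠ 0 := by
    intro h0
    rw [hbar, map_mul (f := f) (c α ^ 17), map_pow f (c α), h0] at hprod
    exact pow_ne_zero 17 h31 (by rw [← hprod]; simp)
  have hfermat : ∀ a : ZMod 87041, a ≠ 0 → (a ^ 17) ^ 5120 = 1 := by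
    intro a ha
    rw [← pow_mul]
    exact ZMod.pow_card_sub_one_eq_one ha
  have hft : f t ^ 5120 = 1 := by
    rw [show 5120 = 512 * 10 by norm_num, pow_mul, ← map_pow, ht, map_one, one_pow]
  have hfin := congrArg (fun a => a ^ 5120) hrelf
  simp only [mul_pow, hfermat _ hα0, hfermat _ hcα0, hfermat _ h31, hft, mul_one] at hfin
  rw [← pow_mul] at hfin
  exact val_pow hfin
end

section
/- (Landau prime ideal theorem) Let $K$ be a number field and, for a real number $T \ge 2$, let $\pi_K(T)$ denote the number of nonzero prime ideals $\mathfrak{p}$ of $\mathcal{O}_K$ with absolute norm $N(\mathfrak{p}) \le T$. Then $\pi_K(T) \sim T/\log T$ as $T \to \infty$, i.e., $\lim_{T \to \infty} \pi_K(T) \cdot \log T / T = 1$. -/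
open Filter
namespace LPIT
open MeasureTheory Topology Set
open scoped Pointwise

/-- lattice point counting -/
theorem lattice_count {E : Type*} [NormedAddCommGroup E] [NormedSpace ℝ E] [FiniteDimensional ℝ E]
    [MeasurableSpace E] [BorelSpace E] (μ : Measure E) [μ.IsAddHaarMeasure]
    (L : Submodule ℤ E) [DiscreteTopology L] [IsZLattice ℝ L] :
    ∃ R : ℝ, 0 < R ∧ ∃ v : ℝ, 0 < v ∧ ∀ S Sh : Set E, Bornology.IsBounded S → μ Sh ≠ ⊤ →
      (∀ x y : E, ‖x - y‖ ≤ R → x ∈ S → y ∉ S → x ∈ Sh ∧ y ∈ Sh) →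
      |(Nat.card {a : L // (a : E) ∈ S} : ℝ) * v - μ.real S| ≤ μ.real Sh := by
  classical
  have : Module.Free ℤ L := ZLattice.module_free ℝ L
  let b := (Module.Free.chooseBasis ℤ L).ofZLatticeBasis ℝ L
  let D := ZSpan.fundamentalDomain b
  have hD : IsAddFundamentalDomain L D μ := ZLattice.isAddFundamentalDomain (Module.Free.chooseBasis ℤ L) μ
  have hDb : Bornology.IsBounded D := ZSpan.fundamentalDomain_isBounded b
  have hDm : MeasurableSet D := ZSpan.fundamentalDomain_measurableSet b
  obtain ⟨R, hR, hDR⟩ := hDb.exists_pos_norm_le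
  have hs : Submodule.span ℤ (Set.range b) = L :=
    (Module.Free.chooseBasis ℤ L).ofZLatticeBasis_span ℝ
  have hex : ∀ x : E, ∃ l : L, x - l ∈ D ∧ ∀ l' : L, x - l' ∈ D → l' = l := by
    intro x
    obtain ⟨l, hl, hu⟩ := ZSpan.exist_unique_vadd_mem_fundamentalDomain b x
    have hlL : (l : E) ∈ L := hs.le l.2
    refine ⟨-⟨l.1, hlL⟩, ?_, ?_⟩
    · have : (l : E) + x ∈ D := hl
      simpa [add_comm] using this
    · intro l' hl'
      have hm : -(l' : E) ∈ Submodule.span ℤ (Set.range b) := hs.ge (neg_mem l'.2)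
      have := hu ⟨-(l' : E), hm⟩ (by
        change -(l' : E) + x ∈ D
        simpa [sub_eq_neg_add] using hl')
      ext
      simp [← this]
  have hfin : μ D ≠ ⊤ := hDb.measure_lt_top.ne
  have hpos : 0 < μ D := by
    refine pos_iff_ne_zero.mpr ?_
    exact ZSpan.measure_fundamentalDomain_ne_zero b
  refine ⟨R, hR, μ.real D, ENNReal.toReal_pos hpos.ne' hfin, ?_⟩
  intro S Sh hS hSh h
  let U : Set E := ⋃ a : {a : L // (a : E) ∈ S}, ((a.1 : E) +ᵥ D)
  have hfinS : Finite {a : L // (a : E) ∈ S} := by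
    have h1 : (S ∩ (Submodule.span ℤ (Set.range b) : Set E)).Finite :=
      ZSpan.setFinite_inter b hS
    have h2 := h1.to_subtype
    refine Finite.of_injective
      (fun a : {a : L // (a : E) ∈ S} => (⟨(a.1 : E), a.2, hs.ge a.1.2⟩ :
        (S ∩ (Submodule.span ℤ (Set.range b) : Set E) : Set E))) ?_
    intro a a' haa
    have h3 : ((a.1 : L) : E) = a'.1 := by
      have := Subtype.ext_iff.mp haa
      exact this
    exact Subtype.ext (Subtype.ext h3)
  have hU : μ U = (Nat.card {a : L // (a : E) ∈ S}) * μ D := by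
    have := measure_iUnion (μ := μ) (f := fun a : {a : L // (a : E) ∈ S} => ((a.1 : E) +ᵥ D)) ?_ ?_
    · change μ U = _ at this
      rw [this]
      simp [measure_vadd, ENat.card_eq_coe_natCard]
    · intro i j hij
      rw [Function.onFun, Set.disjoint_left]
      rintro x ⟨d, hd, rfl⟩ ⟨d', hd', he⟩
      simp only [vadd_eq_add] at he
      obtain ⟨l, -, hl⟩ := hex ((i.1 : E) + d)
      apply hij
      have e1 := hl i.1 (by simpa using hd)
      have e2 := hl j.1 (by rw [← he]; simpa using hd')
      exact Subtype.ext (e1.trans e2.symm)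
    · intro i
      exact hDm.const_vadd _
  have hUr : μ.real U = (Nat.card {a : L // (a : E) ∈ S}) * μ.real D := by
    simp [Measure.real, hU]
  have h1 : U ⊆ S ∪ Sh := by
    intro x hx
    obtain ⟨a, ha⟩ := mem_iUnion.mp hx
    obtain ⟨d, hd, rfl⟩ := ha
    by_cases hxS : (a.1 : E) +ᵥ d ∈ S
    · exact Or.inl hxS
    · refine Or.inr (h (a.1 : E) _ ?_ a.2 hxS).2
      simpa using hDR d hd
  have h2 : S ⊆ U ∪ Sh := by
    intro x hx
    obtain ⟨l, hl, -⟩ := hex x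
    by_cases hlS : (l : E) ∈ S
    · refine Or.inl (mem_iUnion.mpr ⟨⟨l, hlS⟩, ?_⟩)
      exact ⟨x - l, hl, by simp⟩
    · exact Or.inr (h x l (hDR _ hl) hx hlS).1
  have hSf : μ S ≠ ⊤ := hS.measure_lt_top.ne
  have hUf : μ U ≠ ⊤ := by rw [hU]; exact ENNReal.mul_ne_top (by simp) hfin
  rw [← hUr, abs_le]
  have h3 : μ.real U ≤ μ.real S + μ.real Sh :=
    (measureReal_mono h1 (measure_union_ne_top hSf hSh)).trans (measureReal_union_le _ _)
  have h4 : μ.real S ≤ μ.real U + μ.real Sh :=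
    (measureReal_mono h2 (measure_union_ne_top hUf hSh)).trans (measureReal_union_le _ _)
  constructor <;> linarith
end LPIT

open Filter
namespace LPIT
open MeasureTheory Topology Set
open scoped Pointwise
open NumberField NumberField.mixedEmbedding NumberField.mixedEmbedding.fundamentalCone InfinitePlace NumberField.Units NumberField.Units.dirichletUnitTheorem

variable (K : Type*) [Field K] [NumberField K]

open scoped Classical in
theorem vol_pre : ∃ C : ENNReal, C ≠ ⊤ ∧ ∀ s : Set (realSpace K), MeasurableSet s →
    volume ((normAtAllPlaces ⁻¹' (expMapBasis '' s) : Set (mixedSpace K))) =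
      C * ∫⁻ x in s, ENNReal.ofReal (Real.exp (x w₀ * Module.finrank ℚ K)) := by
  refine ⟨2 ^ nrRealPlaces K * .ofReal (2 * Real.pi) ^ nrComplexPlaces K *
    ((2 : ENNReal)⁻¹ ^ nrComplexPlaces K * ENNReal.ofReal (regulator K) * (Module.finrank ℚ K)),
    ?_, ?_⟩
  · finiteness
  intro s hs
  have h₂ : MeasurableSet (normAtAllPlaces ⁻¹' (expMapBasis '' s) : Set (mixedSpace K)) := by
    refine MeasurableSet.preimage ?_ (continuous_normAtAllPlaces K).measurable
    refine MeasurableSet.image_of_continuousOn_injOn hs (continuous_expMapBasis K).continuousOn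
      (injective_expMapBasis K).injOn
  rw [volume_eq_two_pow_mul_two_pi_pow_mul_integral Set.preimage_image_preimage h₂,
    normAtAllPlaces_image_preimage_expMapBasis, setLIntegral_expMapBasis_image hs (by fun_prop)]
  simp_rw [ENNReal.inv_mul_cancel_right
    (Finset.prod_ne_zero_iff.mpr fun _ _ ↦ ENNReal.ofReal_ne_zero_iff.mpr (expMapBasis_pos _ _))
    (ENNReal.prod_ne_top fun _ _ ↦ ENNReal.ofReal_ne_top)]
  ring

theorem lint_pi {ι : Type*} [Fintype ι] [DecidableEq ι] (w0 : ι) (I : ι → Set ℝ)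
    (g : ℝ → ENNReal) (hg : Measurable g) :
    ∫⁻ x in (Set.univ.pi I), g (x w0) = (∫⁻ t in I w0, g t) *
      ∏ u : {u // u ∈ Finset.univ.erase w0}, volume (I u) := by
  rw [volume_pi, Measure.restrict_pi_pi, lintegral_eq_lmarginal_univ 0,
    lmarginal_erase' _ (by fun_prop) (Finset.mem_univ w0)]
  simp_rw [Function.update_self, lmarginal, lintegral_const, Measure.pi_univ,
    Measure.restrict_apply_univ]

/-- product set integral bound -/
theorem box_bound {ι : Type*} [Fintype ι] [DecidableEq ι] (w0 : ι) (n : ℝ) (hn : 0 < n) :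
    ∃ C : ENNReal, C ≠ ⊤ ∧ ∀ (w : ι) (a ρ : ℝ), 0 ≤ ρ →
    ∫⁻ x in (Set.univ.pi fun u => (if u = w0 then Iic (1:ℝ) else Icc (-1) 2) ∩
      (if u = w then Icc (a - ρ) (a + ρ) else univ)),
        ENNReal.ofReal (Real.exp (x w0 * n)) ≤ C * ENNReal.ofReal ρ := by
  have hI : (∫⁻ t in Iic (1:ℝ), ENNReal.ofReal (Real.exp (t * n))) ≠ ⊤ := by
    simp_rw [mul_comm _ n]
    rw [← ofReal_integral_eq_lintegral_ofReal (integrableOn_exp_mul_Iic hn _)]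
    · exact ENNReal.ofReal_ne_top
    · filter_upwards with _ using Real.exp_nonneg _
  refine ⟨ENNReal.ofReal (Real.exp n) * 2 * 3 ^ Fintype.card ι +
    (∫⁻ t in Iic (1:ℝ), ENNReal.ofReal (Real.exp (t * n))) * (2 * 3 ^ Fintype.card ι), by finiteness, ?_⟩
  intro w a ρ hρ
  rw [lint_pi w0 _ (fun t => ENNReal.ofReal (Real.exp (t * n))) (by fun_prop)]
  have h3 : ∀ s : Finset ι, (3 : ENNReal) ^ s.card ≤ 3 ^ Fintype.card ι := fun s =>
    pow_le_pow_right₀ (by norm_num) (Finset.card_le_univ s)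
  have hv : ∀ u : {u // u ∈ Finset.univ.erase w0}, volume ((if (u : ι) = w0 then Iic (1:ℝ) else Icc (-1) 2) ∩
      (if (u : ι) = w then Icc (a - ρ) (a + ρ) else univ)) ≤ 3 := by
    intro u
    rw [if_neg (Finset.ne_of_mem_erase u.2)]
    refine (measure_mono inter_subset_left).trans ?_
    rw [Real.volume_Icc]; norm_num
  have h2 : ENNReal.ofReal (a + ρ - (a - ρ)) = 2 * ENNReal.ofReal ρ := by
    rw [← ENNReal.ofReal_ofNat 2, ← ENNReal.ofReal_mul (by norm_num)]; congr 1; ring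
  by_cases hw : w = w0
  · subst hw
    rw [add_mul]
    refine le_trans ?_ (le_self_add)
    simp only [if_true]
    have e1 : ∫⁻ t in Iic (1:ℝ) ∩ Icc (a - ρ) (a + ρ), ENNReal.ofReal (Real.exp (t * n)) ≤
        ENNReal.ofReal (Real.exp n) * (2 * ENNReal.ofReal ρ) := by
      calc _ ≤ ∫⁻ t in Iic (1:ℝ) ∩ Icc (a - ρ) (a + ρ), ENNReal.ofReal (Real.exp n) := by
            refine setLIntegral_mono' (measurableSet_Iic.inter measurableSet_Icc) ?_
            intro x hx
            refine ENNReal.ofReal_le_ofReal (Real.exp_le_exp.mpr ?_)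
            have : x ≤ 1 := hx.1
            nlinarith
        _ ≤ _ := by
            rw [setLIntegral_const]
            gcongr
            refine (measure_mono inter_subset_right).trans ?_
            rw [Real.volume_Icc, h2]
    have e2 := Finset.prod_le_pow_card Finset.univ _ (3 : ENNReal) (fun u _ => hv u)
    calc _ ≤ ENNReal.ofReal (Real.exp n) * (2 * ENNReal.ofReal ρ) * 3 ^ Fintype.card ι := by
          refine mul_le_mul' e1 (e2.trans ?_)
          refine pow_le_pow_right₀ (by norm_num) ?_
          rw [Finset.card_univ, Fintype.card_coe]
          exact Finset.card_le_univ _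
      _ = _ := by ring
  · rw [add_mul]
    refine le_trans ?_ (le_add_self)
    rw [if_pos rfl, if_neg (Ne.symm hw), inter_univ, mul_assoc]
    refine mul_le_mul' le_rfl ?_
    have hm : w ∈ Finset.univ.erase w0 := by simp [hw]
    rw [← Finset.mul_prod_erase Finset.univ _ (Finset.mem_univ (⟨w, hm⟩ : {u // u ∈ Finset.univ.erase w0}))]
    have e2 := Finset.prod_le_pow_card (Finset.univ.erase (⟨w, hm⟩ : {u // u ∈ Finset.univ.erase w0})) _ (3 : ENNReal) (fun u _ => hv u)
    calc _ ≤ (2 * ENNReal.ofReal ρ) * 3 ^ Fintype.card ι := by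
          refine mul_le_mul' ?_ (e2.trans ?_)
          · simp only [if_true]
            refine (measure_mono inter_subset_right).trans ?_
            rw [Real.volume_Icc, h2]
          · refine pow_le_pow_right₀ (by norm_num) ?_
            refine (Finset.card_le_univ _).trans ?_
            rw [Fintype.card_coe]
            exact Finset.card_le_univ _
      _ = _ := by ring
end LPIT

open Filter
namespace LPIT
open MeasureTheory Topology Set
open scoped Pointwise
open NumberField NumberField.mixedEmbedding NumberField.mixedEmbedding.fundamentalCone InfinitePlace NumberField.Units NumberField.Units.dirichletUnitTheorem

variable (K : Type*) [Field K] [NumberField K]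

open scoped Classical in
/-- box -/
noncomputable def Box (w : InfinitePlace K) (a ρ : ℝ) : Set (realSpace K) :=
  Set.univ.pi fun u => (if u = w₀ then Iic (1:ℝ) else Icc (-1) 2) ∩
      (if u = w then Icc (a - ρ) (a + ρ) else univ)

theorem meas_Box (w : InfinitePlace K) (a ρ : ℝ) : MeasurableSet (Box K w a ρ) := by
  refine MeasurableSet.univ_pi fun _ ↦ ?_
  refine MeasurableSet.inter ?_ ?_ <;> split_ifs
  · exact measurableSet_Iic
  · exact measurableSet_Icc
  · exact measurableSet_Icc
  · exact MeasurableSet.univ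

theorem param_shell (ρ : ℝ) (hρ1 : ρ ≤ 1) (z z' : realSpace K)
    (h : ‖z - z'‖ ≤ ρ) (hz : z ∈ paramSet K) (hz' : z' ∉ paramSet K) :
    ∃ w, (z ∈ Box K w 0 ρ ∧ z' ∈ Box K w 0 ρ) ∨ (z ∈ Box K w 1 ρ ∧ z' ∈ Box K w 1 ρ) := by
  classical
  have hd : ∀ w, |z w - z' w| ≤ ρ := fun w => (norm_le_pi_norm (z - z') w).trans h
  simp only [paramSet, Set.mem_univ_pi] at hz hz'
  push Not at hz'
  obtain ⟨w, hw⟩ := hz'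
  have key : ∀ a, |z w - a| ≤ ρ → |z' w - a| ≤ ρ → (z ∈ Box K w a ρ ∧ z' ∈ Box K w a ρ) := by
    intro a h1 h2
    rw [abs_le] at h1 h2
    constructor
    · rw [Box, Set.mem_univ_pi]
      intro u
      have h3 := hz u
      constructor
      · split_ifs with hu
        · rw [if_pos hu] at h3; exact Set.mem_Iic.mpr (le_trans (Set.mem_Iic.mp h3) zero_le_one)
        · rw [if_neg hu] at h3; exact ⟨by linarith [h3.1], by linarith [h3.2]⟩
      · split_ifs with hu
        · subst hu; constructor <;> linarith
        · trivial
    · rw [Box, Set.mem_univ_pi]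
      intro u
      have h3 := hz u
      have h4 := abs_le.mp (hd u)
      constructor
      · split_ifs with hu
        · rw [if_pos hu] at h3
          have : z u ≤ 0 := h3
          exact Set.mem_Iic.mpr (by linarith)
        · rw [if_neg hu] at h3; exact ⟨by linarith [h3.1], by linarith [h3.2]⟩
      · split_ifs with hu
        · subst hu; constructor <;> linarith
        · trivial
  refine ⟨w, ?_⟩
  have h3 := hz w
  have h4 := abs_le.mp (hd w)
  split_ifs at h3 hw with hu
  · left
    have h5 : z w ≤ 0 := h3
    have h6 : 0 < z' w := not_le.mp hw
    exact key 0 (abs_le.mpr ⟨by linarith, by linarith⟩) (abs_le.mpr ⟨by linarith, by linarith⟩)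
  · have h5 := h3.1
    have h6 := h3.2
    by_cases h7 : z' w < 0
    · left
      exact key 0 (abs_le.mpr ⟨by linarith, by linarith⟩) (abs_le.mpr ⟨by linarith, by linarith⟩)
    · right
      have h8 : 1 ≤ z' w := by
        by_contra h9
        exact hw ⟨not_lt.mp h7, not_le.mp h9⟩
      exact key 1 (abs_le.mpr ⟨by linarith, by linarith⟩) (abs_le.mpr ⟨by linarith, by linarith⟩)

/-- Values of expMapBasis on bounded parameters. -/
theorem exp_bd : ∃ B : ℝ, 0 < B ∧ ∀ z ∈ paramSet K, ∀ w,
    Real.exp (z w₀) * Real.exp (-B) ≤ expMapBasis z w ∧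
      expMapBasis z w ≤ Real.exp (z w₀) * Real.exp B := by
  classical
  let T := (completeBasis K).equivFunL.symm.toContinuousLinearMap
  refine ⟨‖T‖ + 1, by positivity, ?_⟩
  intro z hz w
  rw [expMapBasis_apply'']
  set z0 : realSpace K := fun i ↦ if i = w₀ then 0 else z i with hz0
  have hn : ‖z0‖ ≤ 1 := by
    refine (pi_norm_le_iff_of_nonneg zero_le_one).mpr ?_
    intro u
    have := Set.mem_univ_pi.mp hz u
    simp only [hz0]
    split_ifs at this ⊢ with hu
    · simp
    · rw [Real.norm_eq_abs, abs_le]; exact ⟨by linarith [this.1], this.2.le⟩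
  have hT : |T z0 w| ≤ ‖T‖ := by
    refine (norm_le_pi_norm (T z0) w).trans ((T.le_opNorm z0).trans ?_)
    exact mul_le_of_le_one_right (norm_nonneg _) hn
  have hm : (0:ℝ) < w.mult := by exact_mod_cast mult_pos
  have hm1 : (1:ℝ) ≤ w.mult := by exact_mod_cast one_le_mult
  have he : expMapBasis z0 w = Real.exp ((w.mult : ℝ)⁻¹ * T z0 w) := by
    rw [expMapBasis_apply, expMap_apply]; rfl
  have hb : |(w.mult : ℝ)⁻¹ * T z0 w| ≤ ‖T‖ + 1 := by
    rw [abs_mul, abs_of_pos (inv_pos.mpr hm)]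
    have := inv_le_one_of_one_le₀ hm1
    nlinarith [abs_nonneg (T z0 w), norm_nonneg T, inv_pos.mpr hm]
  rw [abs_le] at hb
  simp only [Pi.smul_apply, smul_eq_mul, he]
  constructor
  · gcongr; exact hb.1
  · gcongr; exact hb.2

theorem param_lip : ∃ B : ℝ, 0 < B ∧ ∀ z z' : realSpace K, ∀ η : ℝ, 0 ≤ η →
    (∀ w, |Real.log (expMapBasis z w) - Real.log (expMapBasis z' w)| ≤ η) → ‖z - z'‖ ≤ B * η := by
  let T := (completeBasis K).equivFunL.toContinuousLinearMap
  refine ⟨(‖T‖ + 1) * 2, by positivity, ?_⟩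
  intro z z' η hη h
  have he : ∀ (z : realSpace K) w, w.mult * Real.log (expMapBasis z w) = (completeBasis K).equivFun.symm z w := by
    intro z w
    rw [expMapBasis_apply, expMap_apply, Real.log_exp]
    have hm : (w.mult : ℝ) ≠ 0 := by exact_mod_cast mult_ne_zero
    rw [mul_inv_cancel_left₀ hm]
  set v := (completeBasis K).equivFun.symm (z - z') with hv
  have hTv : T v = z - z' := by
    change (completeBasis K).equivFun v = _
    rw [hv, LinearEquiv.apply_symm_apply]
  have hvn : ‖v‖ ≤ 2 * η := by
    refine (pi_norm_le_iff_of_nonneg (by positivity)).mpr ?_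
    intro w
    rw [hv, map_sub, Pi.sub_apply, ← he, ← he, ← mul_sub, Real.norm_eq_abs, abs_mul]
    have h2 : (w.mult : ℝ) ≤ 2 := by
      have : w.mult ≤ 2 := by unfold InfinitePlace.mult; split_ifs <;> norm_num
      exact_mod_cast this
    rw [abs_of_nonneg (by positivity)]
    exact mul_le_mul h2 (h w) (abs_nonneg _) (by norm_num)
  rw [← hTv]
  refine (T.le_opNorm v).trans ?_
  nlinarith [norm_nonneg T, norm_nonneg v]

end LPIT

open Filter
namespace LPIT
open MeasureTheory Topology Set
open scoped Pointwise
open NumberField NumberField.mixedEmbedding NumberField.mixedEmbedding.fundamentalCone InfinitePlace NumberField.Units NumberField.Units.dirichletUnitTheorem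

variable (K : Type*) [Field K] [NumberField K]

open scoped Classical in
theorem normAtPlace_le_norm (x : mixedSpace K) (w : InfinitePlace K) : normAtPlace w x ≤ ‖x‖ := by
  rw [norm_eq_sup'_normAtPlace]
  exact Finset.le_sup' (fun w => normAtPlace w x) (Finset.mem_univ w)

open scoped Classical in
theorem normAtPlace_sub_le (x y : mixedSpace K) (w : InfinitePlace K) :
    normAtPlace w x ≤ normAtPlace w y + ‖x - y‖ := by
  have := normAtPlace_add_le w y (x - y)
  rw [add_sub_cancel] at this
  linarith [normAtPlace_le_norm K (x - y) w]

theorem log_close (a b ε : ℝ) (hε : 0 < ε) (ha : √ε ≤ a) (hb : √ε ≤ b)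
    (h1 : a ≤ b + ε) (h2 : b ≤ a + ε) : |Real.log a - Real.log b| ≤ √ε := by
  have hs : 0 < √ε := Real.sqrt_pos.mpr hε
  have hss : √ε * √ε = ε := Real.mul_self_sqrt hε.le
  have key : ∀ a b, √ε ≤ a → √ε ≤ b → a ≤ b + ε → Real.log a - Real.log b ≤ √ε := by
    intro a b ha hb h1
    have ha' : 0 < a := hs.trans_le ha
    have hb' : 0 < b := hs.trans_le hb
    rw [← Real.log_div ha'.ne' hb'.ne']
    refine (Real.log_le_sub_one_of_pos (by positivity)).trans ?_
    rw [sub_le_iff_le_add, div_le_iff₀ hb']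
    nlinarith
  rw [abs_le]
  exact ⟨by linarith [key b a hb ha h2], key a b ha hb h1⟩

open scoped Classical in
theorem shell : ∃ C ε0 : ℝ, 0 < ε0 ∧ ∀ ε, 0 < ε → ε ≤ ε0 → ∃ Sh : Set (mixedSpace K),
    volume Sh ≠ ⊤ ∧ volume.real Sh ≤ C * √ε ∧
    ∀ x y : mixedSpace K, ‖x - y‖ ≤ ε → x ∈ normLeOne K → y ∉ normLeOne K → x ∈ Sh ∧ y ∈ Sh := by
  classical
  obtain ⟨B, hB, hexp⟩ := exp_bd K
  obtain ⟨B2, hB2, hlip⟩ := param_lip K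
  obtain ⟨C1, hC1, hvol⟩ := vol_pre K
  have hn : 0 < Module.finrank ℚ K := Module.finrank_pos
  obtain ⟨C2, hC2, hbox⟩ := box_bound (w₀ : InfinitePlace K) (Module.finrank ℚ K : ℝ) (by exact_mod_cast hn)
  set r : ℝ := 2 * Real.exp (2 * B) + 1 with hr
  have hrpos : 0 < r := by positivity
  set S : ENNReal := volume (Metric.closedBall (0 : mixedSpace K) 1) with hS
  have hSf : S ≠ ⊤ := Metric.isBounded_closedBall.measure_lt_top.ne
  set N := Fintype.card (InfinitePlace K)
  set Ct : ENNReal := ENNReal.ofReal (r ^ Module.finrank ℚ K) * S + C1 * (N * (2 * (C2 * ENNReal.ofReal B2))) with hCt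
  have hCtf : Ct ≠ ⊤ := by
    refine ENNReal.add_ne_top.mpr ⟨ENNReal.mul_ne_top ENNReal.ofReal_ne_top hSf, ?_⟩
    exact ENNReal.mul_ne_top hC1 (ENNReal.mul_ne_top (ENNReal.natCast_ne_top _)
      (ENNReal.mul_ne_top (by norm_num) (ENNReal.mul_ne_top hC2 ENNReal.ofReal_ne_top)))
  refine ⟨Ct.toReal, min 1 (1 / (B2 ^ 2)), by positivity, ?_⟩
  intro ε hε hεle
  have hε1 : ε ≤ 1 := hεle.trans (min_le_left _ _)
  have hε2 : ε ≤ 1 / B2 ^ 2 := hεle.trans (min_le_right _ _)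
  have hs : 0 < √ε := Real.sqrt_pos.mpr hε
  have hss : √ε * √ε = ε := Real.mul_self_sqrt hε.le
  have hs1 : √ε ≤ 1 := Real.sqrt_le_one.mpr hε1
  set ρ := B2 * √ε with hρ
  have hρ1 : ρ ≤ 1 := by
    rw [le_div_iff₀ (by positivity)] at hε2
    have : ρ ^ 2 ≤ 1 := by rw [hρ, mul_pow, pow_two (√ε), hss]; linarith
    nlinarith [mul_pos hB2 hs]
  set Q : Set (realSpace K) := ⋃ w, (Box K w 0 ρ ∪ Box K w 1 ρ) with hQ
  have hQm : MeasurableSet Q := MeasurableSet.iUnion fun w => (meas_Box K w _ _).union (meas_Box K w _ _)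
  let Sh : Set (mixedSpace K) := Metric.closedBall 0 (r * √ε) ∪ normAtAllPlaces ⁻¹' (expMapBasis '' Q)
  have hvSh : volume Sh ≤ Ct * ENNReal.ofReal √ε := by
    refine (measure_union_le _ _).trans ?_
    rw [hCt, add_mul (ENNReal.ofReal (r ^ Module.finrank ℚ K) * S)]
    refine add_le_add (α := ENNReal) ?_ ?_
    · rw [Measure.addHaar_closedBall _ _ (by positivity), mixedEmbedding.finrank, ← Measure.addHaar_closedBall_eq_addHaar_ball,
        mul_right_comm]
      refine mul_le_mul_left ?_ _
      rw [← ENNReal.ofReal_mul (by positivity), mul_pow]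
      refine ENNReal.ofReal_le_ofReal ?_
      gcongr
      exact pow_le_of_le_one hs.le hs1 hn.ne'
    · rw [hvol Q hQm, mul_assoc]
      refine mul_le_mul_right ?_ _
      refine (lintegral_iUnion_le _ _).trans ?_
      rw [tsum_fintype]
      have : ∀ w ∈ (Finset.univ : Finset (InfinitePlace K)), ∫⁻ x in Box K w 0 ρ ∪ Box K w 1 ρ,
          ENNReal.ofReal (Real.exp (x w₀ * Module.finrank ℚ K)) ≤ 2 * (C2 * ENNReal.ofReal ρ) := by
        intro w _
        refine (lintegral_union_le _ _ _).trans ?_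
        rw [two_mul]
        refine add_le_add ?_ ?_
        · exact hbox w 0 ρ (by positivity)
        · exact hbox w 1 ρ (by positivity)
      refine (Finset.sum_le_card_nsmul _ _ _ this).trans ?_
      rw [Finset.card_univ, nsmul_eq_mul, hρ, ENNReal.ofReal_mul hB2.le]
      apply le_of_eq
      ring
  have hf : Ct * ENNReal.ofReal √ε ≠ ⊤ := ENNReal.mul_ne_top hCtf ENNReal.ofReal_ne_top
  refine ⟨Sh, ne_top_of_le_ne_top hf hvSh, ?_, ?_⟩
  · have := ENNReal.toReal_mono hf hvSh
    rwa [ENNReal.toReal_mul, ENNReal.toReal_ofReal hs.le] at this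
  intro x y hxy hx hy
  rw [normLeOne_eq_preimage] at hx hy
  obtain ⟨z, hz, hzx⟩ := hx
  have hzw : ∀ w, expMapBasis z w = normAtPlace w x := fun w => by rw [hzx, normAtAllPlaces_apply]
  by_cases hsmall : Real.exp (z w₀) * Real.exp (-B) ≤ 2 * √ε
  · have hxn : ‖x‖ ≤ 2 * Real.exp (2 * B) * √ε := by
      rw [norm_eq_sup'_normAtPlace]
      refine Finset.sup'_le _ _ fun w _ => ?_
      rw [← hzw]
      refine ((hexp z hz w).2).trans ?_
      have e1 : Real.exp (z w₀) * Real.exp B = Real.exp (z w₀) * Real.exp (-B) * Real.exp (2 * B) := by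
        rw [mul_assoc (Real.exp (z w₀)), ← Real.exp_add (-B)]; congr 2; ring
      rw [e1]
      nlinarith [Real.exp_pos (2 * B)]
    have hεs : ε ≤ √ε := by nlinarith
    constructor
    · left
      rw [mem_closedBall_zero_iff, hr]; linarith
    · left
      rw [mem_closedBall_zero_iff, hr]
      have := norm_sub_norm_le y x
      rw [norm_sub_rev] at this
      linarith
  · push Not at hsmall
    have hxw : ∀ w, 2 * √ε ≤ normAtPlace w x := fun w => by
      rw [← hzw]; exact hsmall.le.trans (hexp z hz w).1
    have hεs : ε ≤ √ε := by nlinarith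
    have hyw : ∀ w, √ε ≤ normAtPlace w y := fun w => by
      have := normAtPlace_sub_le K x y w
      linarith [hxw w]
    let Y : realSpace K := normAtAllPlaces y
    have hYpos : Y ∈ Set.univ.pi fun _ => Ioi (0:ℝ) := by
      rw [Set.mem_univ_pi]; intro w; exact hs.trans_le (hyw w)
    set z' := expMapBasis.symm Y with hz'
    have hzY : expMapBasis z' = Y := by
      rw [hz']
      exact expMapBasis.right_inv hYpos
    have hz'w : ∀ w, expMapBasis z' w = normAtPlace w y := fun w => by rw [hzY]
    have hz'p : z' ∉ paramSet K := fun h => hy ⟨z', h, hzY⟩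
    have hzz : ‖z - z'‖ ≤ ρ := by
      refine hlip z z' (√ε) hs.le fun w => ?_
      rw [hzw, hz'w]
      refine log_close _ _ ε hε (by linarith [hxw w]) (hyw w) ?_ ?_
      · linarith [normAtPlace_sub_le K x y w]
      · have := normAtPlace_sub_le K y x w
        rw [norm_sub_rev] at this
        linarith
    obtain ⟨w, hw⟩ := param_shell K ρ hρ1 z z' hzz hz hz'p
    have : z ∈ Q ∧ z' ∈ Q := by
      rw [hQ]
      simp only [mem_iUnion, mem_union]
      rcases hw with h | h
      · exact ⟨⟨w, Or.inl h.1⟩, ⟨w, Or.inl h.2⟩⟩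
      · exact ⟨⟨w, Or.inr h.1⟩, ⟨w, Or.inr h.2⟩⟩
    exact ⟨Or.inr ⟨z, this.1, hzx⟩, Or.inr ⟨z', this.2, hzY⟩⟩
end LPIT

open Filter
namespace LPIT
open MeasureTheory Topology Set
open scoped Pointwise nonZeroDivisors
open NumberField NumberField.mixedEmbedding NumberField.mixedEmbedding.fundamentalCone InfinitePlace NumberField.Units NumberField.Units.dirichletUnitTheorem

variable (K : Type*) [Field K] [NumberField K]

open scoped Classical in
theorem count_idealSet (J : (Ideal (𝓞 K))⁰) : ∃ κ : ℝ, 0 < κ ∧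
    (fun s : ℝ => (Nat.card {a : idealSet K J // mixedEmbedding.norm (a : mixedSpace K) ≤ s} : ℝ) - κ * s)
      =O[atTop] (fun s : ℝ => s ^ (1 - 1 / (2 * (Module.finrank ℚ K : ℝ)))) := by
  have hn : 0 < Module.finrank ℚ K := Module.finrank_pos
  set n := Module.finrank ℚ K with hndef
  obtain ⟨R, hR, v, hv, hcount⟩ := lattice_count (volume : Measure (mixedSpace K))
    (mixedEmbedding.idealLattice K (FractionalIdeal.mk0 K J))
  obtain ⟨C, ε0, hε0, hshell⟩ := shell K
  have hvolpos : 0 < volume.real (normLeOne K) := by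
    refine ENNReal.toReal_pos ?_ (isBounded_normLeOne K).measure_lt_top.ne
    rw [volume_normLeOne]
    have := regulator_pos K
    have := NNReal.pi_pos
    positivity
  refine ⟨volume.real (normLeOne K) / v, by positivity, ?_⟩
  refine Asymptotics.IsBigO.of_bound (C * √R / v) ?_
  have hev : ∀ᶠ s : ℝ in atTop, R / ε0 ≤ s ^ (1 / (n : ℝ)) :=
    (tendsto_rpow_atTop (by positivity)).eventually_ge_atTop _
  filter_upwards [hev, eventually_gt_atTop 0] with s hs1 hs0
  set t := s ^ (1 / (n : ℝ)) with ht
  have ht0 : 0 < t := Real.rpow_pos_of_pos hs0 _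
  have htn : t ^ n = s := by
    rw [ht, ← Real.rpow_natCast, ← Real.rpow_mul hs0.le, one_div_mul_cancel (by positivity), Real.rpow_one]
  obtain ⟨Sh, hSh, hShv, hShp⟩ := hshell (R / t) (by positivity) (by
    rw [div_le_iff₀ ht0]; rw [div_le_iff₀ hε0] at hs1; linarith)
  have hvs : ∀ A : Set (mixedSpace K), volume (t • A) = ENNReal.ofReal s * volume A := by
    intro A
    rw [Measure.addHaar_smul, mixedEmbedding.finrank, ← hndef, htn, abs_of_pos hs0]
  have hvsr : ∀ A : Set (mixedSpace K), volume.real (t • A) = s * volume.real A := by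
    intro A
    rw [Measure.real, hvs, ENNReal.toReal_mul, ENNReal.toReal_ofReal hs0.le, Measure.real]
  have hmem : ∀ x : mixedSpace K, x ∈ t • normLeOne K ↔ x ∈ fundamentalCone K ∧ mixedEmbedding.norm x ≤ s := by
    intro x
    rw [Set.mem_smul_set_iff_inv_smul_mem₀ ht0.ne', mem_normLeOne, smul_mem_iff_mem (inv_ne_zero ht0.ne'),
      mixedEmbedding.norm_smul, ← hndef, abs_of_pos (inv_pos.mpr ht0), inv_pow, htn,
      inv_mul_le_one₀ hs0]
  have hmain := hcount (t • normLeOne K) (t • Sh) ((isBounded_normLeOne K).smul₀ t)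
    (by rw [hvs]; exact ENNReal.mul_ne_top ENNReal.ofReal_ne_top hSh) (by
      intro x y hxy hx hy
      rw [Set.mem_smul_set_iff_inv_smul_mem₀ ht0.ne'] at hx hy ⊢
      rw [Set.mem_smul_set_iff_inv_smul_mem₀ ht0.ne']
      refine hShp _ _ ?_ hx hy
      rw [← smul_sub, _root_.norm_smul, norm_inv, Real.norm_of_nonneg ht0.le, inv_mul_le_iff₀ ht0]
      rwa [mul_div_cancel₀ R ht0.ne'])
  rw [hvsr, hvsr] at hmain
  have hcard : Nat.card {a : idealSet K J // mixedEmbedding.norm (a : mixedSpace K) ≤ s} =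
      Nat.card {a : mixedEmbedding.idealLattice K (FractionalIdeal.mk0 K J) // (a : mixedSpace K) ∈ t • normLeOne K} := by
    refine Nat.card_congr
      { toFun := fun a => ⟨⟨a.1.1, a.1.2.2⟩, (hmem _).mpr ⟨a.1.2.1, a.2⟩⟩
        invFun := fun a => ⟨⟨a.1.1, ⟨((hmem _).mp a.2).1, a.1.2⟩⟩, ((hmem _).mp a.2).2⟩
        left_inv := fun a => rfl
        right_inv := fun a => rfl }
  rw [hcard]
  set c := (Nat.card {a : mixedEmbedding.idealLattice K (FractionalIdeal.mk0 K J) // (a : mixedSpace K) ∈ t • normLeOne K} : ℝ)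
  have hsq : s * (C * √(R / t)) = C * √R * s ^ (1 - 1 / (2 * (n : ℝ))) := by
    rw [Real.sqrt_div hR.le, Real.rpow_sub hs0, Real.rpow_one]
    have : √t = s ^ (1 / (2 * (n : ℝ))) := by
      rw [Real.sqrt_eq_rpow, ht, ← Real.rpow_mul hs0.le]
      congr 1
      field_simp
    rw [this]; ring
  have h5 : c - volume.real (normLeOne K) / v * s = (c * v - s * volume.real (normLeOne K)) / v := by
    field_simp
  rw [h5, Real.norm_eq_abs, abs_div, abs_of_pos hv, Real.norm_of_nonneg (Real.rpow_nonneg hs0.le _),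
    div_mul_eq_mul_div]
  refine div_le_div_of_nonneg_right (hmain.trans ?_) hv.le
  rw [← hsq]
  gcongr

theorem card_class (C : ClassGroup (𝓞 K)) (J : (Ideal (𝓞 K))⁰) (s : ℝ) (hJ : ClassGroup.mk0 J = C⁻¹) :
    Nat.card {I : (Ideal (𝓞 K))⁰ // Ideal.absNorm (I : Ideal (𝓞 K)) ≤ s ∧ ClassGroup.mk0 I = C}
      = Nat.card {I : (Ideal (𝓞 K))⁰ // (J : Ideal (𝓞 K)) ∣ I ∧ Submodule.IsPrincipal (I : Ideal (𝓞 K)) ∧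
        Ideal.absNorm (I : Ideal (𝓞 K)) ≤ s * Ideal.absNorm (J : Ideal (𝓞 K))} := by
  simp_rw [← nonZeroDivisors_dvd_iff_dvd_coe]
  refine Nat.card_congr ?_
  refine ((Equiv.dvd J).subtypeEquiv fun I ↦ ?_).trans
    (Equiv.subtypeSubtypeEquivSubtypeInter (fun I : (Ideal (𝓞 K))⁰ ↦ J ∣ I) _)
  rw [← ClassGroup.mk0_eq_one_iff (SetLike.coe_mem _)]
  simp_rw [Equiv.dvd_apply, Submonoid.coe_mul, ← Submonoid.mul_def, _root_.map_mul, hJ,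
    inv_mul_eq_one, Nat.cast_mul, mul_comm s, eq_comm, and_comm, and_congr_left_iff]
  exact fun _ ↦
    (mul_le_mul_iff_of_pos_left (Nat.cast_pos.mpr (Ideal.absNorm_pos_of_nonZeroDivisors J))).symm

theorem count_class (C : ClassGroup (𝓞 K)) : ∃ κ : ℝ, 0 < κ ∧
    (fun s : ℝ => (Nat.card {I : (Ideal (𝓞 K))⁰ // Ideal.absNorm (I : Ideal (𝓞 K)) ≤ s ∧ ClassGroup.mk0 I = C} : ℝ) - κ * s)
      =O[atTop] (fun s : ℝ => s ^ (1 - 1 / (2 * (Module.finrank ℚ K : ℝ)))) := by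
  obtain ⟨J, hJ⟩ := ClassGroup.mk0_surjective C⁻¹
  have hJ0 : (0:ℝ) < Ideal.absNorm J.1 := Nat.cast_pos.mpr (Ideal.absNorm_pos_of_nonZeroDivisors J)
  have hT0 : (0:ℝ) < torsionOrder K := Nat.cast_pos.mpr (Nat.pos_of_ne_zero (torsionOrder_ne_zero K))
  obtain ⟨κ, hκ, h⟩ := count_idealSet K J
  refine ⟨κ * Ideal.absNorm J.1 / torsionOrder K, by positivity, ?_⟩
  have h2 := h.comp_tendsto (tendsto_id.atTop_mul_const' hJ0)
  have h3 := h2.const_mul_left ((torsionOrder K : ℝ)⁻¹)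
  have h4 : ((fun s : ℝ => s ^ (1 - 1 / (2 * (Module.finrank ℚ K : ℝ)))) ∘ (fun s : ℝ => id s * (Ideal.absNorm J.1 : ℝ))) =O[atTop]
      (fun s : ℝ => s ^ (1 - 1 / (2 * (Module.finrank ℚ K : ℝ)))) := by
    refine Asymptotics.IsBigO.of_bound ((Ideal.absNorm J.1 : ℝ) ^ (1 - 1 / (2 * (Module.finrank ℚ K : ℝ)))) ?_
    filter_upwards [eventually_gt_atTop 0] with s hs
    rw [Function.comp_apply, id, Real.mul_rpow hs.le hJ0.le, norm_mul, mul_comm]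
    gcongr
    rw [Real.norm_of_nonneg (by positivity)]
  refine (h3.trans h4).congr_left ?_
  intro s
  simp only [Function.comp_apply, id]
  rw [card_class K C J s hJ, ← card_isPrincipal_dvd_norm_le]
  push_cast
  field_simp

theorem count_ideals : ∃ κ : ℝ, 0 < κ ∧
    (fun s : ℝ => (Nat.card {I : (Ideal (𝓞 K))⁰ // Ideal.absNorm (I : Ideal (𝓞 K)) ≤ s} : ℝ) - κ * s)
      =O[atTop] (fun s : ℝ => s ^ (1 - 1 / (2 * (Module.finrank ℚ K : ℝ)))) := by
  classical
  choose κ hκ h using count_class K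
  refine ⟨∑ C, κ C, Finset.sum_pos (fun C _ => hκ C) Finset.univ_nonempty, ?_⟩
  have h1 := Asymptotics.IsBigO.fun_sum (s := Finset.univ) (fun C _ => h C)
  refine h1.congr' ?_ EventuallyEq.rfl
  filter_upwards [eventually_ge_atTop 0] with s hs
  rw [Finset.sum_sub_distrib, Finset.sum_mul]
  congr 1
  have : Fintype {I : (Ideal (𝓞 K))⁰ // Ideal.absNorm (I : Ideal (𝓞 K)) ≤ s} := by
    simp_rw [← Nat.le_floor_iff hs]
    refine @Fintype.ofFinite _ (Ideal.finite_setOfPred_absNorm_le₀ ⌊s⌋₊)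
  let e := fun C : ClassGroup (𝓞 K) ↦ Equiv.subtypeSubtypeEquivSubtypeInter
    (fun I : (Ideal (𝓞 K))⁰ ↦ Ideal.absNorm I.1 ≤ s) (fun I ↦ ClassGroup.mk0 I = C)
  simp_rw [← Nat.card_congr (e _), Nat.card_eq_fintype_card, Fintype.subtype_card]
  rw [Fintype.card, Finset.card_eq_sum_card_fiberwise (f := fun I ↦ ClassGroup.mk0 I.1)
    (t := Finset.univ) (fun _ _ ↦ Finset.mem_univ _), Nat.cast_sum]
end LPIT

open Filter

namespace LPIT
open MeasureTheory Topology Set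

/-- triangle function -/
noncomputable def tri (t : ℝ) : ℝ := max 0 (1 - |t|)

lemma tri_continuous : Continuous tri := by unfold tri; fun_prop

lemma tri_nonneg (t : ℝ) : 0 ≤ tri t := le_max_left _ _
lemma tri_le_one (t : ℝ) : tri t ≤ 1 := by
  unfold tri; exact max_le zero_le_one (by linarith [abs_nonneg t])

lemma tri_eq_zero {t : ℝ} (h : t ∉ Icc (-1:ℝ) 1) : tri t = 0 := by
  unfold tri
  apply max_eq_left
  rw [mem_Icc, ← abs_le] at h
  linarith

lemma tri_compact : HasCompactSupport tri :=
  HasCompactSupport.intro isCompact_Icc (fun _ h => tri_eq_zero h)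

lemma tri_integrable : Integrable tri := tri_continuous.integrable_of_hasCompactSupport tri_compact

/-- Fejér kernel -/
noncomputable def fej (y : ℝ) : ℝ := if y = 0 then 1 else 2 * (1 - Real.cos y) / y ^ 2

lemma fej_nonneg (y : ℝ) : 0 ≤ fej y := by
  unfold fej
  split_ifs
  · exact zero_le_one
  · have := Real.cos_le_one y
    have : 0 ≤ 1 - Real.cos y := by linarith
    positivity

lemma fej_le (y : ℝ) : fej y ≤ 5 * (1 + y ^ 2)⁻¹ := by
  have h1 : fej y ≤ 1 := by
    unfold fej
    split_ifs with h
    · exact le_rfl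
    · rw [div_le_one (by positivity)]
      linarith [Real.one_sub_sq_div_two_le_cos (x := y)]
  by_cases h : y ^ 2 ≤ 4
  · refine h1.trans ?_
    rw [← div_eq_mul_inv, le_div_iff₀ (by positivity)]
    linarith
  · push Not at h
    have hy : y ≠ 0 := by rintro rfl; norm_num at h
    unfold fej
    rw [if_neg hy, ← div_eq_mul_inv, div_le_div_iff₀ (by positivity) (by positivity)]
    have := Real.neg_one_le_cos y
    nlinarith

lemma fej_le_one (y : ℝ) : fej y ≤ 1 := by
  unfold fej
  split_ifs with h
  · exact le_rfl
  · rw [div_le_one (by positivity)]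
    linarith [Real.one_sub_sq_div_two_le_cos (x := y)]

lemma fej_measurable : Measurable fej := by
  unfold fej
  exact Measurable.ite (measurableSet_singleton 0) measurable_const (by fun_prop)

lemma fej_integrable : Integrable fej := by
  refine (integrable_inv_one_add_sq.const_mul 5).mono' fej_measurable.aestronglyMeasurable ?_
  filter_upwards with y
  rw [Real.norm_of_nonneg (fej_nonneg y)]
  exact fej_le y

lemma fej_integral_pos : 0 < ∫ y, fej y := by
  rw [integral_pos_iff_support_of_nonneg fej_nonneg fej_integrable]
  refine lt_of_lt_of_le ?_ (measure_mono (s := Ioo 0 1) ?_)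
  · simp
  · intro y hy
    have : y ≠ 0 := hy.1.ne'
    simp only [Function.mem_support, fej, if_neg this]
    have h : Real.cos y < Real.cos 0 := by
      apply Real.cos_lt_cos_of_nonneg_of_le_pi le_rfl _ hy.1
      linarith [Real.pi_gt_three, hy.2]
    rw [Real.cos_zero] at h
    have : 0 < 1 - Real.cos y := by linarith
    have := hy.1
    positivity

lemma tri_fourier (y : ℝ) :
    ∫ t : ℝ, (tri t : ℂ) * Complex.exp (Complex.I * t * y) = fej y := by
  have key : ∫ t : ℝ, (tri t : ℂ) * Complex.exp (Complex.I * t * y)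
      = ((∫ t in (0:ℝ)..1, (1 - t) * (2 * Real.cos (t * y)) : ℝ) : ℂ) := by
    have h1 : ∫ t : ℝ, (tri t : ℂ) * Complex.exp (Complex.I * t * y)
        = ∫ t in (-1:ℝ)..1, (tri t : ℂ) * Complex.exp (Complex.I * t * y) := by
      rw [intervalIntegral.integral_of_le (by norm_num), ← integral_Icc_eq_integral_Ioc,
        setIntegral_eq_integral_of_forall_compl_eq_zero]
      intro t ht
      rw [tri_eq_zero ht]; simp
    have hc : Continuous (fun t : ℝ => (tri t : ℂ) * Complex.exp (Complex.I * t * y)) := by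
      have := tri_continuous
      fun_prop
    rw [h1, ← intervalIntegral.integral_add_adjacent_intervals (b := 0)
      (hc.intervalIntegrable _ _) (hc.intervalIntegrable _ _)]
    have h2 : ∫ t in (-1:ℝ)..0, (tri t : ℂ) * Complex.exp (Complex.I * t * y)
       = ∫ t in (0:ℝ)..1, (tri (-t) : ℂ) * Complex.exp (Complex.I * (-t : ℝ) * y) := by
      rw [intervalIntegral.integral_comp_neg (fun t : ℝ => (tri t : ℂ) * Complex.exp (Complex.I * t * y))]
      simp
    rw [h2, ← intervalIntegral.integral_add (by
      apply Continuous.intervalIntegrable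
      have := tri_continuous
      fun_prop) (hc.intervalIntegrable _ _), ← intervalIntegral.integral_ofReal]
    apply intervalIntegral.integral_congr
    intro t ht
    rw [uIcc_of_le zero_le_one] at ht
    have ht' : tri t = 1 - t := by
      unfold tri; rw [abs_of_nonneg ht.1]; exact max_eq_right (by linarith [ht.2])
    have ht'' : tri (-t) = 1 - t := by
      unfold tri; rw [abs_neg, abs_of_nonneg ht.1]; exact max_eq_right (by linarith [ht.2])
    simp only [ht', ht'']
    push_cast
    rw [Complex.two_cos]
    have e1 : Complex.I * -(t:ℂ) * y = -(t * y) * Complex.I := by ring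
    have e2 : Complex.I * (t:ℂ) * y = (t * y) * Complex.I := by ring
    rw [e1, e2]; ring
  rw [key]
  congr 1
  unfold fej
  split_ifs with hy
  · subst hy
    simp only [mul_zero, Real.cos_zero, mul_one]
    rw [intervalIntegral.integral_mul_const, intervalIntegral.integral_sub (by simp) (by simp)]
    simp
    norm_num
  · have : ∀ t ∈ uIcc (0:ℝ) 1, HasDerivAt
        (fun t => 2 * ((1 - t) * Real.sin (t * y) / y - Real.cos (t * y) / y ^ 2))
        ((1 - t) * (2 * Real.cos (t * y))) t := by
      intro t _
      have hs : HasDerivAt (fun t => Real.sin (t * y)) (Real.cos (t * y) * (1 * y)) t :=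
        (Real.hasDerivAt_sin _).comp t ((hasDerivAt_id t).mul_const y)
      have hcs : HasDerivAt (fun t => Real.cos (t * y)) (-Real.sin (t * y) * (1 * y)) t :=
        (Real.hasDerivAt_cos _).comp t ((hasDerivAt_id t).mul_const y)
      have := ((((((hasDerivAt_id t).const_sub 1).mul hs).div_const y).sub
        (hcs.div_const (y^2))).const_mul 2)
      refine this.congr_deriv ?_
      simp only [id]
      field_simp
      ring
    rw [intervalIntegral.integral_eq_sub_of_hasDerivAt this (by
      apply Continuous.intervalIntegrable; fun_prop)]
    simp
    field_simp
    ring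

end LPIT

open Filter

namespace LPIT
open MeasureTheory Topology Set

section
variable {B : ℝ → ℝ} {M : ℝ} {G : ℂ → ℂ}

lemma wi_fubini (hBm : Measurable B) (hB : ∀ u, |B u| ≤ M)
    (hG : ∀ s : ℂ, 1 < s.re →
      ∫ u in Ioi (0:ℝ), (B u : ℂ) * Complex.exp (-(s - 1) * u) = G s)
    (l v : ℝ) {ε : ℝ} (hε : 0 < ε) :
    ∫ u in Ioi (0:ℝ), (B u : ℂ) * Real.exp (-ε * u) * fej (l * (v - u)) =
      ∫ t : ℝ, (tri t : ℂ) * Complex.exp (Complex.I * l * t * v) * G (1 + ε + Complex.I * l * t) := by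
  have hM : 0 ≤ M := (abs_nonneg _).trans (hB 0)
  have h1 : ∀ u : ℝ, (B u : ℂ) * Real.exp (-ε * u) * fej (l * (v - u)) =
      ∫ t : ℝ, (B u : ℂ) * Real.exp (-ε * u) *
        ((tri t : ℂ) * Complex.exp (Complex.I * t * (l * (v - u) : ℝ))) := by
    intro u
    rw [integral_const_mul, tri_fourier]
  simp_rw [h1]
  rw [integral_integral_swap]
  · apply integral_congr_ae
    filter_upwards with t
    rw [← hG _ (by simp [hε]), ← integral_const_mul]
    apply integral_congr_ae
    filter_upwards with u
    push_cast
    have : Complex.exp (Complex.I * t * (l * (v - u))) * Complex.exp (-ε * u) =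
      Complex.exp (Complex.I * l * t * v) * Complex.exp (-(1 + ε + Complex.I * l * t - 1) * u) := by
      rw [← Complex.exp_add, ← Complex.exp_add]; congr 1; ring
    linear_combination (B u : ℂ) * tri t * this
  · have hd : Integrable (fun u : ℝ => M * Real.exp (-ε * u)) (volume.restrict (Ioi 0)) :=
      (exp_neg_integrableOn_Ioi 0 hε).const_mul M
    refine (hd.mul_prod tri_integrable).mono' ?_ ?_
    · apply Measurable.aestronglyMeasurable
      have := tri_continuous.measurable
      simp only [Function.uncurry_def]
      fun_prop
    · filter_upwards with p
      simp only [Function.uncurry_def, norm_mul, Complex.norm_real]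
      have : ‖Complex.exp (Complex.I * p.2 * (l * (v - p.1) : ℝ))‖ = 1 := by
        rw [mul_assoc, mul_comm Complex.I, ← Complex.ofReal_mul, Complex.norm_exp_ofReal_mul_I]
      rw [this, mul_one, Real.norm_of_nonneg (tri_nonneg _), Real.norm_of_nonneg (Real.exp_nonneg _)]
      have := hB p.1
      have := tri_nonneg p.2
      have := Real.exp_nonneg (-ε * p.1)
      rw [Real.norm_eq_abs]
      gcongr

lemma wi_limit (hBm : Measurable B) (hB : ∀ u, |B u| ≤ M)
    (hGc : ContinuousOn G {s | 1 ≤ s.re})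
    (hG : ∀ s : ℂ, 1 < s.re →
      ∫ u in Ioi (0:ℝ), (B u : ℂ) * Complex.exp (-(s - 1) * u) = G s)
    {l : ℝ} (hl : 0 < l) (v : ℝ) :
    ∫ u in Ioi (0:ℝ), (B u : ℂ) * fej (l * (v - u)) =
      ∫ t : ℝ, (tri t : ℂ) * Complex.exp (Complex.I * l * t * v) * G (1 + Complex.I * l * t) := by
  have hM : 0 ≤ M := (abs_nonneg _).trans (hB 0)
  have hfi : Integrable (fun u => fej (l * (v - u))) := by
    have := (fej_integrable.comp_mul_left' hl.ne').comp_sub_left v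
    exact this
  have hfm := fej_measurable
  have htm := tri_continuous.measurable
  have L1 : Tendsto (fun ε : ℝ => ∫ u in Ioi (0:ℝ), (B u : ℂ) * Real.exp (-ε * u) * fej (l * (v - u)))
      (𝓝[>] 0) (𝓝 (∫ u in Ioi (0:ℝ), (B u : ℂ) * fej (l * (v - u)))) := by
    apply tendsto_integral_filter_of_dominated_convergence (fun u => M * fej (l * (v - u)))
    · filter_upwards with ε
      apply Measurable.aestronglyMeasurable
      fun_prop
    · filter_upwards [self_mem_nhdsWithin] with ε (hε : 0 < ε)
      filter_upwards [ae_restrict_mem measurableSet_Ioi] with u (hu : 0 < u)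
      simp only [norm_mul, Complex.norm_real]
      rw [Real.norm_of_nonneg (fej_nonneg _), Real.norm_of_nonneg (Real.exp_nonneg _)]
      have h1 : Real.exp (-ε * u) ≤ 1 := Real.exp_le_one_iff.mpr (by nlinarith)
      have h2 := fej_nonneg (l * (v - u))
      calc ‖B u‖ * Real.exp (-ε * u) * fej (l * (v - u)) ≤ M * 1 * fej (l * (v - u)) := by
            gcongr; exact hB u
        _ = _ := by ring
    · exact (hfi.const_mul M).restrict
    · filter_upwards with u
      have : Continuous (fun ε : ℝ => (B u : ℂ) * Real.exp (-ε * u) * fej (l * (v - u))) := by fun_prop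
      have := this.tendsto 0
      simp only [neg_zero, zero_mul, Real.exp_zero, Complex.ofReal_one, mul_one] at this
      exact this.mono_left nhdsWithin_le_nhds
  let Φ : ℝ × ℝ → ℂ := fun p => G (1 + p.1 + Complex.I * l * p.2)
  have hΦ : ContinuousOn Φ (Ici 0 ×ˢ univ) := by
    apply hGc.comp (by fun_prop)
    rintro ⟨a, b⟩ ⟨ha, _⟩
    simp at ha ⊢
    exact ha
  obtain ⟨C, hC⟩ := ((isCompact_Icc (a := (0:ℝ)) (b := 1)).prod
    (isCompact_Icc (a := (-1:ℝ)) (b := 1))).exists_bound_of_continuousOn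
      (hΦ.mono (prod_mono (fun x hx => hx.1) (subset_univ _)))
  have L2 : Tendsto (fun ε : ℝ => ∫ t : ℝ, (tri t : ℂ) * Complex.exp (Complex.I * l * t * v) *
        G (1 + ε + Complex.I * l * t)) (𝓝[>] 0)
      (𝓝 (∫ t : ℝ, (tri t : ℂ) * Complex.exp (Complex.I * l * t * v) * G (1 + Complex.I * l * t))) := by
    apply tendsto_integral_filter_of_dominated_convergence (fun t => tri t * C)
    · filter_upwards [self_mem_nhdsWithin] with ε (hε : 0 < ε)
      apply Continuous.aestronglyMeasurable
      apply Continuous.mul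
      · have := tri_continuous
        fun_prop
      · have : Continuous (fun t : ℝ => Φ (ε, t)) := by
          apply hΦ.comp_continuous (by fun_prop)
          intro t
          simp [hε.le]
        exact this
    · filter_upwards [Ioc_mem_nhdsGT zero_lt_one] with ε hε
      filter_upwards with t
      by_cases ht : t ∈ Icc (-1:ℝ) 1
      · simp only [norm_mul, Complex.norm_real]
        have : ‖Complex.exp (Complex.I * l * t * v)‖ = 1 := by
          rw [mul_assoc, mul_assoc, mul_comm Complex.I, ← Complex.ofReal_mul, ← Complex.ofReal_mul,
            Complex.norm_exp_ofReal_mul_I]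
        rw [this, mul_one, Real.norm_of_nonneg (tri_nonneg _)]
        have h3 := hC (ε, t) ⟨⟨hε.1.le, hε.2⟩, ht⟩
        exact mul_le_mul_of_nonneg_left h3 (tri_nonneg _)
      · rw [tri_eq_zero ht]; simp
    · exact tri_integrable.mul_const C
    · filter_upwards with t
      apply Tendsto.const_mul
      have h0 : ContinuousWithinAt (fun ε : ℝ => Φ (ε, t)) (Ioi 0) 0 := by
        have : ContinuousOn (fun ε : ℝ => Φ (ε, t)) (Ici 0) := by
          apply hΦ.comp (by fun_prop)
          intro e he
          exact ⟨he, mem_univ _⟩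
        exact (this 0 self_mem_Ici).mono Ioi_subset_Ici_self
      have := h0.tendsto
      simpa [Φ] using this
  refine tendsto_nhds_unique L1 (L2.congr' ?_)
  filter_upwards [self_mem_nhdsWithin] with ε (hε : 0 < ε)
  exact (wi_fubini hBm hB hG l v hε).symm

lemma wi_tendsto (hBm : Measurable B) (hB : ∀ u, |B u| ≤ M)
    (hGc : ContinuousOn G {s | 1 ≤ s.re})
    (hG : ∀ s : ℂ, 1 < s.re →
      ∫ u in Ioi (0:ℝ), (B u : ℂ) * Complex.exp (-(s - 1) * u) = G s)
    {l : ℝ} (hl : 0 < l) :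
    Tendsto (fun v : ℝ => ∫ u in Ioi (0:ℝ), B u * fej (l * (v - u))) atTop (𝓝 0) := by
  have hRL := Real.tendsto_integral_exp_smul_cocompact
    (fun t : ℝ => (tri t : ℂ) * G (1 + Complex.I * l * t))
  have hc : Tendsto (fun v : ℝ => -(l / (2 * Real.pi)) * v) atTop (cocompact ℝ) := by
    have : Tendsto (fun v : ℝ => -(l / (2 * Real.pi)) * v) atTop atBot := by
      apply Tendsto.const_mul_atTop_of_neg _ tendsto_id
      have := Real.pi_pos
      have : 0 < l / (2 * Real.pi) := by positivity
      linarith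
    exact this.mono_right atBot_le_cocompact
  have h := hRL.comp hc
  have h2 : Tendsto (fun v : ℝ => ((∫ u in Ioi (0:ℝ), B u * fej (l * (v - u)) : ℝ) : ℂ)) atTop (𝓝 0) := by
    refine h.congr ?_
    intro v
    rw [← integral_complex_ofReal]
    push_cast
    rw [wi_limit hBm hB hGc hG hl v]
    apply integral_congr_ae
    filter_upwards with t
    simp only [Real.fourierChar_apply', Circle.smul_def, Circle.coe_exp, smul_eq_mul]
    push_cast
    have : (2 * (Real.pi:ℂ) * -((t:ℂ) * (-(l / (2 * Real.pi)) * v))) * Complex.I = Complex.I * l * t * v := by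
      have : (Real.pi : ℂ) ≠ 0 := by exact_mod_cast Real.pi_ne_zero
      field_simp
    rw [this]; ring
  have h3 := (Complex.continuous_re.tendsto 0).comp h2
  simpa [Function.comp_def] using h3

end
end LPIT

open Filter

namespace LPIT
open MeasureTheory Topology Set

noncomputable def fejc : ℝ := ∫ y, fej y
noncomputable def feja (R : ℝ) : ℝ := ∫ y in Icc (-R) R, fej y

lemma fejc_pos : 0 < fejc := fej_integral_pos

lemma feja_tendsto : Tendsto feja atTop (𝓝 fejc) := by
  have hc : AECover volume atTop (fun R : ℝ => Icc (-R) R) :=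
    aecover_Icc tendsto_neg_atTop_atBot tendsto_id
  exact hc.integral_tendsto_of_countably_generated fej_integrable

lemma fej_scale (g : ℝ → ℝ) {l : ℝ} (hl : 0 < l) (v : ℝ) :
    ∫ u, g (l * (v - u)) = l⁻¹ * ∫ y, g y := by
  rw [integral_sub_left_eq_self (fun u => g (l * u)) volume v,
    Measure.integral_comp_mul_left, abs_of_pos (inv_pos.mpr hl), smul_eq_mul]

lemma fej_scale_integrable {g : ℝ → ℝ} (hg : Integrable g) {l : ℝ} (hl : 0 < l) (v : ℝ) :
    Integrable (fun u => g (l * (v - u))) :=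
  (hg.comp_mul_left' hl.ne').comp_sub_left v

section
variable {B : ℝ → ℝ} {M : ℝ}

lemma fej_half {l : ℝ} (hl : 0 < l) :
    Tendsto (fun v : ℝ => l * ∫ u in Ioi (0:ℝ), fej (l * (v - u))) atTop (𝓝 fejc) := by
  have h : ∀ v : ℝ, l * ∫ u in Ioi (0:ℝ), fej (l * (v - u)) = ∫ y in Iio (l * v), fej y := by
    intro v
    rw [← integral_indicator measurableSet_Ioi, ← integral_indicator measurableSet_Iio]
    have := fej_scale ((Iio (l * v)).indicator fej) hl v
    have h2 : (fun u => (Iio (l * v)).indicator fej (l * (v - u))) =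
        (Ioi (0:ℝ)).indicator (fun u => fej (l * (v - u))) := by
      ext u
      simp only [indicator, mem_Iio, mem_Ioi]
      have : l * (v - u) < l * v ↔ 0 < u := by
        rw [mul_lt_mul_iff_right₀ hl]; constructor <;> intro h <;> linarith
      simp [this]
    rw [h2] at this
    rw [this]; field_simp
  simp_rw [h]
  have hc : AECover volume atTop (fun v : ℝ => Iio (l * v)) :=
    aecover_Iio (tendsto_id.const_mul_atTop hl)
  exact hc.integral_tendsto_of_countably_generated fej_integrable

lemma taub_upper (hBm : Measurable B) (hB0 : ∀ u, 0 ≤ B u) (hB : ∀ u, B u ≤ M)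
    (hmono : ∀ u w, u ≤ w → B u * Real.exp u ≤ B w * Real.exp w)
    {h l v : ℝ} (hh : 0 < h) (hl : 0 < l) (hv : 0 < v) :
    B v * Real.exp (-(2*h)) * feja (l * h) ≤
      l * ∫ u in Ioi (0:ℝ), B u * fej (l * (v + h - u)) := by
  have e1 : feja (l * h) = l * ∫ u, (Icc (-(l*h)) (l*h)).indicator fej (l * (v + h - u)) := by
    rw [fej_scale _ hl, integral_indicator measurableSet_Icc, feja]; field_simp
  rw [e1, mul_left_comm]
  apply mul_le_mul_of_nonneg_left _ hl.le
  rw [← integral_indicator measurableSet_Ioi, ← integral_const_mul]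
  apply integral_mono
  · exact (fej_scale_integrable (fej_integrable.indicator measurableSet_Icc) hl _).const_mul _
  · apply Integrable.indicator _ measurableSet_Ioi
    refine ((fej_scale_integrable fej_integrable hl (v+h)).const_mul M).mono' ?_ ?_
    · have := fej_measurable
      apply Measurable.aestronglyMeasurable; fun_prop
    · filter_upwards with u
      rw [norm_mul, Real.norm_of_nonneg (hB0 u), Real.norm_of_nonneg (fej_nonneg _)]
      exact mul_le_mul_of_nonneg_right (hB u) (fej_nonneg _)
  · intro u
    simp only [indicator, mem_Icc, mem_Ioi]
    split_ifs with h1 h2 h2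
    · apply mul_le_mul_of_nonneg_right _ (fej_nonneg _)
      have hu1 : v ≤ u := by
        have := le_of_mul_le_mul_left h1.2 hl
        linarith
      have hu2 : u ≤ v + 2 * h := by
        have : l * (-h) ≤ l * (v + h - u) := by linarith [h1.1]
        have := le_of_mul_le_mul_left this hl
        linarith
      have := hmono v u hu1
      have e : B u = B u * Real.exp u * Real.exp (-u) := by
        rw [mul_assoc, ← Real.exp_add]; simp
      rw [e]
      calc B v * Real.exp (-(2*h)) ≤ B v * Real.exp (v - u) := by
            apply mul_le_mul_of_nonneg_left _ (hB0 v)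
            apply Real.exp_le_exp.mpr; linarith
        _ = B v * Real.exp v * Real.exp (-u) := by rw [mul_assoc, ← Real.exp_add]; ring_nf
        _ ≤ _ := mul_le_mul_of_nonneg_right this (Real.exp_nonneg _)
    · exfalso
      have := le_of_mul_le_mul_left h1.2 hl
      apply h2; linarith
    · simp only [mul_zero]
      exact mul_nonneg (hB0 u) (fej_nonneg _)
    · simp

lemma taub_lower (hBm : Measurable B) (hB0 : ∀ u, 0 ≤ B u) (hB : ∀ u, B u ≤ M)
    (hmono : ∀ u w, u ≤ w → B u * Real.exp u ≤ B w * Real.exp w)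
    {h l v : ℝ} (hh : 0 < h) (hl : 0 < l) :
    l * ∫ u in Ioi (0:ℝ), B u * fej (l * (v - h - u)) ≤
      B v * Real.exp (2*h) * fejc + M * (fejc - feja (l * h)) := by
  have hM : 0 ≤ M := (hB0 0).trans (hB 0)
  have e1 : feja (l * h) = l * ∫ u, (Icc (-(l*h)) (l*h)).indicator fej (l * (v - h - u)) := by
    rw [fej_scale _ hl, integral_indicator measurableSet_Icc, feja]; field_simp
  have e2 : fejc = l * ∫ u, fej (l * (v - h - u)) := by
    rw [fej_scale _ hl, fejc]; field_simp
  have i1 := fej_scale_integrable fej_integrable hl (v - h)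
  have i2 := fej_scale_integrable (fej_integrable.indicator (measurableSet_Icc (a := -(l*h)) (b := l*h))) hl (v-h)
  have e3 : B v * Real.exp (2*h) * fejc + M * (fejc - feja (l * h)) = l * ∫ u,
     (B v * Real.exp (2*h) * fej (l * (v - h - u)) +
      M * (fej (l * (v - h - u)) - (Icc (-(l*h)) (l*h)).indicator fej (l * (v - h - u)))) := by
    rw [integral_add (i1.const_mul _) ((show Integrable (fun u => fej (l * (v - h - u)) - (Icc (-(l*h)) (l*h)).indicator fej (l * (v - h - u))) from i1.sub i2).const_mul M), integral_const_mul, integral_const_mul,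
      integral_sub i1 i2, e1, e2]
    ring
  rw [e3]
  apply mul_le_mul_of_nonneg_left _ hl.le
  rw [← integral_indicator measurableSet_Ioi]
  apply integral_mono
  · apply Integrable.indicator _ measurableSet_Ioi
    refine (i1.const_mul M).mono' ?_ ?_
    · have := fej_measurable
      apply Measurable.aestronglyMeasurable; fun_prop
    · filter_upwards with u
      rw [norm_mul, Real.norm_of_nonneg (hB0 u), Real.norm_of_nonneg (fej_nonneg _)]
      exact mul_le_mul_of_nonneg_right (hB u) (fej_nonneg _)
  · exact (i1.const_mul _).add ((i1.sub i2).const_mul M)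
  · intro u
    have hf := fej_nonneg (l * (v - h - u))
    have hq : 0 ≤ B v * Real.exp (2*h) * fej (l * (v - h - u)) := by
      have := hB0 v; positivity
    have hR : B u * fej (l * (v - h - u)) ≤ (B v * Real.exp (2*h) * fej (l * (v - h - u)) +
      M * (fej (l * (v - h - u)) - (Icc (-(l*h)) (l*h)).indicator fej (l * (v - h - u)))) := by
      simp only [indicator, mem_Icc]
      split_ifs with h1
      · rw [sub_self, mul_zero, add_zero]
        apply mul_le_mul_of_nonneg_right _ (fej_nonneg _)
        have hu1 : v - 2 * h ≤ u := by
          have := le_of_mul_le_mul_left h1.2 hl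
          linarith
        have hu2 : u ≤ v := by
          have : l * (-h) ≤ l * (v - h - u) := by linarith [h1.1]
          have := le_of_mul_le_mul_left this hl
          linarith
        have := hmono u v hu2
        have e : B u = B u * Real.exp u * Real.exp (-u) := by
          rw [mul_assoc, ← Real.exp_add]; simp
        rw [e]
        calc B u * Real.exp u * Real.exp (-u) ≤ B v * Real.exp v * Real.exp (-u) :=
              mul_le_mul_of_nonneg_right this (Real.exp_nonneg _)
          _ = B v * Real.exp (v - u) := by rw [mul_assoc, ← Real.exp_add]; ring_nf
          _ ≤ _ := by
            apply mul_le_mul_of_nonneg_left _ (hB0 v)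
            apply Real.exp_le_exp.mpr; linarith
      · rw [sub_zero]
        have := mul_le_mul_of_nonneg_right (hB u) hf
        linarith
    refine le_trans (indicator_le_self' ?_ u) hR
    intro _ _
    exact mul_nonneg (hB0 _) (fej_nonneg _)

lemma taub (hBm : Measurable B) (hB0 : ∀ u, 0 ≤ B u) (hB : ∀ u, B u ≤ M)
    (hmono : ∀ u w, u ≤ w → B u * Real.exp u ≤ B w * Real.exp w)
    (hlim : ∀ l : ℝ, 0 < l → Tendsto (fun v : ℝ => l * ∫ u in Ioi (0:ℝ), B u * fej (l * (v - u)))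
      atTop (𝓝 fejc)) : Tendsto B atTop (𝓝 1) := by
  have hc := fejc_pos
  have ha : Tendsto (fun h : ℝ => feja (h⁻¹)) (𝓝[>] 0) (𝓝 fejc) :=
    feja_tendsto.comp tendsto_inv_nhdsGT_zero
  have he : Tendsto (fun h : ℝ => Real.exp (-(2*h))) (𝓝[>] 0) (𝓝 1) := by
    have : Continuous (fun h : ℝ => Real.exp (-(2*h))) := by fun_prop
    have := this.tendsto 0
    simp at this
    exact this.mono_left nhdsWithin_le_nhds
  have he2 : Tendsto (fun h : ℝ => Real.exp (2*h)) (𝓝[>] 0) (𝓝 1) := by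
    have : Continuous (fun h : ℝ => Real.exp (2*h)) := by fun_prop
    have := this.tendsto 0
    simp at this
    exact this.mono_left nhdsWithin_le_nhds
  rw [tendsto_order]
  constructor
  · intro b hb
    have h1 : Tendsto (fun h : ℝ => (fejc - M * (fejc - feja h⁻¹)) - b * (Real.exp (2*h) * fejc)) (𝓝[>] 0)
        (𝓝 ((fejc - M * (fejc - fejc)) - b * (1 * fejc))) :=
      (tendsto_const_nhds.sub ((tendsto_const_nhds.sub ha).const_mul M)).sub
        ((he2.mul_const _).const_mul b)
    have h2 : 0 < ((fejc - M * (fejc - fejc)) - b * (1 * fejc)) := by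
      have : 0 < (1 - b) * fejc := mul_pos (by linarith) hc
      linarith
    obtain ⟨h, h3, hh⟩ := ((h1.eventually_const_lt h2).and self_mem_nhdsWithin).exists
    have hh : 0 < h := hh
    have hl : 0 < h⁻¹ * h⁻¹ := by positivity
    have h4 : Tendsto (fun v : ℝ => v - h) atTop atTop := tendsto_atTop_add_const_right _ (-h) tendsto_id
    have h5 := (hlim _ hl).comp h4
    have h6 : fejc - (fejc - M * (fejc - feja h⁻¹) - b * (Real.exp (2*h) * fejc)) < fejc := by linarith
    filter_upwards [h5.eventually_const_lt h6] with v hv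
    simp only [Function.comp] at hv
    have h7 := taub_lower hBm hB0 hB hmono (v := v) hh hl
    rw [mul_assoc h⁻¹ h⁻¹ h, inv_mul_cancel₀ hh.ne', mul_one] at h7
    have h8 := hv.trans_le h7
    have h9 : b * (Real.exp (2*h) * fejc) < B v * (Real.exp (2*h) * fejc) := by linarith
    exact lt_of_mul_lt_mul_right h9 (by positivity)
  · intro b hb
    have h1 : Tendsto (fun h : ℝ => b * (Real.exp (-(2*h)) * feja h⁻¹)) (𝓝[>] 0) (𝓝 (b * (1 * fejc))) :=
      (he.mul ha).const_mul b
    have h2 : fejc < b * (1 * fejc) := by nlinarith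
    have h1' : Tendsto (fun h : ℝ => (Real.exp (-(2*h)) * feja h⁻¹)) (𝓝[>] 0) (𝓝 (1 * fejc)) := (he.mul ha)
    obtain ⟨h, ⟨h3, h3'⟩, hh⟩ := (((h1.eventually_const_lt h2).and
      (h1'.eventually_const_lt (by linarith : 0 < 1 * fejc))).and self_mem_nhdsWithin).exists
    have hh : 0 < h := hh
    have hl : 0 < h⁻¹ * h⁻¹ := by positivity
    have h4 : Tendsto (fun v : ℝ => v + h) atTop atTop := tendsto_atTop_add_const_right _ h tendsto_id
    have h5 := (hlim _ hl).comp h4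
    filter_upwards [h5.eventually_lt_const h3, eventually_gt_atTop 0] with v hv hv0
    simp only [Function.comp] at hv
    have h7 := taub_upper hBm hB0 hB hmono hh hl hv0
    rw [mul_assoc h⁻¹ h⁻¹ h, inv_mul_cancel₀ hh.ne', mul_one] at h7
    have h8 := h7.trans_lt hv
    have h9 : B v * (Real.exp (-(2*h)) * feja h⁻¹) < b * (Real.exp (-(2*h)) * feja h⁻¹) := by linarith
    exact lt_of_mul_lt_mul_right h9 h3'.le

end

theorem wiener_ikehara (f : ℕ → ℝ) (hf : ∀ n, 0 ≤ f n) (M : ℝ)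
    (hO : ∀ n : ℕ, ∑ k ∈ Finset.Icc 1 n, f k ≤ M * n) (G : ℂ → ℂ)
    (hGc : ContinuousOn G {s | 1 ≤ s.re})
    (hG : ∀ s : ℂ, 1 < s.re → LSeries (fun n => (f n : ℂ)) s = 1 / (s - 1) + G s) :
    Tendsto (fun x : ℝ => (∑ k ∈ Finset.Icc 1 ⌊x⌋₊, f k) / x) atTop (𝓝 1) := by
  set S : ℝ → ℝ := fun x => ∑ k ∈ Finset.Icc 1 ⌊x⌋₊, f k with hS
  have hM : 0 ≤ M := by have := hO 1; simp at this; exact (hf 1).trans this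
  have hSmono : Monotone S := by
    intro x y hxy
    apply Finset.sum_le_sum_of_subset_of_nonneg
    · exact Finset.Icc_subset_Icc le_rfl (Nat.floor_mono hxy)
    · intros; exact hf _
  have hS0 : ∀ x, 0 ≤ S x := fun x => Finset.sum_nonneg (fun _ _ => hf _)
  have hSM : ∀ x, 0 ≤ x → S x ≤ M * x := fun x hx =>
    (hO _).trans (mul_le_mul_of_nonneg_left (Nat.floor_le hx) hM)
  set B : ℝ → ℝ := fun u => S (Real.exp u) * Real.exp (-u) with hBdef
  have hBm : Measurable B := by
    have := hSmono.measurable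
    fun_prop
  have hB0 : ∀ u, 0 ≤ B u := fun u => mul_nonneg (hS0 _) (Real.exp_nonneg _)
  have hB : ∀ u, B u ≤ M := by
    intro u
    calc B u ≤ M * Real.exp u * Real.exp (-u) :=
          mul_le_mul_of_nonneg_right (hSM _ (Real.exp_nonneg _)) (Real.exp_nonneg _)
      _ = M := by rw [mul_assoc, ← Real.exp_add]; simp
  have hBe : ∀ u, B u * Real.exp u = S (Real.exp u) := by
    intro u
    simp only [hBdef]; rw [mul_assoc, ← Real.exp_add]; simp
  have hmono : ∀ u w, u ≤ w → B u * Real.exp u ≤ B w * Real.exp w := by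
    intro u w huw
    rw [hBe, hBe]
    exact hSmono (Real.exp_le_exp.mpr huw)
  have hbd : ∀ u, |B u - 1| ≤ M + 1 := by
    intro u
    rw [abs_le]; constructor <;> linarith [hB0 u, hB u]
  have hexp : ∀ s : ℂ, 1 < s.re → IntegrableOn (fun u : ℝ => Complex.exp (-(s - 1) * u)) (Ioi 0) := by
    intro s hs
    exact integrableOn_exp_mul_complex_Ioi (by simpa using hs) 0
  have hGG : ∀ s : ℂ, 1 < s.re →
      ∫ u in Ioi (0:ℝ), ((B u - 1 : ℝ) : ℂ) * Complex.exp (-(s - 1) * u) = (G s - 1) / s := by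
    intro s hs
    have hs0 : s ≠ 0 := by rintro rfl; norm_num at hs
    have hs1 : s - 1 ≠ 0 := by intro h; rw [sub_eq_zero.mp h] at hs; norm_num at hs
    have hL := LSeries_eq_mul_integral_of_nonneg f zero_le_one hs (by
      apply Asymptotics.IsBigO.of_bound M
      filter_upwards with n
      rw [Real.norm_of_nonneg (Finset.sum_nonneg (fun _ _ => hf _)), Real.rpow_one,
        Real.norm_of_nonneg (by positivity)]
      exact hO n) hf
    rw [hG s hs] at hL
    have h1 : ∫ t in Ioi (1:ℝ), (∑ k ∈ Finset.Icc 1 ⌊t⌋₊, (f k : ℂ)) * (t:ℂ) ^ (-(s + 1)) =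
        ∫ u in Ioi (0:ℝ), (B u : ℂ) * Complex.exp (-(s - 1) * u) := by
      have := integral_comp_exp_Ioi (fun t : ℝ => (∑ k ∈ Finset.Icc 1 ⌊t⌋₊, (f k : ℂ)) * (t:ℂ) ^ (-(s + 1))) 0
      rw [Real.exp_zero] at this
      rw [← this]
      apply integral_congr_ae
      filter_upwards with u
      have e : (∑ k ∈ Finset.Icc 1 ⌊Real.exp u⌋₊, (f k : ℂ)) = ((B u * Real.exp u : ℝ) : ℂ) := by
        rw [hBe]; simp [hS]
      simp only [e]
      rw [Complex.real_smul]
      have hne : ((Real.exp u : ℝ) : ℂ) ≠ 0 := by exact_mod_cast (Real.exp_pos u).ne'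
      rw [Complex.cpow_def_of_ne_zero hne, ← Complex.ofReal_log (Real.exp_nonneg u), Real.log_exp]
      push_cast
      have : Complex.exp u * (Complex.exp u * Complex.exp (u * -(s+1))) = Complex.exp (-(s - 1) * u) := by
        rw [← Complex.exp_add, ← Complex.exp_add]; congr 1; ring
      linear_combination (B u : ℂ) * this
    have hi1 : IntegrableOn (fun u : ℝ => (B u : ℂ) * Complex.exp (-(s - 1) * u)) (Ioi 0) := by
      refine Integrable.bdd_mul (c := M) (hexp s hs) (by fun_prop) ?_
      filter_upwards with u
      rw [Complex.norm_real, Real.norm_of_nonneg (hB0 u)]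
      exact hB u
    have h2 : ∫ u in Ioi (0:ℝ), Complex.exp (-(s - 1) * u) = 1 / (s - 1) := by
      rw [integral_exp_mul_complex_Ioi (by simpa using hs) 0]
      rw [Complex.ofReal_zero, mul_zero, Complex.exp_zero, neg_div_neg_eq]
    push_cast
    simp_rw [sub_mul, one_mul]
    rw [integral_sub hi1 (hexp s hs), h2, ← h1]
    rw [eq_div_iff hs0]
    linear_combination -hL - (1:ℂ) * (by field_simp; ring : s * (1 / (s-1)) = 1 / (s-1) + 1)
  have hGc' : ContinuousOn (fun s => (G s - 1) / s) {s : ℂ | 1 ≤ s.re} := by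
    apply ContinuousOn.div (hGc.sub continuousOn_const) continuousOn_id
    rintro s hs rfl
    norm_num at hs
  have hlim : ∀ l : ℝ, 0 < l → Tendsto (fun v : ℝ => l * ∫ u in Ioi (0:ℝ), B u * fej (l * (v - u)))
      atTop (𝓝 fejc) := by
    intro l hl
    have h1 := (wi_tendsto (B := fun u => B u - 1) (hBm.sub_const 1) hbd hGc' hGG hl).const_mul l
    have h2 := h1.add (fej_half hl)
    rw [mul_zero, zero_add] at h2
    refine h2.congr ?_
    intro v
    have i1 := (fej_scale_integrable fej_integrable hl v).integrableOn (s := Ioi (0:ℝ))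
    have i2 : IntegrableOn (fun u => (B u - 1) * fej (l * (v - u))) (Ioi (0:ℝ)) := by
      refine Integrable.bdd_mul (c := M + 1) i1 (by fun_prop) ?_
      filter_upwards with u
      exact hbd u
    rw [← mul_add, ← integral_add i2 i1]
    congr 1
    apply integral_congr_ae
    filter_upwards with u
    ring
  have hT := (taub hBm hB0 hB hmono hlim).comp Real.tendsto_log_atTop
  refine hT.congr' ?_
  filter_upwards [eventually_gt_atTop 0] with x hx
  simp only [Function.comp, hBdef, Real.exp_log hx, Real.exp_neg]
  rw [div_eq_mul_inv]

end LPIT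

open Filter
namespace LPIT
open MeasureTheory Topology Set

theorem continuation (f : ℕ → ℝ) (hf : ∀ n, 0 ≤ f n) (κ δ : ℝ) (hδ : 0 < δ)
    (hE : (fun t : ℝ => (∑ k ∈ Finset.Icc 1 ⌊t⌋₊, f k) - κ * t) =O[atTop] (fun t : ℝ => t ^ (1 - δ))) :
    (∀ s : ℂ, 1 < s.re → LSeriesSummable (fun n => (f n : ℂ)) s) ∧
    ∃ H : ℂ → ℂ, DifferentiableOn ℂ H {s | 1 - δ < s.re} ∧ H 1 = κ ∧
      ∀ s : ℂ, 1 < s.re → H s = (s - 1) * LSeries (fun n => (f n : ℂ)) s := by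
  have hO' : (fun t : ℝ => ∑ k ∈ Finset.Icc 1 ⌊t⌋₊, f k) =O[atTop] (fun t : ℝ => t ^ (1:ℝ)) := by
    have h1 : (fun t : ℝ => κ * t) =O[atTop] (fun t : ℝ => t ^ (1:ℝ)) := by
      simp only [Real.rpow_one]
      exact Asymptotics.isBigO_const_mul_self _ _ _
    have h2 : (fun t : ℝ => t ^ (1 - δ)) =O[atTop] (fun t : ℝ => t ^ (1:ℝ)) := by
      apply Asymptotics.IsBigO.of_bound 1
      filter_upwards [eventually_ge_atTop 1] with t ht
      rw [Real.norm_of_nonneg (by positivity), Real.norm_of_nonneg (by positivity), one_mul]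
      exact Real.rpow_le_rpow_of_exponent_le ht (by linarith)
    simpa using (hE.trans h2).add h1
  have hO : (fun n : ℕ ↦ ∑ k ∈ Finset.Icc 1 n, f k) =O[atTop] fun n ↦ (n:ℝ)^(1:ℝ) := by
    have := hO'.comp_tendsto tendsto_natCast_atTop_atTop
    refine this.congr_left (fun n => ?_)
    simp
  refine ⟨fun s hs => LSeriesSummable_of_sum_norm_bigO_and_nonneg hO hf zero_le_one hs, ?_⟩
  set S : ℝ → ℂ := fun t => ∑ k ∈ Finset.Icc 1 ⌊t⌋₊, (f k : ℂ) with hS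
  set E : ℝ → ℂ := indicator (Ioi 1) (fun t => S t - κ * t) with hEdef
  have hEO : E =O[atTop] (fun t : ℝ => t ^ (-(δ - 1))) := by
    have : E =ᶠ[atTop] fun t : ℝ => (((∑ k ∈ Finset.Icc 1 ⌊t⌋₊, f k) - κ * t : ℝ) : ℂ) := by
      filter_upwards [eventually_gt_atTop 1] with t ht
      simp [hEdef, hS, indicator_of_mem (mem_Ioi.2 ht)]
    refine this.trans_isBigO ?_
    rw [neg_sub]
    refine Asymptotics.IsBigO.trans ?_ hE
    exact Asymptotics.isBigO_of_le _ (fun t => by rw [Complex.norm_real])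
  have hli0 : LocallyIntegrableOn (fun t => S t - κ * t) (Ici 0) := by
    refine LocallyIntegrableOn.sub ?_ ?_
    · have := locallyIntegrableOn_mul_sum_Icc (m := 1) (fun k => (f k : ℂ)) (le_refl (0:ℝ)) (g := fun _ => (1:ℂ))
        (continuousOn_const.locallyIntegrableOn measurableSet_Ici)
      simpa using this
    · exact ContinuousOn.locallyIntegrableOn (by fun_prop) measurableSet_Ici
  have hli : LocallyIntegrableOn E (Ioi 0) := by
    intro x hx
    obtain ⟨u, hu, hi⟩ := (hli0.mono_set Ioi_subset_Ici_self) x hx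
    exact ⟨u, hu, hi.indicator measurableSet_Ioi⟩
  have hbot : ∀ b : ℝ, E =O[𝓝[>] 0] (fun t : ℝ => t ^ (-b)) := by
    intro b
    have : E =ᶠ[𝓝[>] 0] fun _ => 0 := by
      filter_upwards [Ioo_mem_nhdsGT (zero_lt_one' ℝ)] with t ht
      simp [hEdef, ht.2.le]
    exact this.trans_isBigO (Asymptotics.isBigO_zero _ _)
  refine ⟨fun s => s * (κ + (s - 1) * mellin E (-s)), ?_, by simp, ?_⟩
  · intro s hs
    have h1 : DifferentiableAt ℂ (mellin E) (-s) :=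
      mellin_differentiableAt_of_isBigO_rpow (b := (-s).re - 1) hli hEO
        (by simp at hs ⊢; linarith) (hbot _) (by linarith)
    have h2 : DifferentiableAt ℂ (fun s => mellin E (-s)) s :=
      DifferentiableAt.comp (g := mellin E) s h1 (by fun_prop)
    exact (by fun_prop : DifferentiableAt ℂ (fun s => s * (κ + (s - 1) * mellin E (-s))) s).differentiableWithinAt
  · intro s hs
    have hs1 : s - 1 ≠ 0 := by
      intro h; rw [sub_eq_zero] at h; simp [h] at hs
    rw [LSeries_eq_mul_integral_of_nonneg f zero_le_one hs hO hf]
    have hm : mellin E (-s) = ∫ t in Ioi (1:ℝ), (S t - κ * t) * (t:ℂ) ^ (-(s+1)) := by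
      rw [mellin]
      have : ∀ t : ℝ, (t:ℂ) ^ (-s - 1) • E t = indicator (Ioi 1) (fun t : ℝ => (S t - κ * t) * (t:ℂ) ^ (-(s+1))) t := by
        intro t
        by_cases h : t ∈ Ioi (1:ℝ)
        · simp only [hEdef, indicator_of_mem h, smul_eq_mul]
          rw [mul_comm]; congr 2; ring
        · simp [hEdef, indicator_of_notMem h]
      simp_rw [this]
      rw [setIntegral_indicator measurableSet_Ioi]
      congr 2
      ext t; simp
    have hmc : IntegrableOn (fun t : ℝ => (S t - κ * t) * (t:ℂ) ^ (-(s+1))) (Ioi 1) := by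
      have h1 : MellinConvergent E (-s) :=
        mellinConvergent_of_isBigO_rpow (b := (-s).re - 1) hli hEO
          (by simp at hs ⊢; linarith) (hbot _) (by linarith)
      refine (h1.mono_set (Ioi_subset_Ioi zero_le_one)).congr_fun ?_ measurableSet_Ioi
      intro t h
      simp only [hEdef, indicator_of_mem h, smul_eq_mul]
      rw [mul_comm]; congr 2; ring
    have hre : (-s).re < -1 := by simp; exact hs
    have hi2 := integrableOn_Ioi_cpow_of_lt hre (zero_lt_one)
    have hv2 := integral_Ioi_cpow_of_lt hre (zero_lt_one)
    have hsum : ∫ t in Ioi (1:ℝ), S t * (t:ℂ) ^ (-(s+1)) = mellin E (-s) + κ * (1 / (s - 1)) := by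
      have : (1 : ℂ) / (s - 1) = ∫ t in Ioi (1:ℝ), (t:ℂ) ^ (-s) := by
        rw [hv2]; simp
        rw [← neg_sub, show (1 - s : ℂ) = -s + 1 by ring, inv_neg, neg_div, one_div]
      rw [this, hm, ← integral_const_mul, ← integral_add hmc (hi2.const_mul _)]
      refine setIntegral_congr_fun measurableSet_Ioi (fun t ht => ?_)
      have ht0 : (t:ℂ) ≠ 0 := by
        have : (0:ℝ) < t := lt_trans zero_lt_one ht
        exact_mod_cast this.ne'
      have : (t:ℂ) ^ (-s) = t * (t:ℂ) ^ (-(s+1)) := by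
        rw [show -s = 1 + (-(s+1)) by ring, Complex.cpow_add _ _ ht0, Complex.cpow_one]
      simp only [this]; ring
    rw [hsum]
    field_simp
    ring

end LPIT

open Filter
namespace LPIT
open MeasureTheory Topology Set

theorem order_lemma (H : ℂ → ℂ) (s : ℂ) (hH : AnalyticAt ℂ H s) (hne : ¬ ∀ᶠ z in 𝓝 s, H z = 0) :
    ∃ m : ℕ, Tendsto (fun z => (z - s) * (deriv H z / H z)) (𝓝[≠] s) (𝓝 m) ∧
      (m = 0 ↔ H s ≠ 0) ∧ ∀ᶠ z in 𝓝[≠] s, H z ≠ 0 := by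
  obtain ⟨m, g, hg, hg0, hev⟩ := hH.exists_eventuallyEq_pow_smul_nonzero_iff.2 hne
  have hev2 : ∀ᶠ z in 𝓝 s, deriv H z = m * (z - s) ^ (m - 1) * g z + (z - s) ^ m * deriv g z := by
    filter_upwards [hev.eventually_nhds, hg.eventually_analyticAt] with z hz hgz
    have h1 : H =ᶠ[𝓝 z] fun z => (z - s) ^ m * g z := hz.mono (fun x hx => by simpa using hx)
    rw [h1.deriv_eq]
    have h2 : HasDerivAt (fun z : ℂ => (z - s) ^ m) (m * (z - s) ^ (m - 1) * 1) z :=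
      ((hasDerivAt_id z).sub_const s).pow m
    refine (h2.mul hgz.differentiableAt.hasDerivAt).deriv.trans ?_
    ring
  have hgne : ∀ᶠ z in 𝓝 s, g z ≠ 0 := hg.continuousAt.eventually_ne hg0
  refine ⟨m, ?_, ?_, ?_⟩
  · have hT : Tendsto (fun z => m + (z - s) * (deriv g z / g z)) (𝓝[≠] s) (𝓝 (m + (s - s) * (deriv g s / g s))) := by
      refine tendsto_nhdsWithin_of_tendsto_nhds (ContinuousAt.tendsto ?_)
      have := hg.deriv.continuousAt
      have := hg.continuousAt
      fun_prop (disch := assumption)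
    simp only [sub_self, zero_mul, add_zero] at hT
    refine hT.congr' ?_
    filter_upwards [hev.filter_mono nhdsWithin_le_nhds, hev2.filter_mono nhdsWithin_le_nhds,
      hgne.filter_mono nhdsWithin_le_nhds, self_mem_nhdsWithin] with z h1 h2 h3 h4
    have h5 : z - s ≠ 0 := sub_ne_zero.2 h4
    rw [h1, h2, smul_eq_mul]
    rcases m with _ | m
    · simp
    · simp only [Nat.add_sub_cancel]
      field_simp
      ring
  · rw [hev.self_of_nhds]
    rcases m with _ | m
    · simpa using hg0
    · simp
  · filter_upwards [hev.filter_mono nhdsWithin_le_nhds, 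
      hgne.filter_mono nhdsWithin_le_nhds, self_mem_nhdsWithin] with z h1 h3 h4
    have h5 : z - s ≠ 0 := sub_ne_zero.2 h4
    rw [h1]
    exact smul_ne_zero (pow_ne_zero _ h5) h3

theorem nonvanish (H D : ℂ → ℂ) (δ : ℝ) (hδ : 0 < δ)
    (hH : DifferentiableOn ℂ H {s | 1 - δ < s.re}) (H1 : H 1 ≠ 0)
    (hD : ∀ s : ℂ, 1 < s.re → deriv H s = H s * (1 / (s - 1) - D s))
    (hb : ∀ s : ℂ, 1 < s.re → ∃ C : ℝ, ∀ z : ℂ, s.re ≤ z.re → ‖D z‖ ≤ C)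
    (h341 : ∀ h : ℝ, 0 < h → ∀ t : ℝ,
      0 ≤ 3 * (D (1 + h)).re + 4 * (D (1 + t * Complex.I + h)).re + (D (1 + 2 * t * Complex.I + h)).re) :
    ∀ s : ℂ, 1 ≤ s.re → H s ≠ 0 := by
  have hopen : IsOpen {s : ℂ | 1 - δ < s.re} := isOpen_lt continuous_const Complex.continuous_re
  have han : AnalyticOnNhd ℂ H {s | 1 - δ < s.re} := hH.analyticOnNhd hopen
  have hpre : IsPreconnected {s : ℂ | 1 - δ < s.re} := (convex_halfSpace_re_gt _).isPreconnected
  have hnz : ∀ s : ℂ, 1 ≤ s.re → ¬ ∀ᶠ z in 𝓝 s, H z = 0 := by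
    intro s hs hz
    have := han.eqOn_zero_of_preconnected_of_eventuallyEq_zero hpre
      (show s ∈ {s : ℂ | 1 - δ < s.re} by simp; linarith) hz
    exact H1 (this (show (1:ℂ) ∈ {s : ℂ | 1 - δ < s.re} by simp; linarith))
  have key : ∀ s : ℂ, 1 ≤ s.re → ∃ m : ℕ, (m = 0 ↔ H s ≠ 0) ∧
      Tendsto (fun h : ℝ => h / (s + h - 1) - h * D (s + h)) (𝓝[>] 0) (𝓝 m) := by
    intro s hs
    obtain ⟨m, h1, h2, h3⟩ := order_lemma H s (han s (by simp; linarith)) (hnz s hs)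
    refine ⟨m, h2, ?_⟩
    have hT : Tendsto (fun h : ℝ => s + h) (𝓝[>] 0) (𝓝[≠] s) := by
      refine tendsto_nhdsWithin_iff.2 ⟨?_, ?_⟩
      · have : Tendsto (fun h : ℝ => s + h) (𝓝 0) (𝓝 (s + (0:ℝ))) := by
          apply Continuous.tendsto; fun_prop
        simp only [Complex.ofReal_zero, add_zero] at this
        exact this.mono_left nhdsWithin_le_nhds
      · filter_upwards [self_mem_nhdsWithin] with h hh
        have : h ≠ 0 := (mem_Ioi.1 hh).ne'
        simp [this]
    refine (h1.comp hT).congr' ?_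
    filter_upwards [hT.eventually h3, self_mem_nhdsWithin] with h hh hpos
    have hpos' : 0 < h := hpos
    simp only [Function.comp]
    rw [hD (s + h) (by simp; linarith), mul_div_cancel_left₀ _ hh]
    ring
  have lim0 : ∀ s : ℂ, s ≠ 1 → Tendsto (fun h : ℝ => (h:ℂ) / (s + h - 1)) (𝓝[>] 0) (𝓝 0) := by
    intro s hs
    have : Tendsto (fun h : ℝ => (h:ℂ) / (s + h - 1)) (𝓝 0) (𝓝 ((0:ℝ) / (s + (0:ℝ) - 1))) := by
      have : s + (0:ℝ) - 1 ≠ 0 := by simpa [sub_eq_zero] using hs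
      apply ContinuousAt.tendsto
      fun_prop (disch := assumption)
    simp only [Complex.ofReal_zero, zero_div] at this
    exact this.mono_left nhdsWithin_le_nhds
  have key2 : ∀ s : ℂ, 1 ≤ s.re → s ≠ 1 → ∃ m : ℕ, (m = 0 ↔ H s ≠ 0) ∧
      Tendsto (fun h : ℝ => h * (D (s + h)).re) (𝓝[>] 0) (𝓝 (-m)) := by
    intro s hs hs1
    obtain ⟨m, h1, h2⟩ := key s hs
    refine ⟨m, h1, ?_⟩
    have := (Complex.continuous_re.tendsto _).comp ((lim0 s hs1).sub h2)
    simpa [Function.comp_def] using this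
  have at1 : Tendsto (fun h : ℝ => h * (D (1 + h)).re) (𝓝[>] 0) (𝓝 1) := by
    obtain ⟨m, h1, h2⟩ := key 1 (by simp)
    rw [h1.2 H1] at h2
    have h3 : Tendsto (fun h : ℝ => (h:ℂ) / (1 + h - 1)) (𝓝[>] 0) (𝓝 1) := by
      refine tendsto_const_nhds.congr' ?_
      filter_upwards [self_mem_nhdsWithin] with h hh
      have : (h:ℂ) ≠ 0 := by exact_mod_cast (mem_Ioi.1 hh).ne'
      field_simp; ring_nf; 
      simp [this]
    have := (Complex.continuous_re.tendsto _).comp (h3.sub h2)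
    simpa [Function.comp_def] using this
  intro s hs
  rcases hs.eq_or_lt with h | h
  · by_cases hs1 : s = 1
    · rwa [hs1]
    · have him : s.im ≠ 0 := by
        intro h'; apply hs1; apply Complex.ext <;> simp [h', ← h]
      have hse : s = 1 + s.im * Complex.I := by apply Complex.ext <;> simp [← h]
      set t := s.im
      obtain ⟨m, h1, h2⟩ := key2 s hs hs1
      obtain ⟨m', -, h3⟩ := key2 (1 + 2 * t * Complex.I) (by simp) (by
        intro h'
        have := congrArg Complex.im h'
        simp at this
        exact him this)
      have hlim := ((at1.const_mul 3).add (h2.const_mul 4)).add h3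
      have hge : (0:ℝ) ≤ 3 * 1 + 4 * (-m) + (-m') := by
        refine ge_of_tendsto hlim ?_
        filter_upwards [self_mem_nhdsWithin] with h hh
        have hh' : 0 < h := hh
        have := mul_nonneg hh'.le (h341 h hh' t)
        rw [← hse] at this
        linarith
      rw [← h1]
      have : (0:ℝ) ≤ m' := by positivity
      have h5 : (m:ℝ) < 1 := by linarith
      have h6 : m < 1 := by exact_mod_cast h5
      omega
  · obtain ⟨m, h1, h2⟩ := key2 s hs (by rintro rfl; simp at h)
    rw [← h1]
    obtain ⟨C, hC⟩ := hb s h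
    have h3 : Tendsto (fun h : ℝ => h * (D (s + h)).re) (𝓝[>] 0) (𝓝 0) := by
      have : Tendsto (fun h : ℝ => h * C) (𝓝[>] 0) (𝓝 0) := by
        have : Tendsto (fun h : ℝ => h * C) (𝓝 0) (𝓝 (0 * C)) := by
          apply Continuous.tendsto; fun_prop
        rw [zero_mul] at this
        exact this.mono_left nhdsWithin_le_nhds
      refine squeeze_zero_norm' ?_ this
      filter_upwards [self_mem_nhdsWithin] with h hh
      have hh' : 0 < h := hh
      rw [norm_mul, Real.norm_of_nonneg hh'.le]
      gcongr
      exact (Complex.abs_re_le_norm _).trans (hC _ (by simp; exact hh'.le))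
    have := tendsto_nhds_unique h2 h3
    simpa using this

end LPIT

open Filter
namespace LPIT
open MeasureTheory Topology Set

theorem norm_term {n : ℕ} (hn : 0 < n) (w : ℝ) (hw : 0 ≤ w) (s : ℂ) :
    ‖(w : ℂ) * (n : ℂ) ^ (-s)‖ = w * (n : ℝ) ^ (-s.re) := by
  rw [norm_mul, Complex.norm_natCast_cpow_of_pos hn, Complex.norm_real, Real.norm_of_nonneg hw]
  simp

theorem dser_summable {ι : Type*} (w : ι → ℝ) (n : ι → ℕ) (hw : ∀ i, 0 ≤ w i) (hn : ∀ i, 0 < n i)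
    (hs : ∀ σ : ℝ, 1 < σ → Summable (fun i => w i * (n i : ℝ) ^ (-σ))) (s : ℂ) (h : 1 < s.re) :
    Summable (fun i => ‖(w i : ℂ) * (n i : ℂ) ^ (-s)‖) := by
  simp_rw [norm_term (hn _) _ (hw _)]
  exact hs _ h

theorem dser_bound {ι : Type*} (w : ι → ℝ) (n : ι → ℕ) (hw : ∀ i, 0 ≤ w i) (hn : ∀ i, 0 < n i)
    (hs : ∀ σ : ℝ, 1 < σ → Summable (fun i => w i * (n i : ℝ) ^ (-σ))) (s : ℂ) (h : 1 < s.re) :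
    ∃ C : ℝ, ∀ z : ℂ, s.re ≤ z.re → ‖∑' i, (w i : ℂ) * (n i : ℂ) ^ (-z)‖ ≤ C := by
  refine ⟨∑' i, w i * (n i : ℝ) ^ (-s.re), fun z hz => ?_⟩
  refine tsum_of_norm_bounded (hs _ h).hasSum (fun i => ?_)
  rw [norm_term (hn _) _ (hw _)]
  have := hw i
  gcongr
  exact_mod_cast hn i

theorem dser_341 {ι : Type*} (w : ι → ℝ) (n : ι → ℕ) (hw : ∀ i, 0 ≤ w i) (hn : ∀ i, 0 < n i)
    (hs : ∀ σ : ℝ, 1 < σ → Summable (fun i => w i * (n i : ℝ) ^ (-σ))) (D : ℂ → ℂ)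
    (hD : ∀ s, D s = ∑' i, (w i : ℂ) * (n i : ℂ) ^ (-s)) (h : ℝ) (hh : 0 < h) (t : ℝ) :
    0 ≤ 3 * (D (1 + h)).re + 4 * (D (1 + t * Complex.I + h)).re + (D (1 + 2 * t * Complex.I + h)).re := by
  have hsum : ∀ s : ℂ, 1 < s.re → HasSum (fun i => ((w i : ℂ) * (n i : ℂ) ^ (-s)).re) (D s).re := by
    intro s h
    rw [hD]
    exact Complex.hasSum_re (dser_summable w n hw hn hs s h).of_norm.hasSum
  have h1 := (hsum (1 + h) (by simpa using hh)).mul_left 3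
  have h2 := (hsum (1 + t * Complex.I + h) (by simpa using hh)).mul_left 4
  have h3 := hsum (1 + 2 * t * Complex.I + h) (by simpa using hh)
  refine ((h1.add h2).add h3).nonneg (fun i => ?_)
  have hn0 : (n i : ℂ) ≠ 0 := by exact_mod_cast (hn i).ne'
  set u : ℂ := (n i : ℂ) ^ (-(t * Complex.I)) with hu
  have hun : ‖u‖ = 1 := by
    rw [hu, Complex.norm_natCast_cpow_of_pos (hn i)]; simp
  have e0 : (n i : ℂ) ^ (-(1 + h : ℂ)) = (((n i : ℝ) ^ (-(1 + h)) : ℝ) : ℂ) := by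
    rw [Complex.ofReal_cpow (by positivity)]; simp
  have e1 : (n i : ℂ) ^ (-(1 + t * Complex.I + h)) = (n i : ℂ) ^ (-(1 + h : ℂ)) * u := by
    rw [hu, ← Complex.cpow_add _ _ hn0]; congr 1; ring
  have e2 : (n i : ℂ) ^ (-(1 + 2 * t * Complex.I + h)) = (n i : ℂ) ^ (-(1 + h : ℂ)) * (u * u) := by
    rw [hu, ← Complex.cpow_add _ _ hn0, ← Complex.cpow_add _ _ hn0]; congr 1; ring
  rw [e1, e2, e0]
  have hsq : u.re * u.re + u.im * u.im = 1 := by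
    have := Complex.sq_norm u
    rw [hun, Complex.normSq_apply] at this; linarith
  have hA : 0 ≤ (n i : ℝ) ^ (-(1 + h)) := by positivity
  set A := (n i : ℝ) ^ (-(1 + h))
  simp only [← mul_assoc, ← Complex.ofReal_mul, Complex.re_ofReal_mul, Complex.ofReal_re]
  rw [mul_assoc ((w i * A : ℝ) : ℂ), Complex.re_ofReal_mul, Complex.mul_re]
  have : 0 ≤ w i * A * (2 * (1 + u.re) ^ 2) := by have := hw i; positivity
  rw [show u.im * u.im = 1 - u.re * u.re by linarith]
  refine this.trans_eq ?_
  ring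

end LPIT

open Filter
namespace LPIT
open MeasureTheory Topology Set
open scoped nonZeroDivisors
open NumberField

theorem group_fiber {X : Type*} (N : X → ℕ) (hfin : ∀ n, Finite {x // N x = n}) (φ : ℕ → ℂ)
    (hφ : Summable (fun n => (Nat.card {x // N x = n} : ℝ) * ‖φ n‖)) :
    Summable (fun x => ‖φ (N x)‖) ∧
      ∑' x, φ (N x) = ∑' n, (Nat.card {x // N x = n} : ℂ) * φ n := by
  have h1 : Summable (fun x => ‖φ (N x)‖) := by
    rw [← (Equiv.sigmaFiberEquiv N).summable_iff]
    refine (summable_sigma_of_nonneg (fun _ => norm_nonneg _)).2 ⟨fun n => ?_, ?_⟩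
    · have := hfin n
      have := Fintype.ofFinite {x // N x = n}
      exact (hasSum_fintype _).summable
    · refine hφ.congr (fun n => ?_)
      have := hfin n
      have := Fintype.ofFinite {x // N x = n}
      rw [tsum_fintype, Nat.card_eq_fintype_card]
      rw [Finset.sum_congr rfl (g := fun _ => ‖φ n‖) (fun x _ => by simp [Equiv.sigmaFiberEquiv, x.2])]
      simp
  refine ⟨h1, ?_⟩
  rw [← (Equiv.sigmaFiberEquiv N).tsum_eq]
  have h2 := (Equiv.sigmaFiberEquiv N).summable_iff.2 h1.of_norm
  rw [Summable.tsum_sigma (by exact h2)]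
  refine tsum_congr (fun n => ?_)
  have := hfin n
  have := Fintype.ofFinite {x // N x = n}
  rw [tsum_fintype, Nat.card_eq_fintype_card]
  rw [Finset.sum_congr rfl (g := fun _ => φ n) (fun x _ => by simp [Equiv.sigmaFiberEquiv, x.2])]
  simp

variable (K : Type*) [Field K] [NumberField K]

/-- nonzero primes -/
abbrev PP := {p : Ideal (𝓞 K) // p.IsPrime ∧ p ≠ ⊥}

variable {K}

theorem PP.prime (p : PP K) : Prime p.1 := Ideal.prime_of_isPrime p.2.2 p.2.1

theorem absNorm_pos {I : Ideal (𝓞 K)} (h : I ≠ ⊥) : 0 < Ideal.absNorm I := by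
  rw [Nat.pos_iff_ne_zero, Ne, Ideal.absNorm_eq_zero_iff]; exact h

theorem PP.two_le (p : PP K) : 2 ≤ Ideal.absNorm p.1 := by
  have h1 := absNorm_pos p.2.2
  have h2 : Ideal.absNorm p.1 ≠ 1 := by
    rw [Ne, Ideal.absNorm_eq_one_iff]; exact p.2.1.ne_top
  omega

open Classical in
theorem sum_log_norm (I : Ideal (𝓞 K)) (hI : I ≠ 0) :
    HasSum (fun q : PP K × ℕ => if q.1.1 ^ (q.2 + 1) ∣ I then Real.log (Ideal.absNorm q.1.1) else 0)
      (Real.log (Ideal.absNorm I)) := by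
  induction I using UniqueFactorizationMonoid.induction_on_prime with
  | h₁ => exact absurd rfl hI
  | h₂ x hx =>
    rw [Ideal.isUnit_iff] at hx
    have : ∀ q : PP K × ℕ, ¬ (q.1.1 ^ (q.2 + 1) ∣ x) := by
      intro q h
      rw [hx] at h
      exact q.1.prime.not_isUnit (isUnit_of_dvd_unit ((dvd_pow_self _ (Nat.succ_ne_zero _)).trans h) 
        (by rw [Ideal.isUnit_iff]))
    simp only [this, if_false]
    rw [hx, Ideal.absNorm_top, Nat.cast_one, Real.log_one]
    exact hasSum_zero
  | h₃ a p ha hp ih =>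
    have ih := ih ha
    have hpb : p ≠ ⊥ := hp.ne_zero
    let p' : PP K := ⟨p, Ideal.isPrime_of_prime hp, hpb⟩
    have hfin : FiniteMultiplicity p a := FiniteMultiplicity.of_prime_left hp ha
    have h2 := hasSum_ite_eq ((p', multiplicity p a) : PP K × ℕ) (Real.log (Ideal.absNorm p))
    have h3 := h2.add ih
    have hN : Real.log (Ideal.absNorm (p * a)) = Real.log (Ideal.absNorm p) + Real.log (Ideal.absNorm a) := by
      rw [map_mul, Nat.cast_mul, Real.log_mul]
      · exact_mod_cast (absNorm_pos hpb).ne'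
      · exact_mod_cast (absNorm_pos ha).ne'
    rw [hN]
    convert h3 using 1
    ext ⟨q, k⟩
    simp only [Prod.mk.injEq]
    by_cases hq : q = p'
    · subst hq
      have e1 : p ^ (k + 1) ∣ p * a ↔ k ≤ multiplicity p a := by
        rw [pow_succ', mul_dvd_mul_iff_left hp.ne_zero, hfin.pow_dvd_iff_le_multiplicity]
      have e2 : p ^ (k + 1) ∣ a ↔ k + 1 ≤ multiplicity p a := by
        rw [hfin.pow_dvd_iff_le_multiplicity]
      simp only [true_and]
      change (if p ^ (k + 1) ∣ p * a then Real.log (Ideal.absNorm p) else 0) = _ +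
        (if p ^ (k + 1) ∣ a then Real.log (Ideal.absNorm p) else 0)
      rw [if_congr e1 rfl rfl, if_congr e2 rfl rfl]
      split_ifs <;> first | omega | simp
    · have hnd : ¬ q.1 ∣ p := by
        intro h
        have := (q.prime.dvd_prime_iff_associated hp).1 h
        rw [associated_iff_eq] at this
        exact hq (Subtype.ext this)
      have e1 : q.1 ^ (k + 1) ∣ p * a ↔ q.1 ^ (k + 1) ∣ a :=
        ⟨fun h => q.prime.pow_dvd_of_dvd_mul_left _ hnd h, fun h => h.mul_left _⟩
      rw [if_congr e1 rfl rfl]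
      simp [hq]

/-- the counting coefficients -/
noncomputable def cf (K : Type*) [Field K] [NumberField K] (n : ℕ) : ℝ :=
  Nat.card {I : (Ideal (𝓞 K))⁰ // Ideal.absNorm (I : Ideal (𝓞 K)) = n}

theorem cf_fin (n : ℕ) : Finite {I : (Ideal (𝓞 K))⁰ // Ideal.absNorm (I : Ideal (𝓞 K)) = n} := by
  have : Finite {I : Ideal (𝓞 K) // Ideal.absNorm I = n} := by
    rcases n.eq_zero_or_pos with h | h
    · subst h
      simp only [Ideal.absNorm_eq_zero_iff]
      infer_instance
    · exact (Ideal.finite_setOfPred_absNorm_eq n).to_subtype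
  exact Finite.of_injective (fun I => (⟨I.1.1, I.2⟩ : {I : Ideal (𝓞 K) // Ideal.absNorm I = n}))
    (fun I J h => by ext1; ext1; simpa using h)

theorem term_eq (s : ℂ) (n : ℕ) : 
    LSeries.term (fun n => (cf K n : ℂ)) s n =
      (Nat.card {I : (Ideal (𝓞 K))⁰ // Ideal.absNorm (I : Ideal (𝓞 K)) = n} : ℂ) * (n : ℂ) ^ (-s) := by
  rcases n.eq_zero_or_pos with h | h
  · subst h
    have : IsEmpty {I : (Ideal (𝓞 K))⁰ // Ideal.absNorm (I : Ideal (𝓞 K)) = 0} := by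
      refine ⟨fun I => ?_⟩
      have := absNorm_pos (nonZeroDivisors.coe_ne_zero I.1)
      omega
    simp
  · rw [LSeries.term_of_ne_zero h.ne', Complex.cpow_neg, cf, div_eq_mul_inv]
    simp

theorem zeta_sum (hsum : ∀ s : ℂ, 1 < s.re → LSeriesSummable (fun n => (cf K n : ℂ)) s) (s : ℂ)
    (hs : 1 < s.re) :
    (Summable (fun I : (Ideal (𝓞 K))⁰ => ‖(Ideal.absNorm (I : Ideal (𝓞 K)) : ℂ) ^ (-s)‖)) ∧
    LSeries (fun n => (cf K n : ℂ)) s = ∑' I : (Ideal (𝓞 K))⁰, (Ideal.absNorm (I : Ideal (𝓞 K)) : ℂ) ^ (-s) := by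
  have h := group_fiber (fun I : (Ideal (𝓞 K))⁰ => Ideal.absNorm (I : Ideal (𝓞 K))) cf_fin
    (fun n => (n : ℂ) ^ (-s)) (by
      have := (hsum s hs).norm
      simp_rw [term_eq, norm_mul] at this
      simpa using this)
  refine ⟨h.1, ?_⟩
  rw [h.2, LSeries]
  simp_rw [term_eq]

theorem zeta_deriv_sum (hsum : ∀ s : ℂ, 1 < s.re → LSeriesSummable (fun n => (cf K n : ℂ)) s) (s : ℂ)
    (hs : 1 < s.re) :
    (Summable (fun I : (Ideal (𝓞 K))⁰ => ‖(Real.log (Ideal.absNorm (I : Ideal (𝓞 K))) : ℂ) *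
      (Ideal.absNorm (I : Ideal (𝓞 K)) : ℂ) ^ (-s)‖)) ∧
    HasDerivAt (LSeries (fun n => (cf K n : ℂ))) (- ∑' I : (Ideal (𝓞 K))⁰,
      (Real.log (Ideal.absNorm (I : Ideal (𝓞 K))) : ℂ) * (Ideal.absNorm (I : Ideal (𝓞 K)) : ℂ) ^ (-s)) s := by
  have habs : LSeries.abscissaOfAbsConv (fun n => (cf K n : ℂ)) < s.re := by
    obtain ⟨r, hr1, hr2⟩ := exists_between hs
    have := (hsum (r:ℂ) (by simpa using hr1)).abscissaOfAbsConv_le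
    refine this.trans_lt ?_
    simpa using hr2
  have h1 := LSeriesSummable_logMul_of_lt_re habs
  have h2 := LSeries_hasDerivAt habs
  have hterm : ∀ n, LSeries.term (LSeries.logMul (fun n => (cf K n : ℂ))) s n =
      (Nat.card {I : (Ideal (𝓞 K))⁰ // Ideal.absNorm (I : Ideal (𝓞 K)) = n} : ℂ) *
        ((Real.log n : ℂ) * (n : ℂ) ^ (-s)) := by
    intro n
    have : LSeries.term (LSeries.logMul (fun n => (cf K n : ℂ))) s n = 
        Real.log n * LSeries.term (fun n => (cf K n : ℂ)) s n := by
      rcases n.eq_zero_or_pos with h | h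
      · subst h; simp
      · simp [LSeries.term_of_ne_zero h.ne', LSeries.logMul, mul_div_assoc, Complex.natCast_log]
    rw [this, term_eq]; ring
  have h := group_fiber (fun I : (Ideal (𝓞 K))⁰ => Ideal.absNorm (I : Ideal (𝓞 K))) cf_fin
    (fun n => (Real.log n : ℂ) * (n : ℂ) ^ (-s)) (by
      have := h1.norm
      simp_rw [hterm] at this
      refine this.congr (fun n => ?_)
      rw [norm_mul]; simp)
  refine ⟨h.1, ?_⟩
  rw [h.2]
  simp_rw [← hterm]
  exact h2

end LPIT

open Filter
namespace LPIT
open MeasureTheory Topology Set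
open scoped nonZeroDivisors
open NumberField
variable {K : Type*} [Field K] [NumberField K]

/-- prime powers as nonzero ideals -/
noncomputable def pq (q : PP K × ℕ) : (Ideal (𝓞 K))⁰ :=
  ⟨q.1.1 ^ (q.2 + 1), mem_nonZeroDivisors_of_ne_zero (pow_ne_zero _ q.1.2.2)⟩

/-- weight -/
noncomputable def wq (q : PP K × ℕ) : ℝ := Real.log (Ideal.absNorm q.1.1)

/-- norm of the prime power -/
noncomputable def nq (q : PP K × ℕ) : ℕ := Ideal.absNorm q.1.1 ^ (q.2 + 1)

theorem norm_pq (q : PP K × ℕ) : Ideal.absNorm (pq q : Ideal (𝓞 K)) = nq q := by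
  simp [pq, nq]

theorem nq_pos (q : PP K × ℕ) : 0 < nq q := pow_pos (by have := q.1.two_le; omega) _

theorem wq_nonneg (q : PP K × ℕ) : 0 ≤ wq q := Real.log_natCast_nonneg _

theorem pq_inj : Function.Injective (pq (K := K)) := by
  rintro ⟨p, k⟩ ⟨p', l⟩ h
  have h1 : p.1 ^ (k + 1) = p'.1 ^ (l + 1) := congrArg Subtype.val h
  have h2 : p.1 ∣ p'.1 ^ (l + 1) := h1 ▸ dvd_pow_self _ (Nat.succ_ne_zero _)
  have h3 := (p.prime.dvd_prime_iff_associated p'.prime).1 (p.prime.dvd_of_dvd_pow h2)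
  rw [associated_iff_eq] at h3
  have h4 : p = p' := Subtype.ext h3
  subst h4
  have h5 := congrArg Ideal.absNorm h1
  rw [map_pow, map_pow] at h5
  have := Nat.pow_right_injective p.two_le h5
  simp only [Prod.mk.injEq, true_and]
  omega

theorem Dsum (hsum : ∀ s : ℂ, 1 < s.re → LSeriesSummable (fun n => (cf K n : ℂ)) s) (σ : ℝ)
    (hσ : 1 < σ) : Summable (fun q : PP K × ℕ => wq q * (nq q : ℝ) ^ (-σ)) := by
  have h := (zeta_deriv_sum hsum (σ : ℂ) (by simpa using hσ)).1.comp_injective pq_inj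
  refine h.of_nonneg_of_le (fun q => mul_nonneg (wq_nonneg q) (by positivity)) (fun q => ?_)
  simp only [Function.comp]
  rw [norm_pq, norm_term (nq_pos q) _ (Real.log_natCast_nonneg _)]
  simp only [Complex.ofReal_re]
  gcongr
  rw [wq, nq]
  apply Real.log_le_log
  · have := q.1.two_le
    have : 0 < Ideal.absNorm q.1.1 := by omega
    exact_mod_cast this
  · exact_mod_cast Nat.le_self_pow (Nat.succ_ne_zero _) _

open Classical in
/-- indicator weight -/
noncomputable def dl (I : Ideal (𝓞 K)) (q : PP K × ℕ) : ℝ :=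
  if q.1.1 ^ (q.2 + 1) ∣ I then Real.log (Ideal.absNorm q.1.1) else 0

theorem dl_nonneg (I : Ideal (𝓞 K)) (q : PP K × ℕ) : 0 ≤ dl I q := by
  unfold dl
  split_ifs
  · exact Real.log_natCast_nonneg _
  · exact le_rfl

theorem dl_sum (I : Ideal (𝓞 K)) (hI : I ≠ 0) : HasSum (dl I) (Real.log (Ideal.absNorm I)) := sum_log_norm I hI

theorem zeta_logderiv (hsum : ∀ s : ℂ, 1 < s.re → LSeriesSummable (fun n => (cf K n : ℂ)) s) (s : ℂ)
    (hs : 1 < s.re) :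
    HasDerivAt (LSeries (fun n => (cf K n : ℂ))) (- ((∑' q : PP K × ℕ, (wq q : ℂ) * (nq q : ℂ) ^ (-s)) *
      LSeries (fun n => (cf K n : ℂ)) s)) s := by
  obtain ⟨hd1, hd2⟩ := zeta_deriv_sum hsum s hs
  obtain ⟨hz1, hz2⟩ := zeta_sum hsum s hs
  refine hd2.congr_deriv ?_
  congr 1
  let F : (Ideal (𝓞 K))⁰ × (PP K × ℕ) → ℂ := fun x =>
    (dl (x.1 : Ideal (𝓞 K)) x.2 : ℂ)
      * (Ideal.absNorm (x.1 : Ideal (𝓞 K)) : ℂ) ^ (-s)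
  have hIs : ∀ I : (Ideal (𝓞 K))⁰, HasSum (fun q => F (I, q))
      ((Real.log (Ideal.absNorm (I : Ideal (𝓞 K))) : ℂ) * (Ideal.absNorm (I : Ideal (𝓞 K)) : ℂ) ^ (-s)) := by
    intro I
    have := dl_sum (I : Ideal (𝓞 K)) (nonZeroDivisors.coe_ne_zero I)
    have h2 : HasSum (fun q => (dl (I : Ideal (𝓞 K)) q : ℂ))
        (Real.log (Ideal.absNorm (I : Ideal (𝓞 K))) : ℂ) := Complex.hasSum_ofReal.2 this
    exact h2.mul_right ((Ideal.absNorm (I : Ideal (𝓞 K)) : ℂ) ^ (-s))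
  have hIn : ∀ I : (Ideal (𝓞 K))⁰, HasSum (fun q => ‖F (I, q)‖)
      (‖(Real.log (Ideal.absNorm (I : Ideal (𝓞 K))) : ℂ) * (Ideal.absNorm (I : Ideal (𝓞 K)) : ℂ) ^ (-s)‖) := by
    intro I
    have := (dl_sum (I : Ideal (𝓞 K)) (nonZeroDivisors.coe_ne_zero I)).mul_right
      ‖(Ideal.absNorm (I : Ideal (𝓞 K)) : ℂ) ^ (-s)‖
    rw [norm_mul, Complex.norm_real, Real.norm_of_nonneg (Real.log_natCast_nonneg _)]
    have e : (fun q => ‖F (I, q)‖) = fun q => dl (I : Ideal (𝓞 K)) q *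
        ‖(Ideal.absNorm (I : Ideal (𝓞 K)) : ℂ) ^ (-s)‖ := by
      refine funext (fun q => ?_)
      simp only [F]
      rw [norm_mul, Complex.norm_real, Real.norm_of_nonneg (dl_nonneg _ _)]
    rw [e]
    exact this
  have hFs : Summable F := by
    apply Summable.of_norm
    refine (summable_prod_of_nonneg (fun _ => norm_nonneg _)).2 ⟨fun I => (hIn I).summable, ?_⟩
    simp_rw [fun I => (hIn I).tsum_eq]
    exact hd1
  have e1 : ∑' I : (Ideal (𝓞 K))⁰, (Real.log (Ideal.absNorm (I : Ideal (𝓞 K))) : ℂ) *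
      (Ideal.absNorm (I : Ideal (𝓞 K)) : ℂ) ^ (-s) = ∑' x, F x := by
    rw [hFs.tsum_prod]
    exact tsum_congr (fun I => ((hIs I).tsum_eq).symm)
  have hDn := dser_summable wq nq wq_nonneg (nq_pos (K := K)) (Dsum hsum) s hs
  let φ : (Ideal (𝓞 K))⁰ × (PP K × ℕ) → (Ideal (𝓞 K))⁰ × (PP K × ℕ) := fun x => (pq x.2 * x.1, x.2)
  have hφ : Function.Injective φ := by
    rintro ⟨J, q⟩ ⟨J', q'⟩ h
    simp only [φ, Prod.mk.injEq] at h
    obtain ⟨h1, rfl⟩ := h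
    have := mul_left_cancel h1
    rw [this]
  have hsupp : Function.support F ⊆ range φ := by
    rintro ⟨I, q⟩ hx
    have hd : q.1.1 ^ (q.2 + 1) ∣ (I : Ideal (𝓞 K)) := by
      by_contra hd
      simp [F, dl, hd] at hx
    obtain ⟨J, hJ⟩ := hd
    have hJ0 : J ≠ 0 := by
      rintro rfl
      exact nonZeroDivisors.coe_ne_zero I (by simpa using hJ)
    refine ⟨(⟨J, mem_nonZeroDivisors_of_ne_zero hJ0⟩, q), ?_⟩
    simp only [φ, Prod.mk.injEq, and_true]
    ext1
    simp [pq, hJ]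
  rw [e1, ← hφ.tsum_eq hsupp, hz2, mul_comm, tsum_mul_tsum_of_summable_norm hz1 hDn]
  refine tsum_congr ?_
  rintro ⟨J, q⟩
  have : q.1.1 ^ (q.2 + 1) ∣ ((pq q * J : (Ideal (𝓞 K))⁰) : Ideal (𝓞 K)) := by
    simp [pq]
  simp only [F, φ, dl, this, if_true]
  rw [Submonoid.coe_mul, map_mul, norm_pq, Nat.cast_mul, Complex.natCast_mul_natCast_cpow]
  rw [wq]; ring

end LPIT

open Filter
namespace LPIT
open MeasureTheory Topology Set
open scoped nonZeroDivisors
open NumberField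
variable {K : Type*} [Field K] [NumberField K]

theorem PP_fin (n : ℕ) : Finite {p : PP K // Ideal.absNorm p.1 = n} := by
  have := cf_fin (K := K) n
  exact Finite.of_injective (fun p => (⟨⟨p.1.1, mem_nonZeroDivisors_of_ne_zero p.1.2.2⟩, p.2⟩ :
    {I : (Ideal (𝓞 K))⁰ // Ideal.absNorm (I : Ideal (𝓞 K)) = n}))
    (fun I J h => by ext1; ext1; simpa using h)

/-- coefficients of the prime series -/
noncomputable def lf (K : Type*) [Field K] [NumberField K] (n : ℕ) : ℝ :=
  Nat.card {p : PP K // Ideal.absNorm p.1 = n} * Real.log n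

theorem lf_nonneg (n : ℕ) : 0 ≤ lf K n := mul_nonneg (Nat.cast_nonneg _) (Real.log_natCast_nonneg _)

theorem lf_le (n : ℕ) : lf K n ≤ Module.finrank ℚ K * ArithmeticFunction.vonMangoldt n := by
  classical
  have hfin := PP_fin (K := K) n
  rcases isEmpty_or_nonempty {p : PP K // Ideal.absNorm p.1 = n} with h | ⟨⟨p, hp⟩⟩
  · rw [lf, Nat.card_of_isEmpty]
    simp only [Nat.cast_zero, zero_mul]
    exact mul_nonneg (Nat.cast_nonneg _) ArithmeticFunction.vonMangoldt_nonneg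
  · have hn2 : 2 ≤ n := hp ▸ p.two_le
    -- a rational prime in p
    obtain ⟨l, hl, hlp⟩ : ∃ l : ℕ, l.Prime ∧ (l : 𝓞 K) ∈ p.1 := by
      have hmem : ((n : ℕ) : 𝓞 K) ∈ p.1 := hp ▸ Ideal.absNorm_mem p.1
      have := p.2.1
      have hpf : ((n.primeFactorsList.map (fun x : ℕ => (x : 𝓞 K))).prod) ∈ p.1 := by
        have e : (n.primeFactorsList.map (fun x : ℕ => (x : 𝓞 K))).prod = (n : 𝓞 K) := by
          conv_rhs => rw [← Nat.prod_primeFactorsList (n := n) (by omega)]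
          rw [Nat.cast_list_prod]
        rwa [e]
      rw [← Multiset.prod_coe] at hpf
      obtain ⟨x, hx, hxp⟩ := (p.2.1.multiset_prod_mem_iff_exists_mem _).1 hpf
      rw [Multiset.mem_coe] at hx
      obtain ⟨l, hl, rfl⟩ := List.mem_map.1 hx
      exact ⟨l, Nat.prime_of_mem_primeFactorsList hl, hxp⟩
    have hd : ∀ q : PP K, (l : 𝓞 K) ∈ q.1 → q.1 ∣ Ideal.span {(l : 𝓞 K)} := by
      intro q hq
      rw [Ideal.dvd_span_singleton]; exact hq
    have hNl : Ideal.absNorm (Ideal.span {(l : 𝓞 K)}) = l ^ Module.finrank ℚ K := by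
      rw [Ideal.absNorm_span_natCast, RingOfIntegers.rank]
    have hnl : n ∣ l ^ Module.finrank ℚ K := by
      rw [← hNl, ← hp]
      exact map_dvd Ideal.absNorm (hd p hlp)
    obtain ⟨j, -, hj⟩ := (Nat.dvd_prime_pow hl).1 hnl
    have hj0 : j ≠ 0 := by rintro rfl; simp at hj; omega
    have hall : ∀ q : {q : PP K // Ideal.absNorm q.1 = n}, (l : 𝓞 K) ∈ q.1.1 := by
      intro q
      have hmem : ((n : ℕ) : 𝓞 K) ∈ q.1.1 := by
        have := Ideal.absNorm_mem q.1.1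
        rwa [q.2] at this
      have e : ((n : ℕ) : 𝓞 K) = (l : 𝓞 K) ^ j := by rw [hj, Nat.cast_pow]
      rw [e] at hmem
      exact q.1.2.1.mem_of_pow_mem _ hmem
    have := Fintype.ofFinite {q : PP K // Ideal.absNorm q.1 = n}
    let S : Finset (Ideal (𝓞 K)) := Finset.univ.image (fun q : {q : PP K // Ideal.absNorm q.1 = n} => q.1.1)
    have hcard : S.card = Nat.card {q : PP K // Ideal.absNorm q.1 = n} := by
      rw [Nat.card_eq_fintype_card, Finset.card_image_of_injective]
      · rfl
      · intro a b hab
        ext1; ext1; exact hab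
    have hS : ∏ q ∈ S, q ∣ Ideal.span {(l : 𝓞 K)} := by
      refine Finset.prod_primes_dvd _ ?_ ?_
      · intro a ha
        obtain ⟨q, -, rfl⟩ := Finset.mem_image.1 ha
        exact q.1.prime
      · intro a ha
        obtain ⟨q, -, rfl⟩ := Finset.mem_image.1 ha
        exact hd _ (hall q)
    have hN := map_dvd Ideal.absNorm hS
    rw [map_prod, hNl, Finset.prod_congr rfl (g := fun _ => n), Finset.prod_const, hcard] at hN
    · have hle := Nat.le_of_dvd (pow_pos hl.pos _) hN
      have hlog : Real.log ((n : ℝ) ^ (Nat.card {q : PP K // Ideal.absNorm q.1 = n})) ≤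
          Real.log ((l : ℝ) ^ Module.finrank ℚ K) := by
        apply Real.log_le_log
        · have : (0:ℝ) < n := by exact_mod_cast (by omega : 0 < n)
          positivity
        · exact_mod_cast hle
      rw [Real.log_pow, Real.log_pow] at hlog
      rw [lf, hj, ArithmeticFunction.vonMangoldt_apply_pow hj0, ArithmeticFunction.vonMangoldt_apply_prime hl, ← hj]
      exact hlog
    · intro a ha
      obtain ⟨q, -, rfl⟩ := Finset.mem_image.1 ha
      exact q.2

theorem lf_cheb (n : ℕ) : ∑ k ∈ Finset.Icc 1 n, lf K k ≤
    (Module.finrank ℚ K * (Real.log 4 + 4)) * n := by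
  have h1 : ∑ k ∈ Finset.Icc 1 n, lf K k ≤ Module.finrank ℚ K * Chebyshev.psi n := by
    rw [Chebyshev.psi_eq_sum_Icc, Finset.mul_sum, Nat.floor_natCast]
    calc _ ≤ ∑ k ∈ Finset.Icc 1 n, Module.finrank ℚ K * ArithmeticFunction.vonMangoldt k :=
          Finset.sum_le_sum (fun k _ => lf_le k)
      _ ≤ _ := Finset.sum_le_sum_of_subset_of_nonneg
          (Finset.Icc_subset_Icc (by omega) le_rfl)
          (fun _ _ _ => mul_nonneg (Nat.cast_nonneg _) ArithmeticFunction.vonMangoldt_nonneg)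
  refine h1.trans ?_
  rw [mul_assoc]
  gcongr
  exact Chebyshev.psi_le_const_mul_self (by positivity)

theorem cf_sum (t : ℝ) (ht : 0 ≤ t) : ∑ k ∈ Finset.Icc 1 ⌊t⌋₊, cf K k =
    Nat.card {I : (Ideal (𝓞 K))⁰ // Ideal.absNorm (I : Ideal (𝓞 K)) ≤ t} := by
  have hf := cf_fin (K := K)
  unfold cf
  rw [← Nat.cast_sum, ← Finset.sum_coe_sort, ← Nat.card_sigma]
  congr 1
  refine Nat.card_congr ⟨fun x => ⟨x.2.1, ?_⟩, fun I => ⟨⟨Ideal.absNorm (I.1 : Ideal (𝓞 K)), ?_⟩, ⟨I.1, rfl⟩⟩, ?_, ?_⟩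
  · have h1 := Finset.mem_Icc.1 x.1.2
    rw [← Nat.le_floor_iff ht, x.2.2]
    exact h1.2
  · rw [Finset.mem_Icc, Nat.le_floor_iff ht]
    exact ⟨absNorm_pos (nonZeroDivisors.coe_ne_zero I.1), I.2⟩
  · rintro ⟨⟨k, hk⟩, ⟨I, hI⟩⟩
    change Ideal.absNorm (I : Ideal (𝓞 K)) = k at hI
    cases hI
    rfl
  · rintro ⟨I, hI⟩
    rfl

end LPIT

open Filter
namespace LPIT
open MeasureTheory Topology Set
open scoped nonZeroDivisors
open NumberField
variable {K : Type*} [Field K] [NumberField K]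

theorem group_fiber' {X : Type*} (N : X → ℕ) (hfin : ∀ n, Finite {x // N x = n}) (φ : ℕ → ℂ)
    (h1 : Summable (fun x => ‖φ (N x)‖)) :
      ∑' x, φ (N x) = ∑' n, (Nat.card {x // N x = n} : ℂ) * φ n := by
  rw [← (Equiv.sigmaFiberEquiv N).tsum_eq]
  have h2 := (Equiv.sigmaFiberEquiv N).summable_iff.2 h1.of_norm
  rw [Summable.tsum_sigma (by exact h2)]
  refine tsum_congr (fun n => ?_)
  have := hfin n
  have := Fintype.ofFinite {x // N x = n}
  rw [tsum_fintype, Nat.card_eq_fintype_card]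
  rw [Finset.sum_congr rfl (g := fun _ => φ n) (fun x _ => by simp [Equiv.sigmaFiberEquiv, x.2])]
  simp

theorem D1_sum (hsum : ∀ s : ℂ, 1 < s.re → LSeriesSummable (fun n => (cf K n : ℂ)) s) (s : ℂ)
    (hs : 1 < s.re) : Summable (fun p : PP K => ‖(wq (p, 0) : ℂ) * (nq (p, 0) : ℂ) ^ (-s)‖) := by
  have hDn := dser_summable wq nq wq_nonneg (nq_pos (K := K)) (Dsum hsum) s hs
  exact hDn.comp_injective (i := fun p : PP K => ((p, 0) : PP K × ℕ)) (fun a b h => by simpa using h)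

theorem D1_eq (hsum : ∀ s : ℂ, 1 < s.re → LSeriesSummable (fun n => (cf K n : ℂ)) s) (s : ℂ)
    (hs : 1 < s.re) : LSeries (fun n => (lf K n : ℂ)) s =
      ∑' p : PP K, (wq (p, 0) : ℂ) * (nq (p, 0) : ℂ) ^ (-s) := by
  have h1 := D1_sum hsum s hs
  simp only [wq, nq, zero_add, pow_one] at h1 ⊢
  rw [group_fiber' (fun p : PP K => Ideal.absNorm p.1) PP_fin
    (fun n => (Real.log n : ℂ) * (n : ℂ) ^ (-s)) h1, LSeries]
  refine tsum_congr (fun n => ?_)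
  rcases n.eq_zero_or_pos with h | h
  · subst h; simp
  · rw [LSeries.term_of_ne_zero h.ne', Complex.cpow_neg, lf, div_eq_mul_inv]
    push_cast; ring

theorem R_cont (hsum : ∀ s : ℂ, 1 < s.re → LSeriesSummable (fun n => (cf K n : ℂ)) s) :
    ContinuousOn (fun s : ℂ => ∑' q : PP K × ℕ, (wq (q.1, q.2 + 1) : ℂ) * (nq (q.1, q.2 + 1) : ℂ) ^ (-s))
      {s | 1 ≤ s.re} := by
  have hs1 : Summable (fun p : PP K => wq (p, 0) * (nq (p, 0) : ℝ) ^ (-(3/2 : ℝ))) :=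
    (Dsum hsum (3/2) (by norm_num)).comp_injective (i := fun p : PP K => ((p, 0) : PP K × ℕ))
      (fun a b h => by simpa using h)
  have hs2 : Summable (fun k : ℕ => ((1:ℝ)/2) ^ k) := summable_geometric_two
  have hu := hs1.mul_of_nonneg hs2 (fun p => mul_nonneg (wq_nonneg _) (by positivity))
    (fun k => by positivity)
  refine continuousOn_tsum (fun q => ?_) hu (fun q s hs => ?_)
  · have : (nq (q.1, q.2 + 1) : ℂ) ≠ 0 := by exact_mod_cast (nq_pos _).ne'
    apply Continuous.continuousOn
    exact continuous_const.mul (continuous_neg.const_cpow (Or.inl this))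
  · rw [norm_term (nq_pos _) _ (wq_nonneg _), mul_assoc]
    have e : wq (q.1, q.2 + 1) = wq (q.1, 0) := rfl
    rw [e]
    have := wq_nonneg (q.1, 0)
    gcongr
    have h2 : (2:ℝ) ≤ Ideal.absNorm q.1.1 := by exact_mod_cast q.1.two_le
    simp only [nq, zero_add, pow_one]
    set N : ℝ := ((Ideal.absNorm q.1.1 : ℕ) : ℝ)
    have hN0 : 0 < N := by linarith
    have hs' : 1 ≤ s.re := hs
    have ecast : ((Ideal.absNorm q.1.1 ^ (q.2 + 1 + 1) : ℕ) : ℝ) = N ^ (q.2 + 2) := by push_cast; rfl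
    rw [ecast]
    calc (N ^ (q.2 + 2)) ^ (-s.re) ≤ (N ^ (q.2 + 2)) ^ (-1 : ℝ) := by
          apply Real.rpow_le_rpow_of_exponent_le
          · exact one_le_pow₀ (by linarith)
          · linarith
      _ = N ^ (-(3/2) : ℝ) * N ^ (-(q.2 + 1/2) : ℝ) := by
          rw [← Real.rpow_natCast, ← Real.rpow_mul hN0.le, ← Real.rpow_add hN0]
          congr 1; push_cast; ring
      _ ≤ N ^ (-(3/2) : ℝ) * (1/2) ^ q.2 := by
          gcongr
          calc N ^ (-(q.2 + 1/2) : ℝ) ≤ N ^ (-q.2 : ℝ) := by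
                apply Real.rpow_le_rpow_of_exponent_le <;> linarith
            _ ≤ 2 ^ (-q.2 : ℝ) := by
                apply Real.rpow_le_rpow_of_nonpos <;> simp [h2]
            _ = _ := by
                rw [Real.rpow_neg (by norm_num), Real.rpow_natCast]; simp

theorem D_split (hsum : ∀ s : ℂ, 1 < s.re → LSeriesSummable (fun n => (cf K n : ℂ)) s) (s : ℂ)
    (hs : 1 < s.re) : ∑' q : PP K × ℕ, (wq q : ℂ) * (nq q : ℂ) ^ (-s) =
      (∑' p : PP K, (wq (p, 0) : ℂ) * (nq (p, 0) : ℂ) ^ (-s)) +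
      ∑' q : PP K × ℕ, (wq (q.1, q.2 + 1) : ℂ) * (nq (q.1, q.2 + 1) : ℂ) ^ (-s) := by
  have hDn := (dser_summable wq nq wq_nonneg (nq_pos (K := K)) (Dsum hsum) s hs).of_norm
  have hR : Summable (fun q : PP K × ℕ => (wq (q.1, q.2 + 1) : ℂ) * (nq (q.1, q.2 + 1) : ℂ) ^ (-s)) :=
    hDn.comp_injective (i := fun q : PP K × ℕ => ((q.1, q.2 + 1) : PP K × ℕ)) (fun a b h => by
      simpa [Prod.ext_iff] using h)
  rw [hDn.tsum_prod, hR.tsum_prod, ← Summable.tsum_add (D1_sum hsum s hs).of_norm hR.prod]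
  refine tsum_congr (fun p => ?_)
  exact (hDn.prod_factor p).tsum_eq_zero_add

theorem theta_tendsto : Tendsto (fun x : ℝ => (∑ k ∈ Finset.Icc 1 ⌊x⌋₊, lf K k) / x) atTop (𝓝 1) := by
  obtain ⟨κ, hκ, hcount⟩ := count_ideals K
  have hd : (0:ℝ) < 1 / (2 * (Module.finrank ℚ K : ℝ)) := by
    have : 0 < Module.finrank ℚ K := Module.finrank_pos
    positivity
  set δ : ℝ := 1 / (2 * (Module.finrank ℚ K : ℝ)) with hδ
  have hE : (fun t : ℝ => (∑ k ∈ Finset.Icc 1 ⌊t⌋₊, cf K k) - κ * t) =O[atTop] (fun t : ℝ => t ^ (1 - δ)) := by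
    refine hcount.congr' ?_ EventuallyEq.rfl
    filter_upwards [eventually_ge_atTop 0] with t ht
    rw [cf_sum t ht]
  obtain ⟨hsum, H, hH, hH1, hHs⟩ := continuation (cf K) (fun n => Nat.cast_nonneg _) κ δ hd hE
  set D : ℂ → ℂ := fun s => ∑' q : PP K × ℕ, (wq q : ℂ) * (nq q : ℂ) ^ (-s) with hD
  set R : ℂ → ℂ := fun s => ∑' q : PP K × ℕ, (wq (q.1, q.2 + 1) : ℂ) * (nq (q.1, q.2 + 1) : ℂ) ^ (-s) with hR
  have hder : ∀ s : ℂ, 1 < s.re → deriv H s = H s * (1 / (s - 1) - D s) := by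
    intro s hs
    have hs1 : s - 1 ≠ 0 := by
      intro h; rw [sub_eq_zero] at h; simp [h] at hs
    have hev : H =ᶠ[𝓝 s] fun z => (z - 1) * LSeries (fun n => (cf K n : ℂ)) z := by
      filter_upwards [(isOpen_lt continuous_const Complex.continuous_re).mem_nhds hs] with z hz
      exact hHs z hz
    rw [hev.deriv_eq, hHs s hs]
    have h1 : HasDerivAt (fun z : ℂ => z - 1) 1 s := (hasDerivAt_id s).sub_const 1
    refine (h1.mul (zeta_logderiv hsum s hs)).deriv.trans ?_
    field_simp
    ring
  have hHne := nonvanish H D δ hd hH (by rw [hH1]; exact_mod_cast hκ.ne') hder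
    (fun s hs => dser_bound wq nq wq_nonneg nq_pos (Dsum hsum) s hs)
    (fun h hh t => dser_341 wq nq wq_nonneg nq_pos (Dsum hsum) D (fun _ => rfl) h hh t)
  have hopen : IsOpen {s : ℂ | 1 - δ < s.re} := isOpen_lt continuous_const Complex.continuous_re
  have hsub : {s : ℂ | 1 ≤ s.re} ⊆ {s : ℂ | 1 - δ < s.re} := by
    intro s hs
    simp only [mem_ofPred_eq] at hs ⊢
    linarith
  refine wiener_ikehara (lf K) lf_nonneg _ lf_cheb (fun s => -(deriv H s / H s) - R s) ?_ ?_
  · refine ContinuousOn.sub (ContinuousOn.neg (ContinuousOn.div ?_ ?_ hHne)) (R_cont hsum)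
    · exact ((hH.deriv hopen).continuousOn).mono hsub
    · exact hH.continuousOn.mono hsub
  · intro s hs
    rw [D1_eq hsum s hs]
    have h1 := D_split hsum s hs
    have h2 : deriv H s / H s = 1 / (s - 1) - D s := by
      rw [hder s hs, mul_div_cancel_left₀ _ (hHne s hs.le)]
    change D s = _ + R s at h1
    rw [h2]
    linear_combination h1.symm

end LPIT

open Filter
namespace LPIT
open MeasureTheory Topology Set
open scoped nonZeroDivisors
open NumberField

theorem theta_to_pi (c : ℕ → ℝ) (hc : ∀ n, 0 ≤ c n) (C : ℝ) 
    (hP : ∀ᶠ x : ℝ in atTop, ∑ k ∈ Finset.Icc 1 ⌊x⌋₊, c k ≤ C * x)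
    (hθ : Tendsto (fun x : ℝ => (∑ k ∈ Finset.Icc 1 ⌊x⌋₊, c k * Real.log k) / x) atTop (𝓝 1)) :
    Tendsto (fun x : ℝ => (∑ k ∈ Finset.Icc 1 ⌊x⌋₊, c k) * Real.log x / x) atTop (𝓝 1) := by
  rw [tendsto_order]
  constructor
  · intro b hb
    filter_upwards [(tendsto_order.1 hθ).1 b hb, eventually_gt_atTop 0] with x hx hx0
    refine hx.trans_le ?_
    gcongr
    rw [Finset.sum_mul]
    refine Finset.sum_le_sum (fun k hk => ?_)
    rw [Finset.mem_Icc, Nat.le_floor_iff hx0.le] at hk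
    have h1 : (0:ℝ) < k := by exact_mod_cast hk.1
    exact mul_le_mul_of_nonneg_left (Real.log_le_log h1 hk.2) (hc k)
  · intro b hb
    set a : ℝ := 2 / (1 + b) with ha
    have ha0 : 0 < a := by positivity
    have ha1 : a < 1 := by rw [ha, div_lt_one (by linarith)]; linarith
    have hlim : Tendsto (fun x : ℝ => C * (Real.log x / x ^ (1 - a)) +
        (∑ k ∈ Finset.Icc 1 ⌊x⌋₊, c k * Real.log k) / x * (1 / a)) atTop (𝓝 (C * 0 + 1 * (1 / a))) := by
      refine (Tendsto.const_mul _ ?_).add (hθ.mul_const _)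
      exact (isLittleO_log_rpow_atTop (by linarith)).tendsto_div_nhds_zero
    have hlt : C * 0 + 1 * (1 / a) < b := by
      rw [ha]; field_simp; linarith
    filter_upwards [(tendsto_order.1 hlim).2 b hlt, (tendsto_rpow_atTop ha0).eventually hP,
      eventually_gt_atTop 1] with x hx hPx hx1
    refine lt_of_le_of_lt ?_ hx
    have hx0 : 0 < x := by linarith
    have hlog : 0 < Real.log x := Real.log_pos hx1
    have hmain : ∑ k ∈ Finset.Icc 1 ⌊x⌋₊, c k ≤ ∑ k ∈ Finset.Icc 1 ⌊x ^ a⌋₊, c k +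
        (∑ k ∈ Finset.Icc 1 ⌊x⌋₊, c k * Real.log k) * (1 / (a * Real.log x)) := by
      rw [← Finset.sum_filter_add_sum_filter_not (Finset.Icc 1 ⌊x⌋₊) (fun k : ℕ => (k : ℝ) ≤ x ^ a)]
      refine add_le_add ?_ ?_
      · refine Finset.sum_le_sum_of_subset_of_nonneg ?_ (fun k _ _ => hc k)
        intro k hk
        rw [Finset.mem_filter, Finset.mem_Icc] at hk
        rw [Finset.mem_Icc, Nat.le_floor_iff (by positivity)]
        exact ⟨hk.1.1, hk.2⟩
      · rw [Finset.sum_mul]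
        refine le_trans ?_ (Finset.sum_le_sum_of_subset_of_nonneg (Finset.filter_subset (fun k : ℕ => ¬ (k : ℝ) ≤ x ^ a) (Finset.Icc 1 ⌊x⌋₊)) ?_)
        · refine Finset.sum_le_sum (fun k hk => ?_)
          rw [Finset.mem_filter, not_le] at hk
          have h1 : a * Real.log x ≤ Real.log k := by
            rw [← Real.log_rpow hx0]
            exact Real.log_le_log (by positivity) hk.2.le
          have h2 : 1 ≤ Real.log k * (1 / (a * Real.log x)) := by
            rw [mul_one_div, le_div_iff₀ (by positivity)]; linarith
          calc c k = c k * 1 := (mul_one _).symm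
            _ ≤ c k * (Real.log k * (1 / (a * Real.log x))) := mul_le_mul_of_nonneg_left h2 (hc k)
            _ = _ := by ring
        · intro k _ _
          have := hc k
          have := Real.log_natCast_nonneg k
          positivity
    have hmain2 := hmain.trans (add_le_add_left hPx _)
    calc (∑ k ∈ Finset.Icc 1 ⌊x⌋₊, c k) * Real.log x / x
        ≤ (C * x ^ a + (∑ k ∈ Finset.Icc 1 ⌊x⌋₊, c k * Real.log k) * (1 / (a * Real.log x))) *
          Real.log x / x := by gcongr
      _ = _ := by
        rw [Real.rpow_sub hx0, Real.rpow_one]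
        have : x ^ a ≠ 0 := by positivity
        field_simp

variable {K : Type*} [Field K] [NumberField K]

theorem pi_sum (t : ℝ) (ht : 0 ≤ t) :
    (Nat.card {p : Ideal (𝓞 K) // p.IsPrime ∧ p ≠ ⊥ ∧ (Ideal.absNorm p : ℝ) ≤ t} : ℝ) =
    ∑ k ∈ Finset.Icc 1 ⌊t⌋₊, (Nat.card {p : PP K // Ideal.absNorm p.1 = k} : ℝ) := by
  have hf := PP_fin (K := K)
  rw [← Nat.cast_sum, ← Finset.sum_coe_sort, ← Nat.card_sigma]
  congr 1
  symm
  refine Nat.card_congr ⟨fun x => ⟨x.2.1.1, x.2.1.2.1, x.2.1.2.2, ?_⟩,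
    fun I => ⟨⟨Ideal.absNorm I.1, ?_⟩, ⟨⟨I.1, I.2.1, I.2.2.1⟩, rfl⟩⟩, ?_, ?_⟩
  · have h1 := Finset.mem_Icc.1 x.1.2
    rw [← Nat.le_floor_iff ht, x.2.2]
    exact h1.2
  · rw [Finset.mem_Icc, Nat.le_floor_iff ht]
    exact ⟨absNorm_pos I.2.2.1, I.2.2.2⟩
  · rintro ⟨⟨k, hk⟩, ⟨I, hI⟩⟩
    change Ideal.absNorm I.1 = k at hI
    cases hI
    rfl
  · rintro ⟨I, hI⟩
    rfl

theorem PP_le_cf (n : ℕ) : (Nat.card {p : PP K // Ideal.absNorm p.1 = n} : ℝ) ≤ cf K n := by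
  have := cf_fin (K := K) n
  rw [cf, Nat.cast_le]
  exact Nat.card_le_card_of_injective (fun p => (⟨⟨p.1.1, mem_nonZeroDivisors_of_ne_zero p.1.2.2⟩, p.2⟩ :
    {I : (Ideal (𝓞 K))⁰ // Ideal.absNorm (I : Ideal (𝓞 K)) = n}))
    (fun I J h => by ext1; ext1; simpa using h)

theorem main (K : Type*) [Field K] [NumberField K] : Tendsto (fun T : ℝ =>
    (Nat.card {p : Ideal (𝓞 K) // p.IsPrime ∧ p ≠ ⊥ ∧ (Ideal.absNorm p : ℝ) ≤ T} : ℝ) * Real.log T / T)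
    atTop (𝓝 1) := by
  have hlim := NumberField.Ideal.tendsto_norm_le_div_atTop₀ K
  have h1 := theta_to_pi (fun k => (Nat.card {p : PP K // Ideal.absNorm p.1 = k} : ℝ))
    (fun n => Nat.cast_nonneg _) _ (by
      filter_upwards [(tendsto_order.1 hlim).2 _ (lt_add_one _), eventually_gt_atTop 0] with x hx hx0
      refine (Finset.sum_le_sum (fun k _ => PP_le_cf k)).trans ?_
      rw [cf_sum x hx0.le]
      rw [div_lt_iff₀ hx0] at hx
      exact hx.le) theta_tendsto
  refine h1.congr' ?_
  filter_upwards [eventually_ge_atTop 0] with t ht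
  rw [pi_sum t ht]

end LPIT

open NumberField Filter

theorem landau_prime_ideal_theorem
    (K : Type*) [Field K] [NumberField K] :
    Tendsto (fun T : ℝ =>
        (Nat.card {p : Ideal (𝓞 K) // p.IsPrime ∧ p ≠ ⊥ ∧ (Ideal.absNorm p : ℝ) ≤ T} : ℝ)
          * Real.log T / T)
      atTop (nhds 1) := by
  exact LPIT.main K
end
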